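/- Fix c ∈ {6, 7}. There exists B0 ≥ 1 such that for every B ≥ B0 there is a constant C' > 0 with the following property: for every sufficiently large integer n, ∫_{𝕽_c \ 𝔐} |F_c(α)| dα ≤ C' · n^{Θ_c} · L^{−1}. Here 𝕽_c ⊆ [0,1] is the union of the intervals 𝕽_c(q,a) = {α ∈ [0,1] : |qα − a| ≤ Q_c / n} over integers a, q with 0 ≤ a ≤ q, gcd(a,q) = 1 and 1 ≤ q ≤ Q_c, where Q_c = n^{2/(3c^2(c−1))}; and 𝔐 ⊆ [0,1] is the union of the intervals 𝔐(q,a) = {α ∈ [0,1] : |α − a/q| ≤ L^B / n} over integers a, q with 0 ≤ a ≤ q, gcd(a,q) = 1 and 1 ≤ q ≤ L^B. -/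

import Mathlib

open MeasureTheory Finset

noncomputable section

/-- `e(x) = exp(2πix)`. -/
def e (x : ℝ) : ℂ := Complex.exp (2 * Real.pi * Complex.I * x)

/-- `P_k = n^(1/k)`. -/
def P (n k : ℕ) : ℝ := (n : ℝ) ^ ((k : ℝ))⁻¹

/-- `θ_6 = 5/6`, `θ_7 = 87/98`. -/
def θ (c : ℕ) : ℝ := if c = 6 then 5 / 6 else 87 / 98

/-- `Θ_c = 2/3 + θ_c/5 + 1/6 + 1/c`. -/
def Θ (c : ℕ) : ℝ := 2 / 3 + θ c / 5 + 1 / 6 + ((c : ℝ))⁻¹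

/-- `f_k(α) = Σ_{P_k/2 < p ≤ P_k, p prime} e(α p^k) log p`. -/
def f (n k : ℕ) (α : ℝ) : ℂ :=
  ∑ p ∈ (Finset.range (n + 1)).filter
      (fun p : ℕ => p.Prime ∧ P n k / 2 < (p : ℝ) ∧ (p : ℝ) ≤ P n k),
    e (α * (p : ℝ) ^ k) * (Real.log p)

/-- `f_{5,c}(α) = Σ_{1 < p ≤ P_5^{θ_c}, p prime} e(α p^5) log p`. -/
def f5 (n c : ℕ) (α : ℝ) : ℂ :=
  ∑ p ∈ (Finset.range (n + 1)).filter
      (fun p : ℕ => p.Prime ∧ 1 < (p : ℝ) ∧ (p : ℝ) ≤ P n 5 ^ θ c),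
    e (α * (p : ℝ) ^ 5) * (Real.log p)

/-- `F_c(α) = f_2(α)^2 f_3(α)^2 f_{5,c}(α) f_6(α) f_c(α)`. -/
def F (n c : ℕ) (α : ℝ) : ℂ :=
  f n 2 α ^ 2 * f n 3 α ^ 2 * f5 n c α * f n 6 α * f n c α

/-- `S_k(q,a) = Σ_{x=1,(x,q)=1}^{q} e(a x^k / q)`. -/
def S (k q a : ℕ) : ℂ :=
  ∑ x ∈ (Finset.Icc 1 q).filter (fun x => Nat.gcd x q = 1),
    e ((a : ℝ) * (x : ℝ) ^ k / q)

/-- `v_k(β) = (1/k) Σ_{2^{-k} n < m ≤ n} m^{1/k-1} e(β m)`. -/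
def v (n k : ℕ) (β : ℝ) : ℂ :=
  ((k : ℂ))⁻¹ *
    ∑ m ∈ (Finset.Icc 1 n).filter (fun m : ℕ => (n : ℝ) / 2 ^ k < (m : ℝ)),
      ((m : ℝ) ^ ((k : ℝ)⁻¹ - 1) : ℝ) * e (β * m)

/-- `w_c(β) = v_2(β)^2 v_3(β)^2 v_6(β) v_c(β)`. -/
def w (n c : ℕ) (β : ℝ) : ℂ := v n 2 β ^ 2 * v n 3 β ^ 2 * v n 6 β * v n c β

/-- `U_c(q,a) = S_2(q,a)^2 S_3(q,a)^2 S_5(q,a) S_6(q,a) S_c(q,a)`. -/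
def U (c q a : ℕ) : ℂ := S 2 q a ^ 2 * S 3 q a ^ 2 * S 5 q a * S 6 q a * S c q a

/-- `A_{n,c}(q) = Σ_{a=1,(a,q)=1}^{q} U_c(q,a) e(-a n / q)`. -/
def A (n : ℤ) (c q : ℕ) : ℂ :=
  ∑ a ∈ (Finset.Icc 1 q).filter (fun a => Nat.gcd a q = 1),
    U c q a * e (-((a : ℝ) * (n : ℝ)) / q)

/-- The major arcs `𝔐`. -/
def Maj (n : ℕ) (B : ℝ) : Set ℝ :=
  {α | α ∈ Set.Icc (0 : ℝ) 1 ∧ ∃ a q : ℕ, a ≤ q ∧ 1 ≤ q ∧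
    (q : ℝ) ≤ Real.log n ^ B ∧ Nat.gcd a q = 1 ∧
    |α - (a : ℝ) / q| ≤ Real.log n ^ B / n}

/-- `Q_c = n^{2/(3c²(c-1))}`. -/
def Q (n c : ℕ) : ℝ := (n : ℝ) ^ (2 / (3 * (c : ℝ) ^ 2 * ((c : ℝ) - 1)))

/-- The arcs `𝕽_c`. -/
def R (n c : ℕ) : Set ℝ :=
  {α | α ∈ Set.Icc (0 : ℝ) 1 ∧ ∃ a q : ℕ, a ≤ q ∧ 1 ≤ q ∧
    (q : ℝ) ≤ Q n c ∧ Nat.gcd a q = 1 ∧ |(q : ℝ) * α - a| ≤ Q n c / n}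

/-- `τ = 2^{-20}`. -/
def τ : ℝ := ((2 : ℝ) ^ (20 : ℕ))⁻¹

/-- The sets `𝓔_c`. -/
def E (n c : ℕ) : Set ℝ :=
  {α | α ∈ Set.Icc (0 : ℝ) 1 ∧
    ‖f n c α‖ ≤ P n c ^ (if c = 6 then 1 - 24 * τ else 139 / 140 - 24 * τ)}

end

/-- number of `k`-th roots of unity modulo `q`. -/
noncomputable def rc (k q : ℕ) : ℕ := Nat.card (powMonoidHom k : (ZMod q)ˣ →* (ZMod q)ˣ).ker

lemma rc_cyclic (k : ℕ) (hk : 0 < k) (G : Type*) [CommGroup G] [Finite G] [IsCyclic G] :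
    Nat.card (powMonoidHom k : G →* G).ker ≤ k := by
  classical
  have := Fintype.ofFinite G
  have h := IsCyclic.card_pow_eq_one_le (α := G) hk
  rw [Nat.card_eq_fintype_card]
  refine le_trans (le_of_eq ?_) h
  rw [Fintype.card_subtype]
  congr 1
  ext x
  simp [MonoidHom.mem_ker]

lemma rc_two (k n : ℕ) (hk : 0 < k) : rc k (2 ^ n) ≤ 2 * k := by
  rcases n with _ | _ | n
  · have : IsCyclic (ZMod (2 ^ 0))ˣ := by simpa using ZMod.isCyclic_units_one
    exact (rc_cyclic k hk _).trans (by omega)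
  · have : IsCyclic (ZMod (2 ^ (0+1)))ˣ := by simpa using ZMod.isCyclic_units_two
    exact (rc_cyclic k hk _).trans (by omega)
  · have h5 := ZMod.orderOf_five n
    have hu : IsUnit (5 : ZMod (2 ^ (n + 1 + 1))) := by
      have : ((5 : ℕ) : ZMod (2 ^ (n + 1 + 1))) = 5 := by norm_num
      rw [← this, ZMod.isUnit_iff_coprime]
      exact Nat.Coprime.pow_right _ (by norm_num)
    obtain ⟨u, hu⟩ := hu
    have hou : orderOf u = 2 ^ n := by
      rw [← orderOf_units, hu]; exact h5
    set Z := Subgroup.zpowers u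
    set K := (powMonoidHom k : (ZMod (2 ^ (n + 1 + 1)))ˣ →* (ZMod (2 ^ (n + 1 + 1)))ˣ).ker
    have hZ : Nat.card Z = 2 ^ n := by rw [Nat.card_zpowers, hou]
    have hG : Nat.card (ZMod (2 ^ (n + 1 + 1)))ˣ = 2 ^ (n+1) := by
      rw [Nat.card_eq_fintype_card, ZMod.card_units_eq_totient, Nat.totient_prime_pow_succ Nat.prime_two]
      simp
    have hidx : Z.index = 2 := by
      have := Z.card_mul_index
      rw [hZ, hG] at this
      exact Nat.eq_of_mul_eq_mul_left (by positivity : 0 < 2 ^ n) (this.trans (pow_succ 2 n))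
    have h1 : Z.relIndex K ≤ 2 := by
      exact (Nat.le_of_dvd (by omega) (Subgroup.relIndex_dvd_index_of_normal Z K)).trans hidx.le
    have h2 : Nat.card K = Nat.card (Z ⊓ K : Subgroup _) * Z.relIndex K := by
      have := (Z.subgroupOf K).card_mul_index
      rw [← this]
      congr 1
      exact Nat.card_congr (Subgroup.subgroupOfEquivOfLe (H := Z ⊓ K) (K := K) inf_le_right |>.toEquiv) |>.symm.trans (by rw [Subgroup.inf_subgroupOf_right]) |>.symm
    have h3 : Nat.card (Z ⊓ K : Subgroup _) ≤ k := by
      refine le_trans ?_ (rc_cyclic k hk Z)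
      refine Nat.card_le_card_of_injective (fun x => ⟨⟨x.1, x.2.1⟩, ?_⟩) ?_
      · have : x.1 ∈ K := x.2.2
        rw [MonoidHom.mem_ker] at this ⊢
        ext
        simpa using congrArg Units.val this
      · intro x y h
        simp at h
        exact h
    change Nat.card K ≤ _
    rw [h2]
    nlinarith

lemma rc_mul (k m n : ℕ) (h : m.Coprime n) :
    rc k (m * n) = rc k m * rc k n := by
  let E : (ZMod (m*n))ˣ ≃* (ZMod m)ˣ × (ZMod n)ˣ :=
    (Units.mapEquiv (ZMod.chineseRemainder h).toMulEquiv).trans MulEquiv.prodUnits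
  unfold rc
  rw [← Nat.card_prod]
  refine Nat.card_congr ⟨fun x => ⟨⟨(E x.1).1, ?_⟩, ⟨(E x.1).2, ?_⟩⟩, fun y => ⟨E.symm (y.1.1, y.2.1), ?_⟩, ?_, ?_⟩
  · have := x.2
    rw [MonoidHom.mem_ker] at this ⊢
    simp only [powMonoidHom_apply] at this ⊢
    rw [← Prod.pow_fst, ← map_pow, this]; simp
  · have := x.2
    rw [MonoidHom.mem_ker] at this ⊢
    simp only [powMonoidHom_apply] at this ⊢
    rw [← Prod.pow_snd, ← map_pow, this]; simp
  · have h1 := y.1.2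
    have h2 := y.2.2
    rw [MonoidHom.mem_ker] at *
    simp only [powMonoidHom_apply] at *
    rw [← map_pow, Prod.pow_mk, h1, h2]; simp
  · intro x; ext; simp
  · intro y; ext <;> simp

lemma rc_le (k : ℕ) (hk : 0 < k) (q : ℕ) (hq : 0 < q) :
    rc k q ≤ (2 * k) ^ q.primeFactors.card := by
  induction q using Nat.recOnPosPrimePosCoprime with
  | prime_pow p n hp hn =>
    rw [Nat.primeFactors_prime_pow hn.ne' hp]
    simp only [card_singleton, pow_one]
    by_cases h2 : p = 2
    · subst h2; exact rc_two k n hk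
    · have := ZMod.isCyclic_units_of_prime_pow p hp h2 n
      have : NeZero (p ^ n) := ⟨hq.ne'⟩
      exact (rc_cyclic k hk _).trans (by omega)
  | zero => omega
  | one =>
    simp
    have : IsCyclic (ZMod 1)ˣ := ZMod.isCyclic_units_one
    unfold rc
    have : Subsingleton (powMonoidHom k : (ZMod 1)ˣ →* (ZMod 1)ˣ).ker := by infer_instance
    exact (Nat.card_of_subsingleton (1 : (powMonoidHom k : (ZMod 1)ˣ →* (ZMod 1)ˣ).ker)).le
  | coprime a b ha hb hab iha ihb =>
    rw [rc_mul k a b hab, hab.primeFactors_mul, card_union_of_disjoint hab.disjoint_primeFactors, pow_add]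
    exact Nat.mul_le_mul (iha (by omega)) (ihb (by omega))

lemma rc_bound (k : ℕ) (hk : 0 < k) :
    ∃ C : ℝ, 1 ≤ C ∧ ∀ q : ℕ, 0 < q → (rc k q : ℝ) ≤ C * (q : ℝ) ^ (1/10 : ℝ) := by
  set T := (2 * k) ^ 10
  refine ⟨(2 * k : ℝ) ^ T, one_le_pow₀ (by exact_mod_cast (by omega : 1 ≤ 2 * k)), fun q hq => ?_⟩
  have h1 : (rc k q : ℝ) ≤ (2 * k : ℝ) ^ q.primeFactors.card := by exact_mod_cast rc_le k hk q hq
  refine h1.trans ?_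
  have hk1 : (1 : ℝ) ≤ 2 * k := by exact_mod_cast (by omega : 1 ≤ 2 * k)
  rw [← prod_const]
  calc ∏ _p ∈ q.primeFactors, (2 * k : ℝ)
      ≤ ∏ p ∈ q.primeFactors, ((if p < T then (2 * k : ℝ) else 1) * (p : ℝ) ^ (1/10 : ℝ)) := by
        refine prod_le_prod (fun _ _ => by positivity) fun p hp => ?_
        have hp1 : (1:ℝ) ≤ p := by exact_mod_cast (Nat.prime_of_mem_primeFactors hp).one_lt.le
        split_ifs with h
        · exact le_mul_of_one_le_right (by positivity) (Real.one_le_rpow hp1 (by norm_num))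
        · rw [one_mul]
          have : ((2 * k : ℝ)) ^ (10:ℕ) ≤ p := by
            have : (2 * k) ^ 10 ≤ p := by simpa [T] using h
            exact_mod_cast this
          calc (2 * k : ℝ) = ((2 * k : ℝ) ^ (10:ℕ)) ^ (1/10 : ℝ) := by
                rw [← Real.rpow_natCast, ← Real.rpow_mul (by positivity)]; norm_num
            _ ≤ _ := Real.rpow_le_rpow (by positivity) this (by norm_num)
    _ = (∏ p ∈ q.primeFactors, (if p < T then (2 * k : ℝ) else 1)) * ∏ p ∈ q.primeFactors, (p : ℝ) ^ (1/10 : ℝ) := prod_mul_distrib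
    _ ≤ (2 * k : ℝ) ^ T * (q : ℝ) ^ (1/10 : ℝ) := by
        gcongr
        · rw [← prod_filter, prod_const]
          refine pow_le_pow_right₀ hk1 ?_
          calc _ ≤ (range T).card := card_le_card fun p hp => by simpa using (mem_filter.1 hp).2
            _ = T := card_range T
        · rw [Real.finsetProd_rpow _ _ (fun _ _ => by positivity)]
          refine Real.rpow_le_rpow (prod_nonneg fun _ _ => by positivity) ?_ (by norm_num)
          rw [← Nat.cast_prod]
          exact Nat.cast_le.2 (Nat.le_of_dvd hq (Nat.prod_primeFactors_dvd q))

lemma rc_fiber (k q : ℕ) [NeZero q] (b : (ZMod q)ˣ) (x : ZMod q) :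
    ((univ : Finset (ZMod q)ˣ).filter (fun u : (ZMod q)ˣ => (b : ZMod q) * (u : ZMod q) ^ k = x)).card ≤ rc k q := by
  classical
  rcases Finset.eq_empty_or_nonempty ((univ : Finset (ZMod q)ˣ).filter (fun u : (ZMod q)ˣ => (b : ZMod q) * (u : ZMod q) ^ k = x)) with h | ⟨u0, hu0⟩
  · rw [h]; simp
  · rw [mem_filter] at hu0
    unfold rc
    rw [Nat.card_eq_fintype_card, Fintype.card_subtype]
    refine card_le_card_of_injOn (fun u => u * u0⁻¹) ?_ ?_
    · intro u hu
      simp only [coe_filter, mem_univ, true_and, Set.mem_ofPred_eq] at hu ⊢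
      rw [MonoidHom.mem_ker, powMonoidHom_apply, mul_pow, inv_pow, mul_inv_eq_one]
      have : (b : ZMod q) * (u : ZMod q) ^ k = b * (u0 : ZMod q) ^ k := by rw [hu, hu0.2]
      ext
      push_cast
      exact b.isUnit.mul_left_cancel this
    · intro u _ v _ h
      simpa using h

lemma norm_chi {q : ℕ} [NeZero q] (x : ZMod q) : ‖ZMod.stdAddChar x‖ = 1 := by
  rw [ZMod.stdAddChar_apply]; exact Circle.norm_coe _

lemma conj_chi {q : ℕ} [NeZero q] (x : ZMod q) : (starRingEnd ℂ) (ZMod.stdAddChar x) = ZMod.stdAddChar (-x) := by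
  rw [AddChar.map_neg_eq_inv, Complex.inv_def, Complex.normSq_eq_norm_sq, norm_chi]; simp

lemma sum_chi_mul {q : ℕ} [NeZero q] (h : ZMod q) :
    ∑ x : ZMod q, ZMod.stdAddChar (x * h) = if h = 0 then (q : ℂ) else 0 := by
  have := AddChar.sum_mulShift h (ZMod.isPrimitive_stdAddChar q)
  rw [this, ZMod.card]
  split_ifs <;> simp

/-- orthogonality. -/
lemma orth {q : ℕ} [NeZero q] {ι : Type*} (s : Finset ι) (g : ι → ℂ) (h : ι → ZMod q) :
    ((∑ x : ZMod q, ‖∑ i ∈ s, g i * ZMod.stdAddChar (x * h i)‖ ^ 2 : ℝ) : ℂ) =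
      q * ∑ i ∈ s, ∑ j ∈ s, if h i = h j then g i * (starRingEnd ℂ) (g j) else 0 := by
  push_cast
  have : ∀ x : ZMod q, ((‖∑ i ∈ s, g i * ZMod.stdAddChar (x * h i)‖ : ℝ) : ℂ) ^ 2 =
      ∑ i ∈ s, ∑ j ∈ s, (g i * (starRingEnd ℂ) (g j)) * ZMod.stdAddChar (x * (h i - h j)) := by
    intro x
    rw [← Complex.mul_conj', map_sum, sum_mul_sum]
    refine sum_congr rfl fun i _ => sum_congr rfl fun j _ => ?_
    rw [(starRingEnd ℂ).map_mul, conj_chi, mul_sub, sub_eq_add_neg, AddChar.map_add_eq_mul]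
    ring
  simp_rw [this]
  rw [sum_comm, mul_sum]
  refine sum_congr rfl fun i _ => ?_
  rw [sum_comm, mul_sum]
  refine sum_congr rfl fun j _ => ?_
  rw [← mul_sum, sum_chi_mul]
  simp only [sub_eq_zero]
  split_ifs <;> ring

/-- reduced Gauss sum. -/
noncomputable def GS (k q : ℕ) [NeZero q] (x : ZMod q) : ℂ :=
  ∑ u : (ZMod q)ˣ, ZMod.stdAddChar (x * (u : ZMod q) ^ k)

lemma sum_units_le (k q : ℕ) [NeZero q] (b : (ZMod q)ˣ) (F : ZMod q → ℝ) (hF : ∀ x, 0 ≤ F x) :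
    ∑ u : (ZMod q)ˣ, F (b * (u : ZMod q) ^ k) ≤ rc k q * ∑ x, F x := by
  classical
  rw [← sum_fiberwise (s := univ) (g := fun u : (ZMod q)ˣ => (b : ZMod q) * (u : ZMod q) ^ k), mul_sum]
  refine sum_le_sum fun x _ => ?_
  calc _ = ∑ i ∈ univ.filter (fun u : (ZMod q)ˣ => (b : ZMod q) * (u : ZMod q) ^ k = x), F x := by
        refine sum_congr rfl fun u hu => ?_
        rw [(mem_filter.1 hu).2]
    _ = ((univ : Finset (ZMod q)ˣ).filter (fun u : (ZMod q)ˣ => (b : ZMod q) * (u : ZMod q) ^ k = x)).card * F x := by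
        rw [sum_const, nsmul_eq_mul]
    _ ≤ _ := mul_le_mul_of_nonneg_right (by exact_mod_cast rc_fiber k q b x) (hF x)

lemma GS_bound (k q : ℕ) [NeZero q] (b : (ZMod q)ˣ) : ‖GS k q b‖ ≤ rc k q * Real.sqrt q := by
  have h1 : ∀ v : (ZMod q)ˣ, GS k q (b * (v : ZMod q) ^ k) = GS k q b := by
    intro v
    unfold GS
    rw [← Equiv.sum_comp (Equiv.mulLeft v) (fun u => ZMod.stdAddChar ((b : ZMod q) * (u : ZMod q) ^ k))]
    refine sum_congr rfl fun u _ => ?_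
    simp only [Equiv.coe_mulLeft, Units.val_mul, mul_pow, mul_assoc]
  have h2 := sum_units_le k q b (fun x => ‖GS k q x‖ ^ 2) (fun _ => by positivity)
  simp only [h1, sum_const, nsmul_eq_mul] at h2
  have h3 : ∑ x : ZMod q, ‖GS k q x‖ ^ 2 ≤ q * ((univ : Finset (ZMod q)ˣ).card * rc k q) := by
    have := orth (q := q) (univ : Finset (ZMod q)ˣ) (fun _ => 1) (fun u => (u : ZMod q) ^ k)
    simp only [one_mul, map_one, mul_one] at this
    have h4 : ∑ x : ZMod q, ‖GS k q x‖ ^ 2 = q * ∑ i : (ZMod q)ˣ, ∑ j : (ZMod q)ˣ, if (i : ZMod q) ^ k = (j : ZMod q) ^ k then (1 : ℝ) else 0 := by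
      have h5 : ((∑ x : ZMod q, ‖GS k q x‖ ^ 2 : ℝ) : ℂ) = ((q * ∑ i : (ZMod q)ˣ, ∑ j : (ZMod q)ˣ, if (i : ZMod q) ^ k = (j : ZMod q) ^ k then (1 : ℝ) else 0 : ℝ) : ℂ) := by
        unfold GS
        rw [this]
        push_cast
        congr 1
        refine sum_congr rfl fun i _ => sum_congr rfl fun j _ => ?_
        split_ifs <;> simp
      exact_mod_cast h5
    rw [h4]
    refine mul_le_mul_of_nonneg_left ?_ (by positivity)
    calc _ ≤ ∑ i : (ZMod q)ˣ, (rc k q : ℝ) := by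
          refine sum_le_sum fun i _ => ?_
          rw [← sum_filter, sum_const, nsmul_eq_mul, mul_one]
          have := rc_fiber k q 1 ((i : ZMod q) ^ k)
          simp only [Units.val_one, one_mul] at this
          simp only [eq_comm (a := (i : ZMod q) ^ k)]
          exact_mod_cast this
      _ = _ := by rw [sum_const, nsmul_eq_mul]
  have hpos : (0 : ℝ) < (univ : Finset (ZMod q)ˣ).card := by
    exact_mod_cast card_pos.2 ⟨1, mem_univ _⟩
  have h6 : ‖GS k q b‖ ^ 2 ≤ (rc k q * Real.sqrt q) ^ 2 := by
    rw [mul_pow, Real.sq_sqrt (by positivity)]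
    have : (rc k q : ℝ) * ∑ x : ZMod q, ‖GS k q x‖ ^ 2 ≤ rc k q * (q * ((univ : Finset (ZMod q)ˣ).card * rc k q)) :=
      mul_le_mul_of_nonneg_left h3 (by positivity)
    refine le_of_mul_le_mul_left ?_ hpos
    linarith
  exact le_trans (le_abs_self _) (abs_le_of_sq_le_sq h6 (by positivity))

lemma e_add (x y : ℝ) : e (x + y) = e x * e y := by
  unfold e; rw [← Complex.exp_add]; push_cast; ring_nf

lemma norm_e (x : ℝ) : ‖e x‖ = 1 := by
  unfold e
  rw [show (2 * Real.pi * Complex.I * x : ℂ) = ((2 * Real.pi * x : ℝ) : ℂ) * Complex.I by push_cast; ring]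
  exact Complex.norm_exp_ofReal_mul_I _

lemma conj_e (x : ℝ) : (starRingEnd ℂ) (e x) = e (-x) := by
  unfold e; rw [← Complex.exp_conj]; simp [Complex.conj_ofNat]

lemma hasDerivAt_e (c y : ℝ) : HasDerivAt (fun y : ℝ => e (c * y)) (2 * Real.pi * Complex.I * c * e (c * y)) y := by
  unfold e
  have h : HasDerivAt (fun y : ℝ => (2 * Real.pi * Complex.I * ((c * y : ℝ) : ℂ) : ℂ)) (2 * Real.pi * Complex.I * c) y := by
    have := ((Complex.ofRealCLM.hasDerivAt (x := y)).const_mul (2 * Real.pi * Complex.I * c : ℂ))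
    simp at this
    have heq : (fun y : ℝ => (2 * Real.pi * Complex.I * ((c * y : ℝ) : ℂ) : ℂ)) = fun y : ℝ => 2 * Real.pi * Complex.I * c * (y : ℂ) := by
      funext y; push_cast; ring
    rw [heq]
    exact this
  have := h.cexp
  convert this using 1
  ring

lemma continuous_e : Continuous e := by
  unfold e; fun_prop

lemma chi_eq_e {q : ℕ} [NeZero q] (j : ℕ) : ZMod.stdAddChar (j : ZMod q) = e ((j : ℝ) / q) := by
  have := ZMod.stdAddChar_coe (N := q) (j : ℤ)
  push_cast at this
  rw [this]; unfold e; push_cast; congr 1; ring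

lemma sobolev (φ φ' : ℝ → ℂ) (h : ∀ y, HasDerivAt φ (φ' y) y) (hc : Continuous φ') (y0 Δ : ℝ) (hΔ : 0 < Δ) :
    ‖φ y0‖ ^ 2 ≤ 2 / Δ * (∫ y in y0..(y0 + Δ), ‖φ y‖ ^ 2) + 2 * Δ * ∫ y in y0..(y0 + Δ), ‖φ' y‖ ^ 2 := by
  have hφ : Continuous φ := continuous_iff_continuousAt.2 fun y => (h y).continuousAt
  have hle : y0 ≤ y0 + Δ := by linarith
  set J := ∫ y in y0..(y0 + Δ), ‖φ' y‖ with hJ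
  have hJ0 : 0 ≤ J := intervalIntegral.integral_nonneg hle fun _ _ => norm_nonneg _
  have h1 : ∀ y ∈ Set.Icc y0 (y0 + Δ), ‖φ y0‖ ^ 2 ≤ 2 * ‖φ y‖ ^ 2 + 2 * J ^ 2 := by
    intro y hy
    have h2 : ∫ t in y0..y, φ' t = φ y - φ y0 :=
      intervalIntegral.integral_eq_sub_of_hasDerivAt (fun t _ => h t) (hc.intervalIntegrable _ _)
    have h3 : ‖φ y - φ y0‖ ≤ J := by
      rw [← h2]
      refine (intervalIntegral.norm_integral_le_integral_norm hy.1).trans ?_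
      exact intervalIntegral.integral_mono_interval le_rfl hy.1 hy.2
        (Filter.Eventually.of_forall fun _ => norm_nonneg _) (hc.norm.intervalIntegrable _ _)
    have h4 : ‖φ y0‖ ≤ ‖φ y‖ + J := by
      calc ‖φ y0‖ = ‖φ y - (φ y - φ y0)‖ := by congr 1; ring
        _ ≤ _ := (norm_sub_le _ _).trans (by linarith)
    calc ‖φ y0‖ ^ 2 ≤ (‖φ y‖ + J) ^ 2 := by gcongr
      _ ≤ _ := by nlinarith [sq_nonneg (‖φ y‖ - J)]
  have h5 : J ^ 2 ≤ Δ * ∫ y in y0..(y0 + Δ), ‖φ' y‖ ^ 2 := by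
    have h6 : 0 ≤ ∫ y in y0..(y0 + Δ), (‖φ' y‖ - J / Δ) ^ 2 :=
      intervalIntegral.integral_nonneg hle fun _ _ => sq_nonneg _
    have h7 : ∫ y in y0..(y0 + Δ), (‖φ' y‖ - J / Δ) ^ 2 =
        (∫ y in y0..(y0 + Δ), ‖φ' y‖ ^ 2) - 2 * (J / Δ) * J + Δ * (J / Δ) ^ 2 := by
      have : ∀ y, (‖φ' y‖ - J / Δ) ^ 2 = ‖φ' y‖ ^ 2 - 2 * (J / Δ) * ‖φ' y‖ + (J / Δ) ^ 2 := fun y => by ring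
      simp_rw [this]
      rw [intervalIntegral.integral_add, intervalIntegral.integral_sub, intervalIntegral.integral_const_mul,
        intervalIntegral.integral_const, ← hJ]
      · simp
      all_goals apply Continuous.intervalIntegrable; fun_prop
    rw [h7] at h6
    have h8 : Δ * (J / Δ) = J := by field_simp
    have h9 : Δ * (2 * (J / Δ) * J) = 2 * J ^ 2 := by rw [show Δ * (2 * (J / Δ) * J) = 2 * (Δ * (J/Δ)) * J by ring, h8]; ring
    have h10 : Δ * (Δ * (J / Δ) ^ 2) = J ^ 2 := by rw [show Δ * (Δ * (J / Δ) ^ 2) = (Δ * (J/Δ)) ^ 2 by ring, h8]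
    nlinarith [mul_nonneg hΔ.le h6]
  have h11 : Δ * ‖φ y0‖ ^ 2 ≤ 2 * (∫ y in y0..(y0 + Δ), ‖φ y‖ ^ 2) + Δ * (2 * J ^ 2) := by
    have := intervalIntegral.integral_mono_on hle (f := fun _ => ‖φ y0‖ ^ 2) (g := fun y => 2 * ‖φ y‖ ^ 2 + 2 * J ^ 2) (μ := volume)
      (by simp) (by apply Continuous.intervalIntegrable; fun_prop) h1
    rw [intervalIntegral.integral_add, intervalIntegral.integral_const_mul, intervalIntegral.integral_const, intervalIntegral.integral_const] at this
    · simpa using this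
    all_goals apply Continuous.intervalIntegrable; fun_prop
  have h12 : ‖φ y0‖ ^ 2 = (Δ * ‖φ y0‖ ^ 2) / Δ := by field_simp
  rw [h12, div_le_iff₀ hΔ]
  have h13 : 2 / Δ * (∫ y in y0..(y0 + Δ), ‖φ y‖ ^ 2) * Δ = 2 * (∫ y in y0..(y0 + Δ), ‖φ y‖ ^ 2) := by field_simp
  nlinarith [mul_le_mul_of_nonneg_left h5 hΔ.le]

lemma integral_e_le (c Y : ℝ) (hY : 0 ≤ Y) : ‖∫ y in (0:ℝ)..Y, e (c * y)‖ ≤ Y := by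
  have := intervalIntegral.norm_integral_le_of_norm_le_const (a := 0) (b := Y) (f := fun y => e (c * y)) (C := 1)
    (fun y _ => (norm_e _).le)
  simpa [abs_of_nonneg hY] using this

lemma integral_e_le' (c Y : ℝ) (hc : c ≠ 0) : ‖∫ y in (0:ℝ)..Y, e (c * y)‖ ≤ 1 / |c| := by
  have h : ∀ y, HasDerivAt (fun y => e (c * y) / (2 * Real.pi * Complex.I * c)) (e (c * y)) y := by
    intro y
    have := (hasDerivAt_e c y).div_const (2 * Real.pi * Complex.I * c)
    have hne : (2 * Real.pi * Complex.I * c : ℂ) ≠ 0 := by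
      simp [Real.pi_ne_zero, hc]
    exact this.congr_deriv (mul_div_cancel_left₀ _ hne)
  rw [intervalIntegral.integral_eq_sub_of_hasDerivAt (fun y _ => h y)
    ((continuous_e.comp (continuous_const.mul continuous_id)).intervalIntegrable _ _)]
  refine (norm_sub_le _ _).trans ?_
  rw [norm_div, norm_div, norm_e, norm_e]
  simp only [norm_mul, Complex.norm_I, Complex.norm_real, Complex.norm_ofNat, mul_one, Real.norm_eq_abs,
    abs_of_pos Real.pi_pos]
  have hc' : 0 < |c| := abs_pos.2 hc
  have : 1 / (2 * Real.pi * |c|) + 1 / (2 * Real.pi * |c|) = 1 / Real.pi * (1 / |c|) := by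
    field_simp; norm_num
  rw [this]
  refine mul_le_of_le_one_left (by positivity) ?_
  rw [div_le_one Real.pi_pos]
  linarith [Real.pi_gt_three]

lemma interval_card (k q A : ℕ) [NeZero q] (x : ZMod q) :
    ((Ico A (A + q)).filter (fun l : ℕ => l.Coprime q ∧ (l : ZMod q) ^ k = x)).card ≤ rc k q := by
  classical
  refine le_trans ?_ (rc_fiber k q 1 x)
  refine card_le_card_of_injOn (fun l => if h : l.Coprime q then ZMod.unitOfCoprime l h else 1) ?_ ?_
  · intro l hl
    simp only [coe_filter, Set.mem_ofPred_eq] at hl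
    have hh : (if h : l.Coprime q then ZMod.unitOfCoprime l h else 1) = ZMod.unitOfCoprime l hl.2.1 := dif_pos hl.2.1
    simp only [coe_filter, Set.mem_ofPred_eq, mem_univ, true_and, hh]
    rw [ZMod.coe_unitOfCoprime, Units.val_one, one_mul]
    exact hl.2.2
  · intro l hl l' hl' h
    simp only [coe_filter, Set.mem_ofPred_eq, mem_Ico] at hl hl'
    have h : (if h : l.Coprime q then ZMod.unitOfCoprime l h else 1) = (if h : l'.Coprime q then ZMod.unitOfCoprime l' h else 1) := h
    rw [dif_pos hl.2.1, dif_pos hl'.2.1] at h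
    have h2 := congrArg Units.val h
    simp only [ZMod.coe_unitOfCoprime] at h2
    rw [ZMod.natCast_eq_natCast_iff] at h2
    have h3 := (Nat.modEq_iff_dvd.1 h2)
    obtain ⟨t, ht⟩ := h3
    have hq : (0:ℤ) < q := by exact_mod_cast Nat.pos_of_ne_zero (NeZero.ne q)
    have h4 : t < 1 := by
      by_contra hh
      push Not at hh
      have : (q:ℤ) * 1 ≤ q * t := by gcongr
      omega
    have h5 : -1 < t := by
      by_contra hh
      push Not at hh
      have : (q:ℤ) * t ≤ q * (-1) := by gcongr
      omega
    have : t = 0 := by omega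
    subst this
    omega

lemma fiber_card (k q l j : ℕ) [NeZero q] (L : Finset ℕ) (hL : ∀ l' ∈ L, l'.Coprime q) :
    (L.filter (fun l' : ℕ => (l : ZMod q) ^ k = (l' : ZMod q) ^ k ∧ Nat.dist l l' / q = j)).card ≤ 2 * rc k q := by
  classical
  have hq : 0 < q := Nat.pos_of_ne_zero (NeZero.ne q)
  have h1 := interval_card k q (l + j * q) ((l : ZMod q) ^ k)
  have h2 := interval_card k q (l + 1 - (j + 1) * q) ((l : ZMod q) ^ k)
  refine le_trans (card_le_card (t := _ ∪ _) ?_) ((card_union_le _ _).trans (by rw [two_mul]; exact add_le_add h1 h2))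
  intro l' hl'
  simp only [mem_filter, mem_union, mem_Ico] at hl' ⊢
  obtain ⟨hm, he, hd⟩ := hl'
  have h3 := Nat.div_add_mod (Nat.dist l l') q
  have h4 := Nat.mod_lt (Nat.dist l l') hq
  rw [hd] at h3
  have e1 : (j+1) * q = q * j + q := by ring
  have e2 : j * q = q * j := by ring
  rw [e1, e2]
  generalize q * j = z at *
  rcases le_total l l' with h | h
  · rw [Nat.dist_eq_sub_of_le h] at h3 h4
    left
    exact ⟨by omega, hL l' hm, he.symm⟩
  · rw [Nat.dist_eq_sub_of_le_right h] at h3 h4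
    right
    exact ⟨by omega, hL l' hm, he.symm⟩

lemma kernel_sum (k q l J : ℕ) [NeZero q] (L : Finset ℕ) (hL : ∀ l' ∈ L, l'.Coprime q)
    (κ : ℕ → ℝ) (hκ : ∀ j, 0 ≤ κ j) (hJ : ∀ l' ∈ L, Nat.dist l l' / q < J) :
    ∑ l' ∈ L, (if (l : ZMod q) ^ k = (l' : ZMod q) ^ k then κ (Nat.dist l l' / q) else 0) ≤
      2 * rc k q * ∑ j ∈ range J, κ j := by
  classical
  rw [← sum_filter]
  rw [← sum_fiberwise_of_maps_to (t := range J) (g := fun l' : ℕ => Nat.dist l l' / q)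
    (fun l' hl' => mem_range.2 (hJ l' (mem_filter.1 hl').1)), mul_sum]
  refine sum_le_sum fun j _ => ?_
  calc _ = ∑ i ∈ (L.filter (fun l' : ℕ => (l : ZMod q) ^ k = (l' : ZMod q) ^ k)).filter (fun l' : ℕ => Nat.dist l l' / q = j), κ j := by
        refine sum_congr rfl fun i hi => by rw [(mem_filter.1 hi).2]
    _ = ((L.filter (fun l' : ℕ => (l : ZMod q) ^ k = (l' : ZMod q) ^ k)).filter (fun l' : ℕ => Nat.dist l l' / q = j)).card * κ j := by
        rw [sum_const, nsmul_eq_mul]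
    _ ≤ _ := by
        refine mul_le_mul_of_nonneg_right ?_ (hκ j)
        rw [filter_filter]
        exact_mod_cast fiber_card k q l j L hL

noncomputable def phi (k q : ℕ) [NeZero q] (β : ℝ) (b : ℕ → ℂ) (L : Finset ℕ) (x : ZMod q) (y : ℝ) : ℂ :=
  ∑ l ∈ L, (b l * e (β * (l : ℝ) ^ k * y)) * ZMod.stdAddChar (x * (l : ZMod q) ^ k)

lemma continuous_phi (k q : ℕ) [NeZero q] (β : ℝ) (b : ℕ → ℂ) (L : Finset ℕ) (x : ZMod q) :
    Continuous (phi k q β b L x) := by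
  unfold phi
  refine continuous_finsetSum _ fun l _ => ?_
  exact (continuous_const.mul (continuous_e.comp (continuous_const.mul continuous_id))).mul continuous_const

lemma hasDerivAt_phi (k q : ℕ) [NeZero q] (β : ℝ) (b : ℕ → ℂ) (L : Finset ℕ) (x : ZMod q) (y : ℝ) :
    HasDerivAt (phi k q β b L x)
      (phi k q β (fun l => b l * (2 * Real.pi * Complex.I * (β * (l : ℝ) ^ k : ℝ))) L x y) y := by
  unfold phi
  have := HasDerivAt.fun_sum (u := L) (x := y)
    (A := fun l y => (b l * e (β * (l : ℝ) ^ k * y)) * ZMod.stdAddChar (x * (l : ZMod q) ^ k))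
    (A' := fun l => (b l * (2 * Real.pi * Complex.I * (β * (l : ℝ) ^ k : ℝ) * e (β * (l : ℝ) ^ k * y))) *
      ZMod.stdAddChar (x * (l : ZMod q) ^ k))
    (fun l _ => ((hasDerivAt_e (β * (l : ℝ) ^ k) y).const_mul (b l)).mul_const _)
  refine this.congr_deriv ?_
  refine sum_congr rfl fun l _ => ?_
  ring

lemma meanK (k q J : ℕ) [NeZero q] (β : ℝ) (b : ℕ → ℂ) (L : Finset ℕ) (Y B : ℝ) (κ : ℕ → ℝ)
    (hκ : ∀ j, 0 ≤ κ j) (hb : ∀ l ∈ L, ‖b l‖ ≤ B) (hL : ∀ l' ∈ L, l'.Coprime q)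
    (hJ : ∀ l ∈ L, ∀ l' ∈ L, Nat.dist l l' / q < J)
    (hK : ∀ l ∈ L, ∀ l' ∈ L,
      ‖∫ y in (0:ℝ)..Y, e ((β * (l:ℝ) ^ k - β * (l':ℝ) ^ k) * y)‖ ≤ κ (Nat.dist l l' / q)) :
    ∑ x : ZMod q, ∫ y in (0:ℝ)..Y, ‖phi k q β b L x y‖ ^ 2 ≤
      q * (B ^ 2 * (L.card * (2 * rc k q * ∑ j ∈ range J, κ j))) := by
  classical
  have hintg : ∀ x : ZMod q, IntervalIntegrable (fun y => ‖phi k q β b L x y‖ ^ 2) volume 0 Y := fun x =>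
    (((continuous_phi k q β b L x).norm).pow 2).intervalIntegrable _ _
  rw [← intervalIntegral.integral_finsetSum (fun x _ => hintg x)]
  have h1 : ((∫ y in (0:ℝ)..Y, ∑ x : ZMod q, ‖phi k q β b L x y‖ ^ 2 : ℝ) : ℂ) =
      q * ∑ l ∈ L, ∑ l' ∈ L, if (l : ZMod q) ^ k = (l' : ZMod q) ^ k then
        b l * (starRingEnd ℂ) (b l') * ∫ y in (0:ℝ)..Y, e ((β * (l:ℝ) ^ k - β * (l':ℝ) ^ k) * y) else 0 := by
    rw [← intervalIntegral.integral_ofReal]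
    have h2 : ∀ y : ℝ, ((∑ x : ZMod q, ‖phi k q β b L x y‖ ^ 2 : ℝ) : ℂ) =
        q * ∑ l ∈ L, ∑ l' ∈ L, if (l : ZMod q) ^ k = (l' : ZMod q) ^ k then
        b l * (starRingEnd ℂ) (b l') * e ((β * (l:ℝ) ^ k - β * (l':ℝ) ^ k) * y) else 0 := by
      intro y
      unfold phi
      rw [orth]
      congr 1
      refine sum_congr rfl fun l _ => sum_congr rfl fun l' _ => ?_
      split_ifs
      · rw [(starRingEnd ℂ).map_mul, conj_e, sub_mul, sub_eq_add_neg, e_add]; ring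
      · rfl
    have hcont : ∀ l l' : ℕ, Continuous fun y : ℝ => (if (l : ZMod q) ^ k = (l' : ZMod q) ^ k then
        b l * (starRingEnd ℂ) (b l') * e ((β * (l:ℝ) ^ k - β * (l':ℝ) ^ k) * y) else 0) := by
      intro l l'
      split_ifs
      · exact continuous_const.mul (continuous_e.comp (continuous_const.mul continuous_id))
      · exact continuous_const
    simp_rw [h2]
    rw [intervalIntegral.integral_const_mul, intervalIntegral.integral_finsetSum]
    · congr 1
      refine sum_congr rfl fun l _ => ?_
      rw [intervalIntegral.integral_finsetSum]
      · refine sum_congr rfl fun l' _ => ?_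
        split_ifs
        · rw [intervalIntegral.integral_const_mul]
        · simp
      · intro l' _
        exact (hcont l l').intervalIntegrable _ _
    · intro l _
      exact (continuous_finsetSum _ fun l' _ => hcont l l').intervalIntegrable _ _
  have h3 : (∫ y in (0:ℝ)..Y, ∑ x : ZMod q, ‖phi k q β b L x y‖ ^ 2 : ℝ) ≤
      ‖((∫ y in (0:ℝ)..Y, ∑ x : ZMod q, ‖phi k q β b L x y‖ ^ 2 : ℝ) : ℂ)‖ := by
    rw [Complex.norm_real]; exact le_abs_self _
  refine h3.trans ?_
  rw [h1, norm_mul, Complex.norm_natCast]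
  refine mul_le_mul_of_nonneg_left ?_ (by positivity)
  refine (norm_sum_le _ _).trans ?_
  rw [show B ^ 2 * (L.card * (2 * rc k q * ∑ j ∈ range J, κ j)) =
    ∑ l ∈ L, B ^ 2 * (2 * rc k q * ∑ j ∈ range J, κ j) by rw [sum_const, nsmul_eq_mul]; ring]
  refine sum_le_sum fun l hl => ?_
  refine (norm_sum_le _ _).trans ?_
  have hB : 0 ≤ B := (norm_nonneg _).trans (hb l hl)
  refine le_trans ?_ (mul_le_mul_of_nonneg_left (kernel_sum k q l J L hL κ hκ (hJ l hl)) (by positivity))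
  rw [mul_sum]
  refine sum_le_sum fun l' hl' => ?_
  split_ifs
  · rw [norm_mul, norm_mul, RCLike.norm_conj, sq]
    have := hK l hl l' hl'
    have h5 := hb l hl
    have h6 := hb l' hl'
    gcongr
  · simp

lemma pow_diff_lower (k : ℕ) (hk : 1 ≤ k) (x y N : ℝ) (hN : 0 ≤ N) (hx : N ≤ x) (hxy : x ≤ y) :
    (y - x) * N ^ (k - 1) ≤ y ^ k - x ^ k := by
  obtain ⟨j, rfl⟩ : ∃ j, k = j + 1 := ⟨k - 1, by omega⟩
  simp only [Nat.add_sub_cancel]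
  have h1 : N ^ j ≤ y ^ j := pow_le_pow_left₀ hN (hx.trans hxy) j
  have h2 : x ^ j ≤ y ^ j := pow_le_pow_left₀ (hN.trans hx) hxy j
  have h3 : x * x ^ j ≤ x * y ^ j := mul_le_mul_of_nonneg_left h2 (hN.trans hx)
  have h4 : (y - x) * N ^ j ≤ (y - x) * y ^ j := mul_le_mul_of_nonneg_left h1 (by linarith)
  rw [pow_succ, pow_succ]
  nlinarith

lemma dist_lt (N : ℝ) (l l' : ℕ) (h1 : N < l) (h2 : (l:ℝ) ≤ 4 * N) (h1' : N < l') (h2' : (l':ℝ) ≤ 4 * N) :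
    (Nat.dist l l' : ℝ) < 3 * N := by
  rcases le_total l l' with h | h
  · rw [Nat.dist_eq_sub_of_le h, Nat.cast_sub h]; linarith
  · rw [Nat.dist_eq_sub_of_le_right h, Nat.cast_sub h]; linarith

lemma abs_pow_diff (k : ℕ) (hk : 1 ≤ k) (N : ℝ) (hN : 0 ≤ N) (l l' : ℕ) (h1 : N < l) (h1' : N < l') :
    (Nat.dist l l' : ℝ) * N ^ (k - 1) ≤ |(l:ℝ) ^ k - (l':ℝ) ^ k| := by
  rcases le_total l l' with h | h
  · rw [Nat.dist_eq_sub_of_le h, Nat.cast_sub h, abs_sub_comm]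
    exact (pow_diff_lower k hk l l' N hN h1.le (by exact_mod_cast h)).trans (le_abs_self _)
  · rw [Nat.dist_eq_sub_of_le_right h, Nat.cast_sub h]
    exact (pow_diff_lower k hk l' l N hN h1'.le (by exact_mod_cast h)).trans (le_abs_self _)

lemma card_le_of_interval (N : ℝ) (hN : 1 ≤ N) (L : Finset ℕ) (hL : ∀ l ∈ L, N < (l:ℝ) ∧ (l:ℝ) ≤ 4 * N) :
    (L.card : ℝ) ≤ 4 * N := by
  have : L ⊆ Ioc 0 ⌊4 * N⌋₊ := by
    intro l hl
    rw [mem_Ioc]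
    have := hL l hl
    refine ⟨?_, Nat.le_floor this.2⟩
    have h : (0:ℝ) < l := by linarith
    exact_mod_cast h
  have h2 := card_le_card this
  rw [Nat.card_Ioc, Nat.sub_zero] at h2
  calc (L.card : ℝ) ≤ ⌊4 * N⌋₊ := by exact_mod_cast h2
    _ ≤ _ := Nat.floor_le (by linarith)

lemma mean2 (k q M : ℕ) [NeZero q] (hk : 1 ≤ k) (hM : 1 ≤ M) (β N B : ℝ) (hN : 1 ≤ N) (b : ℕ → ℂ) (L : Finset ℕ)
    (hb : ∀ l ∈ L, ‖b l‖ ≤ B) (hL : ∀ l' ∈ L, l'.Coprime q) (hLN : ∀ l ∈ L, N < (l:ℝ) ∧ (l:ℝ) ≤ 4 * N)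
    (D : ℝ) (hD : D = q * (1 + |β| * (M * N) ^ k)) (hDN : D ≤ N) :
    ∑ x : ZMod q, ∫ y in (0:ℝ)..(2 ^ (k+1) * (M:ℝ) ^ k), ‖phi k q β b L x y‖ ^ 2 ≤
      q * (B ^ 2 * (4 * N * (2 * rc k q * (2 ^ (k + 4) * (M:ℝ) ^ k * (N / D) * (1 + Real.log (4 * N)))))) := by
  have hq : (1:ℝ) ≤ q := by exact_mod_cast Nat.one_le_iff_ne_zero.2 (NeZero.ne q)
  have hM' : (1:ℝ) ≤ M := by exact_mod_cast hM
  set T := |β| * (M * N) ^ k with hT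
  have hT0 : 0 ≤ T := by positivity
  have hqD : (q:ℝ) ≤ D := by rw [hD]; nlinarith
  have hDpos : 0 < D := by linarith
  set Y : ℝ := 2 ^ (k+1) * (M:ℝ) ^ k with hY
  have hY0 : 0 ≤ Y := by positivity
  have hlog : 0 ≤ Real.log (4 * N) := Real.log_nonneg (by linarith)
  set J : ℕ := ⌊3 * N / q⌋₊ + 1 with hJdef
  have hJ : ∀ l ∈ L, ∀ l' ∈ L, Nat.dist l l' / q < J := by
    intro l hl l' hl'
    rw [hJdef, Nat.lt_succ_iff, Nat.le_floor_iff (by positivity)]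
    refine (Nat.cast_div_le).trans ?_
    have := dist_lt N l l' (hLN l hl).1 (hLN l hl).2 (hLN l' hl').1 (hLN l' hl').2
    gcongr
  have hJle : (J:ℝ) ≤ 4 * N / q := by
    rw [hJdef]; push_cast
    have h1 := Nat.floor_le (show 0 ≤ 3 * N / q by positivity)
    have h2 : 1 ≤ N / q := by rw [le_div_iff₀ (by linarith)]; linarith
    have h3 : 4 * N / q = 3 * N / q + N / q := by ring
    linarith
  have key : ∀ κ : ℕ → ℝ, (∀ j, 0 ≤ κ j) → (∀ l ∈ L, ∀ l' ∈ L,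
      ‖∫ y in (0:ℝ)..Y, e ((β * (l:ℝ) ^ k - β * (l':ℝ) ^ k) * y)‖ ≤ κ (Nat.dist l l' / q)) →
      ∑ j ∈ range J, κ j ≤ (2 ^ (k + 4) * (M:ℝ) ^ k * (N / D) * (1 + Real.log (4 * N))) →
      ∑ x : ZMod q, ∫ y in (0:ℝ)..Y, ‖phi k q β b L x y‖ ^ 2 ≤
      q * (B ^ 2 * (4 * N * (2 * rc k q * (2 ^ (k + 4) * (M:ℝ) ^ k * (N / D) * (1 + Real.log (4 * N)))))) := by
    intro κ h1 h2 h3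
    refine (meanK k q J β b L Y B κ h1 hb hL hJ h2).trans ?_
    have h4 := card_le_of_interval N hN L hLN
    have h5 : 0 ≤ ∑ j ∈ range J, κ j := sum_nonneg fun j _ => h1 j
    gcongr
  have hND : 1 ≤ N / D := by rw [le_div_iff₀ hDpos]; linarith
  rcases le_total T 1 with hT1 | hT1
  · refine key (fun _ => Y) (fun _ => hY0) (fun l _ l' _ => integral_e_le _ _ hY0) ?_
    rw [sum_const, nsmul_eq_mul, card_range]
    have h1 : N / q ≤ 2 * (N / D) := by
      rw [← mul_div_assoc, div_le_div_iff₀ (by linarith) hDpos, hD]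
      have h9 : N * q * T ≤ N * q * 1 := by gcongr
      nlinarith
    calc (J:ℝ) * Y ≤ (4 * N / q) * Y := by gcongr
      _ = 4 * (N / q) * Y := by ring
      _ ≤ 4 * (2 * (N / D)) * Y := by gcongr
      _ = (2 ^ (k + 4) * (M:ℝ) ^ k * (N / D)) * 1 := by rw [hY, pow_add, pow_add]; ring
      _ ≤ _ := by gcongr; linarith
  · have hβ : 0 < |β| := by
      rcases (abs_nonneg β).eq_or_lt with h | h
      · rw [hT, ← h] at hT1; norm_num at hT1
      · exact h
    have hNk : (0:ℝ) < N ^ (k-1) := by positivity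
    have hq0 : (0:ℝ) < q := by linarith
    set W := 1 / (|β| * N ^ (k-1) * q) with hW
    have hW0 : 0 < W := by positivity
    refine key (fun j => if j = 0 then Y else W * (1 / (j:ℝ))) (fun j => ?_) (fun l hl l' hl' => ?_) ?_
    · split_ifs <;> positivity
    · by_cases hj : Nat.dist l l' / q = 0
      · simp only [hj, if_true]
        exact integral_e_le _ _ hY0
      · simp only [if_neg hj]
        set j := Nat.dist l l' / q with hjd
        have hj1 : (0:ℝ) < j := by exact_mod_cast Nat.pos_of_ne_zero hj
        have hjq : (j:ℝ) * q ≤ Nat.dist l l' := by exact_mod_cast Nat.div_mul_le_self _ _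
        have h1 := abs_pow_diff k hk N (by linarith) l l' (hLN l hl).1 (hLN l' hl').1
        have h2 : |β| * N ^ (k-1) * q * j ≤ |β * (l:ℝ) ^ k - β * (l':ℝ) ^ k| := by
          rw [← mul_sub, abs_mul]
          calc |β| * N ^ (k-1) * q * j = |β| * ((j * q) * N ^ (k-1)) := by ring
            _ ≤ |β| * (Nat.dist l l' * N ^ (k-1)) := by gcongr
            _ ≤ _ := by gcongr
        have h3 : 0 < |β| * N ^ (k-1) * q * j := by positivity
        refine (integral_e_le' _ _ ?_).trans ?_
        · intro h; rw [h, abs_zero] at h2; linarith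
        · rw [hW, div_mul_div_comm, one_mul]
          exact one_div_le_one_div_of_le h3 h2
    · have hWD : W ≤ 2 * (M:ℝ) ^ k * (N / D) := by
        have e1 : N ^ k = N ^ (k-1) * N := by rw [← pow_succ]; congr 1; omega
        have e2 : W = (M:ℝ) ^ k * N / (q * T) := by
          rw [hW, hT, mul_pow, e1]
          field_simp
        have e3 : D ≤ 2 * (q * T) := by rw [hD]; nlinarith
        rw [e2, ← mul_div_assoc, div_le_div_iff₀ (by positivity) hDpos]
        calc (M:ℝ) ^ k * N * D ≤ (M:ℝ) ^ k * N * (2 * (q * T)) := by gcongr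
          _ = _ := by ring
      rw [hJdef, sum_range_succ']
      simp only [Nat.add_eq_zero_iff, one_ne_zero, and_false, if_false, if_true]
      rw [← mul_sum]
      have hh : ∑ j ∈ range ⌊3 * N / q⌋₊, 1 / (((j + 1 : ℕ)) : ℝ) ≤ 1 + Real.log (4 * N) := by
        have h1 := harmonic_floor_le_one_add_log (3 * N / q) (by
          rw [le_div_iff₀ hq0]; linarith)
        rw [harmonic] at h1
        push_cast at h1
        simp only [one_div]
        push_cast
        refine h1.trans ?_
        have : Real.log (3 * N / q) ≤ Real.log (4 * N) := by
          apply Real.log_le_log (by positivity)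
          rw [div_le_iff₀ hq0]; nlinarith
        linarith
      calc _ ≤ W * (1 + Real.log (4 * N)) + Y := by gcongr
        _ ≤ (2 * (M:ℝ) ^ k * (N / D)) * (1 + Real.log (4 * N)) + (2 ^ (k+1) * (M:ℝ) ^ k) * (N / D) * (1 + Real.log (4 * N)) := by
            have : Y * 1 * 1 ≤ (2 ^ (k+1) * (M:ℝ) ^ k) * (N / D) * (1 + Real.log (4 * N)) := by
              rw [hY]; gcongr; linarith
            have h8 : W * (1 + Real.log (4 * N)) ≤ (2 * (M:ℝ) ^ k * (N / D)) * (1 + Real.log (4 * N)) := by gcongr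
            linarith
        _ = ((2 + 2 ^ (k+1)) * (M:ℝ) ^ k * (N / D)) * (1 + Real.log (4 * N)) := by ring
        _ ≤ _ := by
            have : (2:ℝ) + 2 ^ (k+1) ≤ 2 ^ (k+4) := by
              have : (1:ℝ) ≤ 2 ^ k := one_le_pow₀ (by norm_num)
              rw [pow_add, pow_add]; linarith
            gcongr

lemma disj_int (k q M : ℕ) [NeZero q] (hk : 1 ≤ k) (hqM : q ≤ M) (s : Finset ℕ) (u : ZMod q)
    (hs : ∀ m ∈ s, M ≤ m ∧ m < 2 * M ∧ (m : ZMod q) = u) (G : ℝ → ℝ) (hG : Continuous G) (hG0 : ∀ y, 0 ≤ G y) :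
    ∑ m ∈ s, ∫ y in ((m:ℝ) ^ k)..((m:ℝ) ^ k + q * (M:ℝ) ^ (k-1)), G y ≤
      ∫ y in (0:ℝ)..(2 ^ (k+1) * (M:ℝ) ^ k), G y := by
  have hΔ : (0:ℝ) ≤ q * (M:ℝ) ^ (k-1) := by positivity
  have hq0 : 0 < q := Nat.pos_of_ne_zero (NeZero.ne q)
  have h1 : ∀ m ∈ s, ∫ y in ((m:ℝ) ^ k)..((m:ℝ) ^ k + q * (M:ℝ) ^ (k-1)), G y =
      ∫ y in Set.Ioc ((m:ℝ) ^ k) ((m:ℝ) ^ k + q * (M:ℝ) ^ (k-1)), G y := fun m _ =>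
    intervalIntegral.integral_of_le (by linarith)
  rw [sum_congr rfl h1, intervalIntegral.integral_of_le (by positivity)]
  rw [← integral_biUnion_finset]
  · refine setIntegral_mono_set ?_ (Filter.Eventually.of_forall hG0) (HasSubset.Subset.eventuallyLE ?_)
    · exact (hG.integrableOn_Icc).mono_set Set.Ioc_subset_Icc_self
    · intro y hy
      simp only [Set.mem_iUnion] at hy
      obtain ⟨m, hm, hy⟩ := hy
      obtain ⟨h2, h3, h4⟩ := hs m hm
      refine ⟨lt_of_le_of_lt (by positivity) hy.1, hy.2.trans ?_⟩
      have e1 : (m:ℝ) ^ k ≤ (2 * M) ^ k := by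
        gcongr
        exact_mod_cast h3.le
      have e2 : (q:ℝ) * (M:ℝ) ^ (k-1) ≤ M ^ k := by
        calc (q:ℝ) * (M:ℝ) ^ (k-1) ≤ M * (M:ℝ) ^ (k-1) := by gcongr
          _ = M ^ k := by rw [← pow_succ']; congr 1; omega
      have e3 : (M:ℝ) ^ k ≤ (2 * M) ^ k := by
        gcongr
        have : (0:ℝ) ≤ M := by positivity
        linarith
      rw [mul_pow] at e1 e3
      rw [pow_succ]
      linarith
  · intro m _
    exact measurableSet_Ioc
  · have hlt : ∀ m ∈ s, ∀ m' ∈ s, m < m' → (m:ℝ) ^ k + q * (M:ℝ) ^ (k-1) ≤ (m':ℝ) ^ k := by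
      intro m hm m' hm' h
      have h4 : (m : ZMod q) = (m' : ZMod q) := by rw [(hs m hm).2.2, (hs m' hm').2.2]
      rw [ZMod.natCast_eq_natCast_iff] at h4
      have h5 : q ∣ m' - m := (Nat.modEq_iff_dvd' h.le).1 h4
      have h6 : q ≤ m' - m := Nat.le_of_dvd (by omega) h5
      have h7 := pow_diff_lower k hk m m' M (by positivity) (by exact_mod_cast (hs m hm).1) (by exact_mod_cast h.le)
      have h8 : (q:ℝ) ≤ (m':ℝ) - m := by
        have : ((m' - m : ℕ) : ℝ) = (m':ℝ) - m := Nat.cast_sub h.le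
        rw [← this]; exact_mod_cast h6
      have h9 : (q:ℝ) * (M:ℝ) ^ (k-1) ≤ ((m':ℝ) - m) * M ^ (k-1) := by gcongr
      linarith
    intro m hm m' hm' hne
    refine Set.disjoint_left.2 fun y hy hy' => ?_
    rcases lt_or_gt_of_ne hne with h | h
    · have := hlt m hm m' hm' h
      exact absurd hy'.1 (not_lt.2 (hy.2.trans this))
    · have := hlt m' hm' m hm h
      exact absurd hy.1 (not_lt.2 (hy'.2.trans this))
  · intro m _
    exact (hG.integrableOn_Icc).mono_set Set.Ioc_subset_Icc_self

lemma large_sieve (k q M : ℕ) [NeZero q] (hk : 1 ≤ k) (hM : 1 ≤ M) (a : (ZMod q)ˣ) (β N B : ℝ) (hN : 1 ≤ N)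
    (b : ℕ → ℂ) (L s : Finset ℕ) (hB : 0 ≤ B)
    (hb : ∀ l ∈ L, ‖b l‖ ≤ B) (hL : ∀ l' ∈ L, l'.Coprime q) (hLN : ∀ l ∈ L, N < (l:ℝ) ∧ (l:ℝ) ≤ 4 * N)
    (hs : ∀ m ∈ s, M ≤ m ∧ m < 2 * M ∧ m.Coprime q)
    (D : ℝ) (hD : D = q * (1 + |β| * (M * N) ^ k)) (hDN : D ≤ N) (hDM : D ≤ M) :
    ∑ m ∈ s, ‖phi k q β b L (a * (m : ZMod q) ^ k) ((m:ℝ) ^ k)‖ ^ 2 ≤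
      (100 * 16 ^ k * 2 ^ (k + 7)) * (rc k q : ℝ) ^ 2 * B ^ 2 * (1 + Real.log (4 * N)) * M * N ^ 2 / D := by
  classical
  have hq : (1:ℝ) ≤ q := by exact_mod_cast Nat.one_le_iff_ne_zero.2 (NeZero.ne q)
  have hM' : (1:ℝ) ≤ M := by exact_mod_cast hM
  set T := |β| * (M * N) ^ k with hT
  have hT0 : 0 ≤ T := by positivity
  have hqD : (q:ℝ) ≤ D := by rw [hD]; nlinarith
  have hDpos : 0 < D := by linarith
  have hqM : q ≤ M := by exact_mod_cast (hqD.trans hDM)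
  have hlog : 0 ≤ Real.log (4 * N) := Real.log_nonneg (by linarith)
  set Δ : ℝ := q * (M:ℝ) ^ (k-1) with hΔ
  have hΔ0 : 0 < Δ := by positivity
  set Y : ℝ := 2 ^ (k+1) * (M:ℝ) ^ k with hY
  set b' : ℕ → ℂ := fun l => b l * (2 * Real.pi * Complex.I * (β * (l : ℝ) ^ k : ℝ)) with hb'
  set B' : ℝ := B * (7 * (|β| * (4 * N) ^ k)) with hB'
  have hbB' : ∀ l ∈ L, ‖b' l‖ ≤ B' := by
    intro l hl
    rw [hb', hB']
    simp only [norm_mul, Complex.norm_I, Complex.norm_real, Complex.norm_ofNat, mul_one, Real.norm_eq_abs,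
      abs_of_pos Real.pi_pos, abs_mul, abs_pow, Nat.abs_cast]
    have h1 := hb l hl
    have h2 := (hLN l hl).2
    have h3 : 2 * Real.pi ≤ 7 := by linarith [Real.pi_lt_d2]
    gcongr
  set I1 : ZMod q → ℝ := fun x => ∫ y in (0:ℝ)..Y, ‖phi k q β b L x y‖ ^ 2 with hI1
  set I2 : ZMod q → ℝ := fun x => ∫ y in (0:ℝ)..Y, ‖phi k q β b' L x y‖ ^ 2 with hI2
  have hY0 : 0 ≤ Y := by positivity
  have hI1n : ∀ x, 0 ≤ I1 x := fun x => intervalIntegral.integral_nonneg hY0 fun _ _ => by positivity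
  have hI2n : ∀ x, 0 ≤ I2 x := fun x => intervalIntegral.integral_nonneg hY0 fun _ _ => by positivity
  have step1 : ∑ m ∈ s, ‖phi k q β b L (a * (m : ZMod q) ^ k) ((m:ℝ) ^ k)‖ ^ 2 ≤
      ∑ u : (ZMod q)ˣ, (2 / Δ * I1 (a * (u : ZMod q) ^ k) + 2 * Δ * I2 (a * (u : ZMod q) ^ k)) := by
    have : ∀ m ∈ s, (if h : m.Coprime q then ZMod.unitOfCoprime m h else 1) ∈ (univ : Finset (ZMod q)ˣ) := fun _ _ => mem_univ _
    rw [← sum_fiberwise_of_maps_to this]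
    refine sum_le_sum fun u _ => ?_
    set s' := s.filter (fun m : ℕ => (if h : m.Coprime q then ZMod.unitOfCoprime m h else 1) = u) with hs'
    have hms' : ∀ m ∈ s', M ≤ m ∧ m < 2 * M ∧ (m : ZMod q) = u := by
      intro m hm
      rw [hs', mem_filter] at hm
      obtain ⟨h1, h2, h3⟩ := hs m hm.1
      refine ⟨h1, h2, ?_⟩
      have := hm.2
      rw [dif_pos h3] at this
      rw [← this, ZMod.coe_unitOfCoprime]
    have h4 : ∀ m ∈ s', ‖phi k q β b L (a * (m : ZMod q) ^ k) ((m:ℝ) ^ k)‖ ^ 2 ≤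
        2 / Δ * (∫ y in ((m:ℝ)^k)..((m:ℝ)^k + Δ), ‖phi k q β b L (a * (u : ZMod q) ^ k) y‖ ^ 2) +
        2 * Δ * ∫ y in ((m:ℝ)^k)..((m:ℝ)^k + Δ), ‖phi k q β b' L (a * (u : ZMod q) ^ k) y‖ ^ 2 := by
      intro m hm
      rw [(hms' m hm).2.2]
      exact sobolev _ _ (fun y => hasDerivAt_phi k q β b L _ y) (continuous_phi k q β _ L _) _ _ hΔ0
    refine (sum_le_sum h4).trans ?_
    rw [sum_add_distrib, ← mul_sum, ← mul_sum]
    have h5 := disj_int k q M hk hqM s' u hms' (fun y => ‖phi k q β b L (a * (u : ZMod q) ^ k) y‖ ^ 2)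
      (((continuous_phi k q β b L _).norm).pow 2) (fun _ => by positivity)
    have h6 := disj_int k q M hk hqM s' u hms' (fun y => ‖phi k q β b' L (a * (u : ZMod q) ^ k) y‖ ^ 2)
      (((continuous_phi k q β b' L _).norm).pow 2) (fun _ => by positivity)
    gcongr
  refine step1.trans ?_
  rw [sum_add_distrib, ← mul_sum, ← mul_sum]
  have h7 := sum_units_le k q a I1 hI1n
  have h8 := sum_units_le k q a I2 hI2n
  have h9 := mean2 k q M hk hM β N B hN b L hb hL hLN D hD hDN
  have h10 := mean2 k q M hk hM β N B' hN b' L hbB' hL hLN D hD hDN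
  set Z := (4 * N * (2 * rc k q * (2 ^ (k + 4) * (M:ℝ) ^ k * (N / D) * (1 + Real.log (4 * N))))) with hZ
  have hZ0 : 0 ≤ Z := by positivity
  have hkey : Δ * (|β| * (4 * N) ^ k) ≤ 4 ^ k := by
    have e1 : (M:ℝ) ^ k = M ^ (k-1) * M := by rw [← pow_succ]; congr 1; omega
    have e2 : Δ * (|β| * (4 * N) ^ k) * M = 4 ^ k * (q * T) := by
      rw [hΔ, hT, mul_pow, mul_pow, e1]; ring
    have e3 : (q:ℝ) * T ≤ M := by
      refine le_trans ?_ hDM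
      rw [hD]; nlinarith
    have e4 : Δ * (|β| * (4 * N) ^ k) * M ≤ 4 ^ k * M := by rw [e2]; gcongr
    exact le_of_mul_le_mul_right e4 (by linarith)
  have hk0 : 0 ≤ Δ * (|β| * (4 * N) ^ k) := by positivity
  calc _ ≤ 2 / Δ * (rc k q * (q * (B ^ 2 * Z))) + 2 * Δ * (rc k q * (q * (B' ^ 2 * Z))) := by
        have h11 := h7.trans (mul_le_mul_of_nonneg_left h9 (by positivity))
        have h12 := h8.trans (mul_le_mul_of_nonneg_left h10 (by positivity))
        gcongr
    _ = 2 / Δ * (rc k q * (q * (B ^ 2 * Z))) * (1 + 49 * (Δ * (|β| * (4 * N) ^ k)) ^ 2) := by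
        rw [hB']; field_simp; ring
    _ ≤ 2 / Δ * (rc k q * (q * (B ^ 2 * Z))) * (1 + 49 * (4 ^ k) ^ 2) := by gcongr
    _ ≤ 2 / Δ * (rc k q * (q * (B ^ 2 * Z))) * (50 * 16 ^ k) := by
        have e5 : ((4:ℝ) ^ k) ^ 2 = 16 ^ k := by rw [← pow_mul, mul_comm, pow_mul]; norm_num
        have e6 : (1:ℝ) ≤ 16 ^ k := one_le_pow₀ (by norm_num)
        rw [e5]; gcongr; linarith
    _ = _ := by
        have e1 : (M:ℝ) ^ k = M ^ (k-1) * M := by rw [← pow_succ]; congr 1; omega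
        rw [hZ, hΔ, e1]
        field_simp
        rw [show k + 7 = k + 4 + 3 by omega, pow_add _ (k+4) 3]
        ring

lemma norm_e_sub_one (t : ℝ) (h0 : 0 < t) (h1 : t < 1) : 4 * min t (1 - t) ≤ ‖e t - 1‖ := by
  have h2 : ‖e t - 1‖ = ‖2 * Real.sin (Real.pi * t)‖ := by
    have := Complex.norm_exp_I_mul_ofReal_sub_one (2 * Real.pi * t)
    rw [show (2 * Real.pi * t) / 2 = Real.pi * t by ring] at this
    rw [← this]; unfold e; congr 2; push_cast; ring_nf
  have hpi := Real.pi_pos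
  have hs : 0 ≤ Real.sin (Real.pi * t) := Real.sin_nonneg_of_nonneg_of_le_pi (by positivity) (by nlinarith)
  rw [h2, Real.norm_of_nonneg (by positivity)]
  rcases le_total t (1/2) with h | h
  · have := Real.mul_le_sin (x := Real.pi * t) (by positivity) (by nlinarith)
    have e1 : 2 / Real.pi * (Real.pi * t) = 2 * t := by field_simp
    rw [e1] at this
    linarith [min_le_left t (1-t)]
  · have := Real.mul_le_sin (x := Real.pi * (1 - t)) (by apply mul_nonneg hpi.le; linarith) (by nlinarith)
    have e1 : 2 / Real.pi * (Real.pi * (1 - t)) = 2 * (1 - t) := by field_simp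
    have e2 : Real.sin (Real.pi * (1 - t)) = Real.sin (Real.pi * t) := by
      rw [mul_sub, mul_one, Real.sin_pi_sub]
    rw [e1, e2] at this
    linarith [min_le_right t (1-t)]

noncomputable def cK (K : ℕ) [NeZero K] (r1 r2 : ℕ) (x : ZMod K) : ℂ :=
  (K : ℂ)⁻¹ * ∑ j ∈ Ioc r1 r2, ZMod.stdAddChar (x * -(j : ZMod K))

noncomputable def gK (K : ℕ) (x : ZMod K) : ℝ :=
  if x = 0 then 1 else (1 / (x.val : ℝ) + 1 / ((K - x.val : ℕ) : ℝ)) / 2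

lemma gK_nonneg (K : ℕ) (x : ZMod K) : 0 ≤ gK K x := by
  unfold gK; split_ifs <;> positivity

lemma sep (K : ℕ) [NeZero K] (r1 r2 l : ℕ) (hr : r2 < K) (hl : l < K) :
    ∑ x : ZMod K, cK K r1 r2 x * ZMod.stdAddChar (x * (l : ZMod K)) = if r1 < l ∧ l ≤ r2 then 1 else 0 := by
  classical
  have hK : (K:ℂ) ≠ 0 := by exact_mod_cast NeZero.ne K
  unfold cK
  simp_rw [mul_assoc, sum_mul, ← AddChar.map_add_eq_mul, ← mul_add]
  rw [← mul_sum, sum_comm]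
  simp_rw [sum_chi_mul]
  have : ∀ j ∈ Ioc r1 r2, (if -(j : ZMod K) + (l : ZMod K) = 0 then (K : ℂ) else 0) = if j = l then (K:ℂ) else 0 := by
    intro j hj
    have h1 : j < K := lt_of_le_of_lt (mem_Ioc.1 hj).2 hr
    have h2 : -(j : ZMod K) + (l : ZMod K) = 0 ↔ j = l := by
      rw [neg_add_eq_zero, ZMod.natCast_eq_natCast_iff', Nat.mod_eq_of_lt h1, Nat.mod_eq_of_lt hl]
    simp only [h2]
  rw [sum_congr rfl this, sum_ite_eq']
  simp only [mem_Ioc]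
  split_ifs
  · field_simp
  · simp

lemma cK_le (K : ℕ) [NeZero K] (r1 r2 : ℕ) (x : ZMod K) (hr : r2 < K) : ‖cK K r1 r2 x‖ ≤ gK K x := by
  have hK : (0:ℝ) < K := by exact_mod_cast Nat.pos_of_ne_zero (NeZero.ne K)
  unfold cK gK
  rw [norm_mul, norm_inv, Complex.norm_natCast]
  split_ifs with h
  · subst h
    have h1 : ‖∑ j ∈ Ioc r1 r2, ZMod.stdAddChar ((0 : ZMod K) * -(j : ZMod K))‖ ≤ K := by
      refine (norm_sum_le _ _).trans ?_
      simp only [norm_chi, sum_const, nsmul_eq_mul, mul_one, Nat.card_Ioc]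
      exact_mod_cast (by omega : r2 - r1 ≤ K)
    calc _ ≤ (K:ℝ)⁻¹ * K := by gcongr
      _ = 1 := by field_simp
  · have hv0 : 0 < x.val := Nat.pos_of_ne_zero fun h' => h ((ZMod.val_eq_zero x).1 h')
    have hvK : x.val < K := ZMod.val_lt x
    set v := x.val with hv
    have hx : ZMod.stdAddChar x = e ((v:ℝ) / K) := by
      rw [← chi_eq_e, hv, ZMod.natCast_zmod_val]
    set z := ZMod.stdAddChar (-x) with hz
    have hzn : ‖z‖ = 1 := norm_chi _
    have hv0' : (0:ℝ) < v := by exact_mod_cast hv0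
    have hvK' : (v:ℝ) < K := by exact_mod_cast hvK
    have hz1 : ‖z - 1‖ = ‖e ((v:ℝ) / K) - 1‖ := by
      rw [← hx, hz, ← conj_chi, ← RCLike.norm_conj (ZMod.stdAddChar x - 1)]
      congr 1
      rw [(starRingEnd ℂ).map_sub, (starRingEnd ℂ).map_one]
    have hlow := norm_e_sub_one ((v:ℝ)/K) (by positivity) (by rw [div_lt_one hK]; exact hvK')
    have hmin : 0 < min ((v:ℝ)/K) (1 - (v:ℝ)/K) := by
      refine lt_min (by positivity) ?_
      rw [sub_pos, div_lt_one hK]; exact hvK'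
    rw [← hz1] at hlow
    have hzpos : 0 < ‖z - 1‖ := by linarith
    have hz1' : z ≠ 1 := fun h => by rw [h] at hzpos; simp at hzpos
    have hsum : ‖∑ j ∈ Ioc r1 r2, ZMod.stdAddChar (x * -(j : ZMod K))‖ ≤ 2 / ‖z - 1‖ := by
      have e1 : ∀ j ∈ Ioc r1 r2, ZMod.stdAddChar (x * -(j : ZMod K)) = z ^ j := by
        intro j _
        rw [hz, ← AddChar.map_nsmul_eq_pow]
        congr 1
        simp
        ring
      rw [sum_congr rfl e1]
      rcases le_total r1 r2 with h12 | h12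
      · have : Ioc r1 r2 = Ico (r1+1) (r2+1) := by ext; simp
        rw [this, geom_sum_Ico hz1' (by omega), norm_div]
        gcongr
        refine (norm_sub_le _ _).trans ?_
        rw [norm_pow, norm_pow, hzn]; norm_num
      · rw [Ioc_eq_empty (by omega)]; simp; positivity
    have hKv : ((K - v : ℕ) : ℝ) = K - v := Nat.cast_sub hvK.le
    rw [hKv]
    have hKv0 : (0:ℝ) < K - v := by linarith
    calc _ ≤ (K:ℝ)⁻¹ * (2 / ‖z - 1‖) := by gcongr
      _ ≤ (K:ℝ)⁻¹ * (2 / (4 * min ((v:ℝ)/K) (1 - (v:ℝ)/K))) := by gcongr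
      _ ≤ _ := by
        rcases min_choice ((v:ℝ)/K) (1 - (v:ℝ)/K) with hm | hm <;> rw [hm]
        · have : (K:ℝ)⁻¹ * (2 / (4 * ((v:ℝ)/K))) = (1 / (v:ℝ)) / 2 := by field_simp; norm_num
          rw [this]
          have : 0 < 1 / ((K:ℝ) - v) := by positivity
          gcongr; linarith
        · have : (K:ℝ)⁻¹ * (2 / (4 * (1 - (v:ℝ)/K))) = (1 / ((K:ℝ) - v)) / 2 := by
            have e3 : 1 - (v:ℝ)/K = (K - v) / K := by field_simp
            rw [e3]; field_simp; norm_num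
          rw [this]
          have : 0 < 1 / (v:ℝ) := by positivity
          gcongr; linarith

lemma gK_sum (K : ℕ) [NeZero K] : ∑ x : ZMod K, gK K x ≤ 2 + Real.log K := by
  classical
  have hK : 0 < K := Nat.pos_of_ne_zero (NeZero.ne K)
  have h1 : ∑ x : ZMod K, gK K x = ∑ h ∈ range K, if h = 0 then (1:ℝ) else (1 / (h : ℝ) + 1 / ((K - h : ℕ) : ℝ)) / 2 := by
    refine sum_nbij' (fun x => x.val) (fun h => (h : ZMod K)) ?_ ?_ ?_ ?_ ?_
    · intro x _; exact mem_range.2 (ZMod.val_lt x)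
    · intro h _; exact mem_univ _
    · intro x _; exact ZMod.natCast_zmod_val x
    · intro h hh; exact ZMod.val_cast_of_lt (mem_range.1 hh)
    · intro x _; unfold gK; simp only [ZMod.val_eq_zero]
  rw [h1]
  obtain ⟨n, rfl⟩ : ∃ n, K = n + 1 := ⟨K - 1, by omega⟩
  rw [sum_range_succ']
  simp only [Nat.add_eq_zero_iff, one_ne_zero, and_false, if_false, if_true]
  rw [← sum_div, sum_add_distrib]
  have h2 : ∑ h ∈ range n, 1 / ((n + 1 - (h + 1) : ℕ) : ℝ) = ∑ h ∈ range n, 1 / ((h + 1 : ℕ) : ℝ) := by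
    rw [← sum_range_reflect]
    refine sum_congr rfl fun h hh => ?_
    have := mem_range.1 hh
    congr 3
    omega
  rw [h2]
  have h3 : ∑ h ∈ range n, 1 / ((h + 1 : ℕ) : ℝ) ≤ 1 + Real.log (n + 1 : ℕ) := by
    have h4 := harmonic_le_one_add_log n
    rw [harmonic] at h4
    push_cast at h4
    simp only [one_div]
    push_cast
    refine h4.trans ?_
    have : Real.log n ≤ Real.log (n + 1) := by
      rcases Nat.eq_zero_or_pos n with h | h
      · subst h; simp
      · apply Real.log_le_log
        · exact_mod_cast h
        · linarith
    linarith
  linarith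

lemma bilin (k q M K : ℕ) [NeZero q] [NeZero K] (hk : 1 ≤ k) (hM : 1 ≤ M) (a : (ZMod q)ˣ) (β N B : ℝ) (hN : 1 ≤ N)
    (b : ℕ → ℂ) (L s : Finset ℕ) (hB : 0 ≤ B)
    (hb : ∀ l ∈ L, ‖b l‖ ≤ B) (hL : ∀ l' ∈ L, l'.Coprime q) (hLN : ∀ l ∈ L, N < (l:ℝ) ∧ (l:ℝ) ≤ 4 * N)
    (hs : ∀ m ∈ s, M ≤ m ∧ m < 2 * M ∧ m.Coprime q)
    (D : ℝ) (hD : D = q * (1 + |β| * (M * N) ^ k)) (hDN : D ≤ N) (hDM : D ≤ M)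
    (A : ℕ → ℂ) (r1 r2 : ℕ → ℕ) (hr : ∀ m ∈ s, r2 m < K) (hLK : ∀ l ∈ L, l < K) :
    ‖∑ m ∈ s, A m * ∑ l ∈ L, if r1 m < l ∧ l ≤ r2 m then
        (b l * e (β * (l : ℝ) ^ k * (m:ℝ) ^ k)) * ZMod.stdAddChar (((a : ZMod q) * (m : ZMod q) ^ k) * (l : ZMod q) ^ k) else 0‖ ≤
      (2 + Real.log K) * (Real.sqrt (∑ m ∈ s, ‖A m‖ ^ 2) *
        Real.sqrt ((100 * 16 ^ k * 2 ^ (k + 7)) * (rc k q : ℝ) ^ 2 * B ^ 2 * (1 + Real.log (4 * N)) * M * N ^ 2 / D)) := by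
  classical
  set bh : ZMod K → ℕ → ℂ := fun x l => b l * ZMod.stdAddChar (x * (l : ZMod K)) with hbh
  have h1 : ∑ m ∈ s, A m * ∑ l ∈ L, (if r1 m < l ∧ l ≤ r2 m then
        (b l * e (β * (l : ℝ) ^ k * (m:ℝ) ^ k)) * ZMod.stdAddChar (((a : ZMod q) * (m : ZMod q) ^ k) * (l : ZMod q) ^ k) else 0) =
      ∑ x : ZMod K, ∑ m ∈ s, A m * cK K (r1 m) (r2 m) x * phi k q β (bh x) L (a * (m : ZMod q) ^ k) ((m:ℝ) ^ k) := by
    rw [sum_comm]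
    refine sum_congr rfl fun m hm => ?_
    simp_rw [mul_assoc (A m), ← mul_sum]
    congr 1
    unfold phi
    simp_rw [mul_sum]
    rw [sum_comm]
    refine sum_congr rfl fun l hl => ?_
    have h2 := sep K (r1 m) (r2 m) l (hr m hm) (hLK l hl)
    calc _ = ((b l * e (β * (l : ℝ) ^ k * (m:ℝ) ^ k)) * ZMod.stdAddChar (((a : ZMod q) * (m : ZMod q) ^ k) * (l : ZMod q) ^ k)) *
          (if r1 m < l ∧ l ≤ r2 m then (1:ℂ) else 0) := by split_ifs <;> simp
      _ = _ := by
          rw [← h2, mul_sum]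
          refine sum_congr rfl fun x _ => ?_
          rw [hbh]; ring
  rw [h1]
  set Z := (100 * 16 ^ k * 2 ^ (k + 7)) * (rc k q : ℝ) ^ 2 * B ^ 2 * (1 + Real.log (4 * N)) * M * N ^ 2 / D with hZ
  refine (norm_sum_le _ _).trans ?_
  have h3 : ∀ x : ZMod K, ‖∑ m ∈ s, A m * cK K (r1 m) (r2 m) x * phi k q β (bh x) L (a * (m : ZMod q) ^ k) ((m:ℝ) ^ k)‖ ≤
      gK K x * (Real.sqrt (∑ m ∈ s, ‖A m‖ ^ 2) * Real.sqrt Z) := by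
    intro x
    have h4 := large_sieve k q M hk hM a β N B hN (bh x) L s hB (fun l hl => by
      rw [hbh]; simp only [norm_mul, norm_chi, mul_one]; exact hb l hl) hL hLN hs D hD hDN hDM
    refine (norm_sum_le _ _).trans ?_
    calc _ ≤ ∑ m ∈ s, gK K x * (‖A m‖ * ‖phi k q β (bh x) L (a * (m : ZMod q) ^ k) ((m:ℝ) ^ k)‖) := by
          refine sum_le_sum fun m hm => ?_
          rw [norm_mul, norm_mul]
          have := cK_le K (r1 m) (r2 m) x (hr m hm)
          calc _ ≤ ‖A m‖ * gK K x * ‖phi k q β (bh x) L (a * (m : ZMod q) ^ k) ((m:ℝ) ^ k)‖ := by gcongr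
            _ = _ := by ring
      _ = gK K x * ∑ m ∈ s, ‖A m‖ * ‖phi k q β (bh x) L (a * (m : ZMod q) ^ k) ((m:ℝ) ^ k)‖ := by rw [mul_sum]
      _ ≤ _ := by
          refine mul_le_mul_of_nonneg_left ?_ (gK_nonneg K x)
          refine (Real.sum_mul_le_sqrt_mul_sqrt _ _ _).trans ?_
          gcongr
  refine (sum_le_sum fun x _ => h3 x).trans ?_
  rw [← sum_mul]
  exact mul_le_mul_of_nonneg_right (gK_sum K) (by positivity)

noncomputable def xi (k q : ℕ) [NeZero q] (a : ZMod q) (β : ℝ) (n : ℕ) : ℂ :=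
  if n.Coprime q then e (β * (n:ℝ) ^ k) * ZMod.stdAddChar (a * (n : ZMod q) ^ k) else 0

lemma norm_xi_le (k q : ℕ) [NeZero q] (a : ZMod q) (β : ℝ) (n : ℕ) : ‖xi k q a β n‖ ≤ 1 := by
  unfold xi
  split_ifs
  · rw [norm_mul, norm_e, norm_chi, one_mul]
  · simp

lemma t2_num (k : ℕ) (S C0 ρ B lN lX M N D D' X 𝒜 : ℝ) (hS : 0 ≤ S) (hC0 : 0 ≤ C0) (hρ : 0 ≤ ρ) (hB : 0 ≤ B)
    (hlN : 0 ≤ lN) (hl : lN ≤ lX) (hM : 0 ≤ M) (hD : 0 < D) (hD' : 0 < D') (hX : 0 ≤ X) (h𝒜 : 0 ≤ 𝒜)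
    (hSM : S ≤ 𝒜 * M) (hMN : M * N = X / 4) (hDD : D ≤ 4 ^ k * D') :
    Real.sqrt S * Real.sqrt (C0 * ρ ^ 2 * B ^ 2 * (1 + lN) * M * N ^ 2 / D') ≤
      B * ρ * Real.sqrt (C0 * 𝒜 * (1 + lX)) * (2 ^ k * X / Real.sqrt D) := by
  have hlX : 0 ≤ lX := hlN.trans hl
  rw [← Real.sqrt_mul hS]
  apply Real.sqrt_le_iff.2
  refine ⟨by positivity, ?_⟩
  have h1 : (M * N) ^ 2 / D' ≤ (2 ^ k * X) ^ 2 / D := by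
    rw [div_le_div_iff₀ hD' hD, hMN, mul_pow, ← pow_mul, mul_comm k 2, pow_mul]
    norm_num
    calc (X / 4) ^ 2 * D ≤ X ^ 2 * (4 ^ k * D') := by gcongr; linarith
      _ = _ := by ring
  calc S * (C0 * ρ ^ 2 * B ^ 2 * (1 + lN) * M * N ^ 2 / D')
      ≤ (𝒜 * M) * (C0 * ρ ^ 2 * B ^ 2 * (1 + lX) * M * N ^ 2 / D') := by gcongr
    _ = C0 * 𝒜 * (1 + lX) * ρ ^ 2 * B ^ 2 * ((M * N) ^ 2 / D') := by ring
    _ ≤ C0 * 𝒜 * (1 + lX) * ρ ^ 2 * B ^ 2 * ((2 ^ k * X) ^ 2 / D) := by gcongr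
    _ = _ := by
        rw [mul_pow (B * ρ * Real.sqrt _), mul_pow (B * ρ), Real.sq_sqrt (by positivity), div_pow, Real.sq_sqrt hD.le]
        ring

lemma type2_block (k q i x1 x2 : ℕ) [NeZero q] (hk : 1 ≤ k) (a : (ZMod q)ˣ) (β X U V B 𝒜 : ℝ)
    (hX : 1 ≤ X) (hx1 : X / 2 < x1 + 1) (hx2 : (x2:ℝ) ≤ X)
    (A b : ℕ → ℂ) (hB : 0 ≤ B) (h𝒜 : 0 ≤ 𝒜) (hb : ∀ l, l ≤ x2 → ‖b l‖ ≤ B)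
    (hA : ∀ M : ℕ, 1 ≤ M → (M:ℝ) ≤ X → ∑ m ∈ Ico M (2 * M), ‖A m‖ ^ 2 ≤ 𝒜 * M)
    (hAV : ∀ m : ℕ, (m:ℝ) ≤ V → A m = 0) (hbU : ∀ l : ℕ, (l:ℝ) ≤ U → b l = 0)
    (D : ℝ) (hD : D = q * (1 + |β| * X ^ k)) (hDU : 4 * D ≤ U) (hDV : 2 * D ≤ V) :
    ‖∑ m ∈ (Ioc 0 x2).filter (fun m : ℕ => Nat.log 2 m = i), A m * ∑ l ∈ (Ioc 0 x2).filter (fun l : ℕ => x1 < m * l ∧ m * l ≤ x2),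
        b l * xi k q a β (m * l)‖ ≤
      (2 + Real.log (X + 1)) * (B * rc k q * Real.sqrt ((100 * 16 ^ k * 2 ^ (k + 7)) * 𝒜 * (1 + Real.log X)) *
        (2 ^ k * X / Real.sqrt D)) := by
  classical
  have hq : (1:ℝ) ≤ q := by exact_mod_cast Nat.one_le_iff_ne_zero.2 (NeZero.ne q)
  have hT0 : 0 ≤ |β| * X ^ k := by positivity
  have hqD : (q:ℝ) ≤ D := by rw [hD]; nlinarith
  have hDpos : 0 < D := by linarith
  have hlogX : 0 ≤ Real.log X := Real.log_nonneg hX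
  have hlogX1 : 0 ≤ Real.log (X + 1) := Real.log_nonneg (by linarith)
  have hRHS : 0 ≤ (2 + Real.log (X + 1)) * (B * rc k q * Real.sqrt ((100 * 16 ^ k * 2 ^ (k + 7)) * 𝒜 * (1 + Real.log X)) *
        (2 ^ k * X / Real.sqrt D)) := by positivity
  set M : ℕ := 2 ^ i with hM
  have hM1 : 1 ≤ M := Nat.one_le_two_pow
  have hM1' : (1:ℝ) ≤ M := by exact_mod_cast hM1
  have hmM : ∀ m ∈ (Ioc 0 x2).filter (fun m : ℕ => Nat.log 2 m = i), M ≤ m ∧ m < 2 * M := by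
    intro m hm
    rw [mem_filter, mem_Ioc] at hm
    have h0 : m ≠ 0 := by omega
    refine ⟨?_, ?_⟩
    · rw [hM, ← hm.2]; exact Nat.pow_log_le_self 2 h0
    · rw [hM, ← hm.2, ← pow_succ']; exact Nat.lt_pow_succ_log_self (by norm_num) m
  by_cases hMV : (2 * M : ℝ) ≤ V
  · rw [sum_eq_zero]
    · simpa using hRHS
    · intro m hm
      have : (m:ℝ) ≤ V := by
        refine le_trans ?_ hMV
        exact_mod_cast (hmM m hm).2.le
      rw [hAV m this, zero_mul]
  by_cases hMU : X ≤ U * M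
  · rw [sum_eq_zero]
    · simpa using hRHS
    · intro m hm
      rw [sum_eq_zero, mul_zero]
      intro l hl
      rw [mem_filter] at hl
      have h1 : (m:ℝ) * l ≤ X := le_trans (by exact_mod_cast hl.2.2) hx2
      have h2 : (M:ℝ) * l ≤ X := le_trans (by gcongr; exact (hmM m hm).1) h1
      have h3 : (l:ℝ) ≤ U := by
        have : (M:ℝ) * l ≤ M * U := by linarith
        exact le_of_mul_le_mul_left this (by linarith)
      rw [hbU l h3, zero_mul]
  push Not at hMV hMU
  set N : ℝ := X / (4 * M) with hN
  have hMN : M * N = X / 4 := by rw [hN]; field_simp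
  have h4N : 4 * N * M = X := by rw [hN]; field_simp
  have hUN : U < 4 * N := by
    have : U * M < 4 * N * M := by linarith
    exact lt_of_mul_lt_mul_right this (by linarith)
  set D' : ℝ := q * (1 + |β| * (M * N) ^ k) with hD'
  have hD'D : D' ≤ D := by
    rw [hD', hD, hMN]; gcongr; linarith
  have hDD' : D ≤ 4 ^ k * D' := by
    rw [hD', hD, hMN, div_pow]
    have : (1:ℝ) ≤ 4 ^ k := one_le_pow₀ (by norm_num)
    calc (q:ℝ) * (1 + |β| * X ^ k) ≤ q * (4 ^ k * 1 + |β| * X ^ k) := by gcongr; linarith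
      _ = _ := by field_simp
  have hD'pos : 0 < D' := by positivity
  set L := (Ioc 0 x2).filter (fun l : ℕ => N < l ∧ (l:ℝ) ≤ 4 * N ∧ l.Coprime q) with hL
  set s := ((Ioc 0 x2).filter (fun m : ℕ => Nat.log 2 m = i)).filter (fun m : ℕ => m.Coprime q) with hs
  have hlogle : Real.log (4 * N) ≤ Real.log X := by
    apply Real.log_le_log (by positivity)
    nlinarith [show 0 < N by positivity]
  have hbil := bilin k q M (x2 + 1) hk hM1 a β N B (by linarith) b L s hB
    (fun l hl => hb l (by rw [hL, mem_filter, mem_Ioc] at hl; exact hl.1.2))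
    (fun l hl => by rw [hL, mem_filter] at hl; exact hl.2.2.2)
    (fun l hl => by rw [hL, mem_filter] at hl; exact ⟨hl.2.1, hl.2.2.1⟩)
    (fun m hm => by
      rw [hs, mem_filter] at hm
      exact ⟨(hmM m hm.1).1, (hmM m hm.1).2, hm.2⟩) D' hD' (by linarith) (by linarith) A
    (fun m => x1 / m) (fun m => x2 / m)
    (fun m _ => lt_of_le_of_lt (Nat.div_le_self _ _) (Nat.lt_succ_self _))
    (fun l hl => by rw [hL, mem_filter, mem_Ioc] at hl; omega)
  have heq : ∑ m ∈ (Ioc 0 x2).filter (fun m : ℕ => Nat.log 2 m = i), A m * ∑ l ∈ (Ioc 0 x2).filter (fun l : ℕ => x1 < m * l ∧ m * l ≤ x2),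
        b l * xi k q a β (m * l) = ∑ m ∈ s, A m * ∑ l ∈ L, if x1 / m < l ∧ l ≤ x2 / m then
        (b l * e (β * (l : ℝ) ^ k * (m:ℝ) ^ k)) * ZMod.stdAddChar (((a : ZMod q) * (m : ZMod q) ^ k) * (l : ZMod q) ^ k) else 0 := by
    rw [hs, sum_filter (fun m : ℕ => m.Coprime q)]
    refine sum_congr rfl fun m hm => ?_
    have hm0 : 0 < m := by have := (hmM m hm).1; omega
    split_ifs with hc
    · congr 1
      rw [hL, sum_filter, sum_filter]
      refine sum_congr rfl fun l hl => ?_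
      rw [mem_Ioc] at hl
      have c1 : x1 / m < l ↔ x1 < m * l := by rw [Nat.div_lt_iff_lt_mul hm0, mul_comm]
      have c2 : l ≤ x2 / m ↔ m * l ≤ x2 := by rw [Nat.le_div_iff_mul_le hm0, mul_comm]
      simp only [c1, c2]
      by_cases hh : x1 < m * l ∧ m * l ≤ x2
      · rw [if_pos hh, if_pos hh]
        have c3 : N < l := by
          have h1 : (x1:ℝ) + 1 ≤ m * l := by exact_mod_cast hh.1
          have h2 : (m:ℝ) * l ≤ (2 * M) * l := by gcongr; exact_mod_cast (hmM m hm).2.le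
          have h3 : N * (2 * M) < l * (2 * M) := by nlinarith
          exact lt_of_mul_lt_mul_right h3 (by linarith)
        have c4 : (l:ℝ) ≤ 4 * N := by
          have h1 : (m:ℝ) * l ≤ X := le_trans (by exact_mod_cast hh.2) hx2
          have h2 : (M:ℝ) * l ≤ X := le_trans (by gcongr; exact (hmM m hm).1) h1
          have h3 : (l:ℝ) * M ≤ 4 * N * M := by linarith
          exact le_of_mul_le_mul_right h3 (by linarith)
        unfold xi
        have hcop : (m * l).Coprime q ↔ l.Coprime q := by
          rw [Nat.coprime_mul_iff_left]; exact ⟨fun h => h.2, fun h => ⟨hc, h⟩⟩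
        have hcop2 : (N < l ∧ (l:ℝ) ≤ 4 * N ∧ l.Coprime q) ↔ l.Coprime q := ⟨fun h => h.2.2, fun h => ⟨c3, c4, h⟩⟩
        simp only [hcop, hcop2]
        split_ifs
        · push_cast
          rw [mul_pow, mul_pow, mul_assoc (b l)]
          congr 2
          · congr 1; ring
          · congr 1; ring
        · simp
      · rw [if_neg hh, if_neg hh]; simp
    · rw [sum_eq_zero, mul_zero]
      intro l _
      unfold xi
      rw [if_neg, mul_zero]
      rw [Nat.coprime_mul_iff_left]; exact fun h => hc h.1
  rw [heq]
  refine hbil.trans ?_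
  have hsA : ∑ m ∈ s, ‖A m‖ ^ 2 ≤ 𝒜 * M := by
    refine le_trans (sum_le_sum_of_subset_of_nonneg ?_ (fun _ _ _ => by positivity)) (hA M hM1 ?_)
    · intro m hm
      rw [hs, mem_filter] at hm
      rw [mem_Ico]
      exact ⟨(hmM m hm.1).1, (hmM m hm.1).2⟩
    · nlinarith
  have hlogx : Real.log ((x2 + 1 : ℕ) : ℝ) ≤ Real.log (X + 1) := by
    apply Real.log_le_log (by positivity)
    push_cast; linarith
  have hlog0 : 0 ≤ Real.log ((x2 + 1 : ℕ) : ℝ) := Real.log_nonneg (by push_cast; linarith [show (0:ℝ) ≤ x2 by positivity])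
  refine mul_le_mul (by linarith) ?_ (by positivity) (by positivity)
  have hlog4N : 0 ≤ Real.log (4 * N) := Real.log_nonneg (by linarith)
  exact t2_num k (∑ m ∈ s, ‖A m‖ ^ 2) (100 * 16 ^ k * 2 ^ (k + 7)) (rc k q) B (Real.log (4 * N)) (Real.log X) M N D D' X 𝒜
    (sum_nonneg fun _ _ => by positivity) (by positivity) (by positivity) hB hlog4N hlogle (by positivity) hDpos hD'pos
    (by linarith) h𝒜 hsA hMN hDD'

lemma type2 (k q x1 x2 : ℕ) [NeZero q] (hk : 1 ≤ k) (a : (ZMod q)ˣ) (β X U V B 𝒜 : ℝ)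
    (hX : 1 ≤ X) (hx1 : X / 2 < x1 + 1) (hx2 : (x2:ℝ) ≤ X)
    (A b : ℕ → ℂ) (hB : 0 ≤ B) (h𝒜 : 0 ≤ 𝒜) (hb : ∀ l, l ≤ x2 → ‖b l‖ ≤ B)
    (hA : ∀ M : ℕ, 1 ≤ M → (M:ℝ) ≤ X → ∑ m ∈ Ico M (2 * M), ‖A m‖ ^ 2 ≤ 𝒜 * M)
    (hAV : ∀ m : ℕ, (m:ℝ) ≤ V → A m = 0) (hbU : ∀ l : ℕ, (l:ℝ) ≤ U → b l = 0)
    (D : ℝ) (hD : D = q * (1 + |β| * X ^ k)) (hDU : 4 * D ≤ U) (hDV : 2 * D ≤ V) :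
    ‖∑ m ∈ Ioc 0 x2, A m * ∑ l ∈ (Ioc 0 x2).filter (fun l : ℕ => x1 < m * l ∧ m * l ≤ x2),
        b l * xi k q a β (m * l)‖ ≤
      (2 + 2 * Real.log X) * ((2 + Real.log (X + 1)) * (B * rc k q * Real.sqrt ((100 * 16 ^ k * 2 ^ (k + 7)) * 𝒜 * (1 + Real.log X)) *
        (2 ^ k * X / Real.sqrt D))) := by
  classical
  have hlogX : 0 ≤ Real.log X := Real.log_nonneg hX
  have hlogX1 : 0 ≤ Real.log (X + 1) := Real.log_nonneg (by linarith)
  rw [← sum_fiberwise_of_maps_to (s := Ioc 0 x2) (t := range (Nat.log 2 x2 + 1)) (g := fun m : ℕ => Nat.log 2 m)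
    (fun m hm => mem_range.2 (Nat.lt_succ_of_le (Nat.log_mono_right (mem_Ioc.1 hm).2)))]
  refine (norm_sum_le _ _).trans ?_
  refine (sum_le_sum fun i _ => type2_block k q i x1 x2 hk a β X U V B 𝒜 hX hx1 hx2 A b hB h𝒜 hb hA hAV hbU D hD hDU hDV).trans ?_
  rw [sum_const, nsmul_eq_mul, card_range]
  refine mul_le_mul_of_nonneg_right ?_ (by positivity)
  push_cast
  rcases Nat.eq_zero_or_pos x2 with h | h
  · subst h; simp; linarith
  have h1 : (2:ℝ) ^ (Nat.log 2 x2) ≤ X := le_trans (by exact_mod_cast Nat.pow_log_le_self 2 (by omega)) hx2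
  have h2 := Real.log_le_log (by positivity) h1
  rw [Real.log_pow] at h2
  have h3 := Real.log_two_gt_d9
  have : (Nat.log 2 x2 : ℝ) * (1/2) ≤ Nat.log 2 x2 * Real.log 2 := by gcongr; linarith
  linarith

lemma abel_lin (c : ℕ → ℂ) (s : ℂ) (Eb a b W G : ℝ) (ha : 0 ≤ a) (hab : a ≤ b)
    (hC : ∀ t : ℝ, 0 ≤ t → ‖∑ j ∈ Icc 0 ⌊t⌋₊, c j - s * t‖ ≤ Eb) (f f' : ℝ → ℂ)
    (hf : ∀ t ∈ Set.Icc a b, HasDerivAt f (f' t) t) (hf' : ContinuousOn f' (Set.Icc a b))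
    (hW : ∀ t ∈ Set.Icc a b, ‖f t‖ ≤ W) (hG : ∀ t ∈ Set.Icc a b, ‖f' t‖ ≤ G) :
    ‖∑ j ∈ Ioc ⌊a⌋₊ ⌊b⌋₊, f j * c j‖ ≤ ‖s‖ * ‖∫ t in a..b, f t‖ + Eb * (2 * W + (b - a) * G) := by
  have hEb : 0 ≤ Eb := (norm_nonneg _).trans (hC 0 le_rfl)
  have hder : ∀ t ∈ Set.Icc a b, deriv f t = f' t := fun t ht => (hf t ht).deriv
  have hf'int : IntegrableOn f' (Set.Icc a b) := hf'.integrableOn_Icc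
  have hdint : IntegrableOn (deriv f) (Set.Icc a b) := by
    refine (integrableOn_congr_fun (fun t ht => hder t ht) measurableSet_Icc).2 hf'int
  rw [sum_mul_eq_sub_sub_integral_mul c ha hab (fun t ht => (hf t ht).differentiableAt) hdint]
  have hint1 : IntegrableOn (fun t => f' t * ∑ j ∈ Icc 0 ⌊t⌋₊, c j) (Set.Icc a b) :=
    integrableOn_mul_sum_Icc c ha hf'int
  have hint2 : IntegrableOn (fun t : ℝ => f' t * (t : ℂ)) (Set.Icc a b) :=
    (hf'.mul (Complex.continuous_ofReal.continuousOn)).integrableOn_Icc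
  have e1 : ∫ t in Set.Ioc a b, deriv f t * ∑ j ∈ Icc 0 ⌊t⌋₊, c j =
      (∫ t in a..b, f' t * (∑ j ∈ Icc 0 ⌊t⌋₊, c j - s * t)) + s * ∫ t in a..b, f' t * (t : ℂ) := by
    rw [← intervalIntegral.integral_const_mul, ← intervalIntegral.integral_add, intervalIntegral.integral_of_le hab]
    · refine setIntegral_congr_fun measurableSet_Ioc fun t ht => ?_
      simp only [hder t ⟨ht.1.le, ht.2⟩]
      ring
    · have : IntegrableOn (fun t => f' t * (∑ j ∈ Icc 0 ⌊t⌋₊, c j - s * t)) (Set.Icc a b) := by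
        have h3 := hint1.sub (hint2.const_mul s)
        refine h3.congr (Filter.Eventually.of_forall fun t => ?_)
        simp only [Pi.sub_apply]; ring
      exact (intervalIntegrable_iff_integrableOn_Icc_of_le hab).2 this
    · exact (intervalIntegrable_iff_integrableOn_Icc_of_le hab).2 (hint2.const_mul s)
  have e2 : ∫ t in a..b, f t = f b * b - f a * a - ∫ t in a..b, f' t * (t : ℂ) := by
    have := intervalIntegral.integral_mul_deriv_eq_deriv_mul (a := a) (b := b) (u := f) (u' := f')
      (v := fun t : ℝ => (t : ℂ)) (v' := fun _ => 1)
      (fun t ht => by rw [Set.uIcc_of_le hab] at ht; exact hf t ht) (fun t _ => Complex.ofRealCLM.hasDerivAt)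
      ((intervalIntegrable_iff_integrableOn_Icc_of_le hab).2 hf'int) (by simp)
    simpa using this
  rw [e1]
  have e3 : f b * (∑ j ∈ Icc 0 ⌊b⌋₊, c j) - f a * (∑ j ∈ Icc 0 ⌊a⌋₊, c j) -
      ((∫ t in a..b, f' t * (∑ j ∈ Icc 0 ⌊t⌋₊, c j - s * t)) + s * ∫ t in a..b, f' t * (t : ℂ)) =
      s * (∫ t in a..b, f t) + f b * (∑ j ∈ Icc 0 ⌊b⌋₊, c j - s * b) - f a * (∑ j ∈ Icc 0 ⌊a⌋₊, c j - s * a)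
        - ∫ t in a..b, f' t * (∑ j ∈ Icc 0 ⌊t⌋₊, c j - s * t) := by
    rw [e2]; ring
  rw [e3]
  have b1 : ‖f b * (∑ j ∈ Icc 0 ⌊b⌋₊, c j - s * b)‖ ≤ W * Eb := by
    rw [norm_mul]
    exact mul_le_mul (hW b ⟨hab, le_rfl⟩) (hC b (ha.trans hab)) (norm_nonneg _) ((norm_nonneg _).trans (hW b ⟨hab, le_rfl⟩))
  have b2 : ‖f a * (∑ j ∈ Icc 0 ⌊a⌋₊, c j - s * a)‖ ≤ W * Eb := by
    rw [norm_mul]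
    exact mul_le_mul (hW a ⟨le_rfl, hab⟩) (hC a ha) (norm_nonneg _) ((norm_nonneg _).trans (hW b ⟨hab, le_rfl⟩))
  have b3 : ‖∫ t in a..b, f' t * (∑ j ∈ Icc 0 ⌊t⌋₊, c j - s * t)‖ ≤ (G * Eb) * |b - a| := by
    refine intervalIntegral.norm_integral_le_of_norm_le_const fun t ht => ?_
    rw [Set.uIoc_of_le hab] at ht
    have ht' : t ∈ Set.Icc a b := ⟨ht.1.le, ht.2⟩
    rw [norm_mul]
    exact mul_le_mul (hG t ht') (hC t (ha.trans ht'.1)) (norm_nonneg _) ((norm_nonneg _).trans (hG t ht'))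
  rw [abs_of_nonneg (by linarith)] at b3
  refine (norm_sub_le _ _).trans ?_
  have b4 := norm_sub_le (s * (∫ t in a..b, f t) + f b * (∑ j ∈ Icc 0 ⌊b⌋₊, c j - s * b)) (f a * (∑ j ∈ Icc 0 ⌊a⌋₊, c j - s * a))
  have b5 := norm_add_le (s * (∫ t in a..b, f t)) (f b * (∑ j ∈ Icc 0 ⌊b⌋₊, c j - s * b))
  rw [norm_mul s] at b5
  nlinarith

/-- derivative of `e (γ t^k)` -/
lemma hasDerivAt_epow (k : ℕ) (γ t : ℝ) :
    HasDerivAt (fun t : ℝ => e (γ * t ^ k)) (2 * Real.pi * Complex.I * γ * (k * t ^ (k-1) : ℝ) * e (γ * t ^ k)) t := by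
  have h1 := hasDerivAt_e γ (t ^ k)
  have h2 := hasDerivAt_pow k t
  have h3 := HasDerivAt.scomp (g₁ := fun y : ℝ => e (γ * y)) (h := fun x : ℝ => x ^ k) t h1 h2
  refine HasDerivAt.congr_deriv (f := fun t : ℝ => e (γ * t ^ k)) h3 ?_
  rw [Complex.real_smul]; ring

lemma osc_int (k : ℕ) (hk : 1 ≤ k) (γ Z W : ℝ) (hZ : 0 < Z) (w w' : ℝ → ℝ)
    (hw : ∀ t ∈ Set.Icc (Z/2) Z, HasDerivAt w (w' t) t) (hw' : ContinuousOn w' (Set.Icc (Z/2) Z))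
    (hW : ∀ t ∈ Set.Icc (Z/2) Z, |w t| ≤ W) (hW' : ∀ t ∈ Set.Icc (Z/2) Z, |w' t| ≤ 2 * W / Z) :
    ‖∫ t in (Z/2)..Z, (w t : ℂ) * e (γ * t ^ k)‖ ≤ 2 ^ (k+2) * W * Z / (1 + |γ| * Z ^ k) := by
  have hZ2 : Z / 2 ≤ Z := by linarith
  have hmem : Z ∈ Set.Icc (Z/2) Z := ⟨hZ2, le_rfl⟩
  have hmem2 : Z / 2 ∈ Set.Icc (Z/2) Z := ⟨le_rfl, hZ2⟩
  have hW0 : 0 ≤ W := (abs_nonneg _).trans (hW Z hmem)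
  have h2k : (1:ℝ) ≤ 2 ^ k := one_le_pow₀ (by norm_num)
  rcases le_total (|γ| * Z ^ k) 1 with h | h
  · have : ‖∫ t in (Z/2)..Z, (w t : ℂ) * e (γ * t ^ k)‖ ≤ W * |Z - Z/2| := by
      refine intervalIntegral.norm_integral_le_of_norm_le_const fun t ht => ?_
      rw [Set.uIoc_of_le hZ2] at ht
      rw [norm_mul, norm_e, mul_one, Complex.norm_real]
      exact hW t ⟨ht.1.le, ht.2⟩
    refine this.trans ?_
    rw [abs_of_nonneg (by linarith), le_div_iff₀ (by positivity)]
    calc W * (Z - Z/2) * (1 + |γ| * Z ^ k) ≤ W * (Z - Z/2) * (1 + 1) := by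
          have : 0 ≤ Z - Z/2 := by linarith
          gcongr
      _ = 1 * W * Z := by ring
      _ ≤ 2 ^ (k+2) * W * Z := by gcongr; exact one_le_pow₀ (by norm_num)
  · have hγ : 0 < |γ| := by
      rcases (abs_nonneg γ).eq_or_lt with h' | h'
      · rw [← h'] at h; norm_num at h
      · exact h'
    have hγ0 : γ ≠ 0 := abs_pos.1 hγ
    have hkR : (1:ℝ) ≤ k := by exact_mod_cast hk
    -- u(t) = w t / (2πiγ k t^(k-1))
    set κ : ℂ := 2 * Real.pi * Complex.I * γ * k with hκ
    have hκ0 : κ ≠ 0 := by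
      rw [hκ]
      have : (k:ℂ) ≠ 0 := by exact_mod_cast (by omega : k ≠ 0)
      simp [Real.pi_ne_zero, hγ0, this]
    have hκn : ‖κ‖ = 2 * Real.pi * |γ| * k := by
      rw [hκ]
      simp only [norm_mul, Complex.norm_I, Complex.norm_real, Complex.norm_ofNat, mul_one, Real.norm_eq_abs,
        abs_of_pos Real.pi_pos, Complex.norm_natCast]
    have hκlow : 6 * |γ| * k ≤ ‖κ‖ := by
      rw [hκn]; have := Real.pi_gt_three; gcongr; linarith
    set r : ℝ → ℝ := fun t => w t * (t ^ (k-1))⁻¹ with hr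
    set r' : ℝ → ℝ := fun t => w' t * (t ^ (k-1))⁻¹ + w t * (-(((k-1 : ℕ) : ℝ) * t ^ (k-1-1)) / (t ^ (k-1)) ^ 2) with hr'
    have hpos : ∀ t ∈ Set.Icc (Z/2) Z, 0 < t := fun t ht => lt_of_lt_of_le (by linarith) ht.1
    have hrd : ∀ t ∈ Set.Icc (Z/2) Z, HasDerivAt r (r' t) t := by
      intro t ht
      have := (hw t ht).mul ((hasDerivAt_pow (k-1) t).inv (pow_ne_zero _ (hpos t ht).ne'))
      exact this
    have hr'c : ContinuousOn r' (Set.Icc (Z/2) Z) := by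
      have hwc : ContinuousOn w (Set.Icc (Z/2) Z) := fun t ht => (hw t ht).continuousAt.continuousWithinAt
      refine ContinuousOn.add (hw'.mul (ContinuousOn.inv₀ (by fun_prop) fun t ht => pow_ne_zero _ (hpos t ht).ne'))
        (hwc.mul (ContinuousOn.div (by fun_prop) (by fun_prop) fun t ht => by have := hpos t ht; positivity))
    have hZk : (0:ℝ) < (Z/2) ^ (k-1) := by positivity
    have hrb : ∀ t ∈ Set.Icc (Z/2) Z, |r t| ≤ W / (Z/2) ^ (k-1) := by
      intro t ht
      rw [hr]; simp only
      have h1 := hpos t ht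
      rw [abs_mul, abs_of_pos (show 0 < (t ^ (k-1))⁻¹ by positivity), ← div_eq_mul_inv]
      have := hW t ht
      have := ht.1
      gcongr
    have hr'b : ∀ t ∈ Set.Icc (Z/2) Z, |r' t| ≤ (2 * k * W / Z) / (Z/2) ^ (k-1) := by
      intro t ht
      have h1 := hpos t ht
      have h2 : ((k-1 : ℕ) : ℝ) * t ^ (k-1-1) / (t ^ (k-1)) ^ 2 = ((k-1 : ℕ) : ℝ) / t / t ^ (k-1) := by
        rcases Nat.eq_zero_or_pos (k-1) with h0 | h0
        · rw [h0]; simp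
        · obtain ⟨j, hj⟩ : ∃ j, k - 1 = j + 1 := ⟨k - 2, by omega⟩
          rw [hj, Nat.add_sub_cancel]; field_simp; ring
      have h3 : r' t = (w' t - w t * (((k-1 : ℕ) : ℝ) / t)) / t ^ (k-1) := by
        rw [hr']; simp only
        rw [neg_div, h2]; field_simp; ring
      rw [h3, abs_div, abs_of_pos (show 0 < t ^ (k-1) by positivity)]
      have h4 := hW t ht
      have h5 := hW' t ht
      have h6 := ht.1
      have h7 : |w' t - w t * (((k-1 : ℕ) : ℝ) / t)| ≤ 2 * k * W / Z := by
        refine (abs_sub _ _).trans ?_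
        rw [abs_mul, abs_of_nonneg (show 0 ≤ ((k-1 : ℕ) : ℝ) / t by positivity)]
        calc _ ≤ 2 * W / Z + W * (((k-1 : ℕ) : ℝ) / (Z/2)) := by gcongr
          _ = 2 * k * W / Z := by rw [Nat.cast_sub hk]; field_simp; push_cast; ring
      gcongr
    have hparts := intervalIntegral.integral_mul_deriv_eq_deriv_mul (a := Z/2) (b := Z)
      (u := fun t : ℝ => (r t : ℂ) / κ) (u' := fun t : ℝ => (r' t : ℂ) / κ)
      (v := fun t : ℝ => e (γ * t ^ k)) (v' := fun t : ℝ => 2 * Real.pi * Complex.I * γ * (k * t ^ (k-1) : ℝ) * e (γ * t ^ k))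
      (fun t ht => by
        rw [Set.uIcc_of_le hZ2] at ht
        exact ((hrd t ht).ofReal_comp).div_const κ) (fun t _ => hasDerivAt_epow k γ t)
      (by
        refine ContinuousOn.intervalIntegrable ?_
        rw [Set.uIcc_of_le hZ2]
        exact (Complex.continuous_ofReal.comp_continuousOn hr'c).div_const κ)
      (by
        apply Continuous.intervalIntegrable
        have h3 : Continuous fun t : ℝ => e (γ * t ^ k) := continuous_e.comp (by fun_prop)
        have h4 : Continuous fun t : ℝ => (2 * Real.pi * Complex.I * γ * (k * t ^ (k-1) : ℝ) : ℂ) := by fun_prop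
        exact h4.mul h3)
    have e1 : ∫ t in (Z/2)..Z, (w t : ℂ) * e (γ * t ^ k) = ∫ t in (Z/2)..Z, (r t : ℂ) / κ *
        (2 * Real.pi * Complex.I * γ * (k * t ^ (k-1) : ℝ) * e (γ * t ^ k)) := by
      refine intervalIntegral.integral_congr fun t ht => ?_
      rw [Set.uIcc_of_le hZ2] at ht
      have h1 : (t:ℂ) ≠ 0 := by exact_mod_cast (hpos t ht).ne'
      have h2 : ((t:ℂ) ^ (k-1)) ≠ 0 := pow_ne_zero _ h1
      have h3 : (2 * Real.pi * Complex.I * γ * (k * t ^ (k-1) : ℝ) : ℂ) = κ * (t:ℂ) ^ (k-1) := by rw [hκ]; push_cast; ring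
      rw [hr]
      simp only
      rw [h3]
      push_cast
      field_simp
    rw [e1, hparts]
    set A := W / (Z/2) ^ (k-1) / ‖κ‖ with hA
    have hκpos : 0 < ‖κ‖ := norm_pos_iff.2 hκ0
    have b1 : ∀ t ∈ Set.Icc (Z/2) Z, ‖(r t : ℂ) / κ * e (γ * t ^ k)‖ ≤ A := by
      intro t ht
      rw [norm_mul, norm_e, mul_one, norm_div, Complex.norm_real, hA]
      have := hrb t ht
      rw [Real.norm_eq_abs]; gcongr
    have b2 : ‖∫ t in (Z/2)..Z, (r' t : ℂ) / κ * e (γ * t ^ k)‖ ≤ ((2 * k / Z) * A) * |Z - Z/2| := by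
      refine intervalIntegral.norm_integral_le_of_norm_le_const fun t ht => ?_
      rw [Set.uIoc_of_le hZ2] at ht
      have ht' : t ∈ Set.Icc (Z/2) Z := ⟨ht.1.le, ht.2⟩
      rw [norm_mul, norm_e, mul_one, norm_div, Complex.norm_real, hA]
      have := hr'b t ht'
      rw [Real.norm_eq_abs]
      calc |r' t| / ‖κ‖ ≤ ((2 * k * W / Z) / (Z/2) ^ (k-1)) / ‖κ‖ := by gcongr
        _ = _ := by ring
    have b3 : ((2 * k / Z) * A) * |Z - Z/2| = k * A := by
      rw [abs_of_nonneg (by linarith)]; field_simp; ring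
    rw [b3] at b2
    have b4 := b1 Z hmem
    have b5 := b1 (Z/2) hmem2
    refine (norm_sub_le _ _).trans ?_
    have b6 := norm_sub_le ((r Z : ℂ) / κ * e (γ * Z ^ k)) ((r (Z/2) : ℂ) / κ * e (γ * (Z/2) ^ k))
    have hA0 : 0 ≤ A := by positivity
    have b7 : A ≤ 2 ^ k * W * Z / (6 * k * (|γ| * Z ^ k)) := by
      calc A ≤ W / (Z/2) ^ (k-1) / (6 * |γ| * k) := by rw [hA]; gcongr
        _ = 2 ^ (k-1) * W * Z / (6 * k * (|γ| * Z ^ k)) := by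
            have : Z ^ k = Z ^ (k-1) * Z := by rw [← pow_succ]; congr 1; omega
            rw [this, div_pow]; field_simp
        _ ≤ _ := by
            gcongr
            · norm_num
            · omega
    calc _ ≤ (2 + k) * A := by push_cast at b6 b2 ⊢; linarith
      _ ≤ (3 * k) * (2 ^ k * W * Z / (6 * k * (|γ| * Z ^ k))) := by gcongr; linarith
      _ = 2 ^ k * W * Z / (2 * (|γ| * Z ^ k)) := by field_simp; ring
      _ ≤ 2 ^ k * W * Z / (1 + |γ| * Z ^ k) := by gcongr; linarith
      _ ≤ _ := by
          gcongr
          · norm_num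
          · omega

lemma xi_zero_add (k q : ℕ) [NeZero q] (b : ZMod q) (l : ℕ) : xi k q b 0 (l + q) = xi k q b 0 l := by
  unfold xi
  simp

lemma xi_sum_period (k q : ℕ) [NeZero q] (b : ZMod q) : ∑ l ∈ range q, xi k q b 0 l = GS k q b := by
  unfold GS
  symm
  have h0 : ∑ l ∈ range q, xi k q b 0 l = ∑ l ∈ (range q).filter (fun l : ℕ => l.Coprime q), ZMod.stdAddChar (b * (l : ZMod q) ^ k) := by
    rw [sum_filter]
    refine sum_congr rfl fun l _ => ?_
    unfold xi
    split_ifs with h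
    · have : e (0 * (l:ℝ) ^ k) = 1 := by unfold e; simp
      rw [this, one_mul]
    · rfl
  rw [h0]
  refine sum_nbij' (fun u : (ZMod q)ˣ => (u : ZMod q).val)
    (fun l => if h : l.Coprime q then ZMod.unitOfCoprime l h else 1) ?_ ?_ ?_ ?_ ?_
  · intro u _
    simp only [mem_filter, mem_range]
    exact ⟨ZMod.val_lt _, ZMod.val_coe_unit_coprime u⟩
  · intro l _; exact mem_univ _
  · intro u _
    have h := ZMod.val_coe_unit_coprime u
    rw [dif_pos h]
    ext
    rw [ZMod.coe_unitOfCoprime, ZMod.natCast_zmod_val]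
  · intro l hl
    simp only [mem_filter, mem_range] at hl
    rw [dif_pos hl.2, ZMod.coe_unitOfCoprime, ZMod.val_cast_of_lt hl.1]
  · intro u _
    rw [ZMod.natCast_zmod_val]

lemma xi_sum_mul (k q : ℕ) [NeZero q] (b : ZMod q) (j : ℕ) : ∑ l ∈ range (j * q), xi k q b 0 l = j * GS k q b := by
  induction j with
  | zero => simp
  | succ j ih =>
    have h2 : ∀ l, xi k q b 0 (j * q + l) = xi k q b 0 l := by
      intro l
      clear ih
      induction j with
      | zero => simp
      | succ j ih => rw [← ih, ← xi_zero_add k q b (j * q + l)]; congr 1; ring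
    rw [add_mul, one_mul, sum_range_add, ih, sum_congr rfl (fun l _ => h2 l), xi_sum_period]
    push_cast; ring

lemma GS_triv (k q : ℕ) [NeZero q] (b : ZMod q) : ‖GS k q b‖ ≤ q := by
  unfold GS
  refine (norm_sum_le _ _).trans ?_
  rw [sum_congr rfl (fun u _ => norm_chi _)]
  simp only [sum_const, nsmul_eq_mul, mul_one, card_univ, ZMod.card_units_eq_totient]
  exact_mod_cast Nat.totient_le q

lemma xi_count (k q : ℕ) [NeZero q] (b : ZMod q) (t : ℝ) (ht : 0 ≤ t) :
    ‖∑ j ∈ Icc 0 ⌊t⌋₊, xi k q b 0 j - (GS k q b / q) * t‖ ≤ 2 * q := by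
  have hq : (0:ℝ) < q := by exact_mod_cast Nat.pos_of_ne_zero (NeZero.ne q)
  have hq1 : (1:ℝ) ≤ q := by exact_mod_cast Nat.pos_of_ne_zero (NeZero.ne q)
  have hI : Icc 0 ⌊t⌋₊ = range (⌊t⌋₊ + 1) := by ext j; simp
  set M := ⌊t⌋₊ + 1 with hM
  have hMt : (M:ℝ) ≤ t + 1 := by rw [hM]; push_cast; linarith [Nat.floor_le ht]
  have htM : t < M := by rw [hM]; push_cast; exact Nat.lt_floor_add_one t
  have hd : (M / q) * q + M % q = M := by rw [mul_comm]; exact Nat.div_add_mod M q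
  have hdR : ((M / q : ℕ) : ℝ) * q + (M % q : ℕ) = M := by exact_mod_cast hd
  have hr : ((M % q : ℕ):ℝ) ≤ q := by exact_mod_cast (Nat.mod_lt M (Nat.pos_of_ne_zero (NeZero.ne q))).le
  rw [hI]
  nth_rewrite 1 [← hd]
  rw [sum_range_add, xi_sum_mul]
  have h1 : ‖∑ x ∈ range (M % q), xi k q b 0 ((M / q) * q + x)‖ ≤ q := by
    refine (norm_sum_le _ _).trans ((sum_le_sum fun x _ => norm_xi_le k q b 0 _).trans ?_)
    simpa using hr
  have h2 : ‖((M / q : ℕ) : ℂ) * GS k q b - (GS k q b / q) * t‖ ≤ q := by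
    have hqc : (q:ℂ) ≠ 0 := by exact_mod_cast hq.ne'
    have : ((M / q : ℕ) : ℂ) * GS k q b - (GS k q b / q) * t = (GS k q b / q) * (((((M / q : ℕ):ℝ) * q - t : ℝ)) : ℂ) := by
      push_cast; field_simp
    rw [this, norm_mul, norm_div, Complex.norm_natCast, Complex.norm_real]
    have h3 : ‖GS k q b‖ / q ≤ 1 := (div_le_one hq).2 (GS_triv k q b)
    have h4 : ‖((M / q : ℕ):ℝ) * q - t‖ ≤ q := by
      rw [Real.norm_eq_abs, abs_le]
      have : (0:ℝ) ≤ (M % q : ℕ) := by positivity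
      constructor <;> linarith
    calc _ ≤ 1 * (q:ℝ) := mul_le_mul h3 h4 (norm_nonneg _) zero_le_one
      _ = q := one_mul _
  calc _ = ‖(((M / q : ℕ) : ℂ) * GS k q b - (GS k q b / q) * t) + ∑ x ∈ range (M % q), xi k q b 0 ((M / q) * q + x)‖ := by
        congr 1; ring
    _ ≤ _ := (norm_add_le _ _).trans (by linarith)

lemma typeI_inner (k q : ℕ) [NeZero q] (hk : 1 ≤ k) (b : (ZMod q)ˣ) (γ Z W : ℝ) (hZ : 0 < Z) (w w' : ℝ → ℝ)
    (hw : ∀ t ∈ Set.Icc (Z/2) Z, HasDerivAt w (w' t) t) (hw' : ContinuousOn w' (Set.Icc (Z/2) Z))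
    (hW : ∀ t ∈ Set.Icc (Z/2) Z, |w t| ≤ W) (hW' : ∀ t ∈ Set.Icc (Z/2) Z, |w' t| ≤ 2 * W / Z) :
    ‖∑ l ∈ Ioc ⌊Z/2⌋₊ ⌊Z⌋₊, (w l : ℂ) * xi k q b γ l‖ ≤
      (rc k q / Real.sqrt q) * (2 ^ (k+2) * W * Z / (1 + |γ| * Z ^ k)) + 8 * k * W * (q * (1 + |γ| * Z ^ k)) := by
  have hq : (0:ℝ) < q := by exact_mod_cast Nat.pos_of_ne_zero (NeZero.ne q)
  have hZ2 : Z / 2 ≤ Z := by linarith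
  have hW0 : 0 ≤ W := (abs_nonneg _).trans (hW Z ⟨hZ2, le_rfl⟩)
  have hk1 : (1:ℝ) ≤ k := by exact_mod_cast hk
  have hwc : ContinuousOn w (Set.Icc (Z/2) Z) := fun t ht => (hw t ht).continuousAt.continuousWithinAt
  have hec : Continuous fun t : ℝ => e (γ * t ^ k) := continuous_e.comp (by fun_prop)
  have h := abel_lin (fun l => xi k q b 0 l) (GS k q b / q) (2 * q) (Z/2) Z W
    (2 * W / Z + W * (2 * Real.pi * |γ| * (k * Z ^ (k-1)))) (by linarith) hZ2
    (fun t ht => xi_count k q b t ht) (fun t => (w t : ℂ) * e (γ * t ^ k))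
    (fun t => (w' t : ℂ) * e (γ * t ^ k) + (w t : ℂ) * (2 * Real.pi * Complex.I * γ * (k * t ^ (k-1) : ℝ) * e (γ * t ^ k)))
    (fun t ht => ((hw t ht).ofReal_comp).mul (hasDerivAt_epow k γ t))
    (by
      have h4 : Continuous fun t : ℝ => (2 * Real.pi * Complex.I * γ * (k * t ^ (k-1) : ℝ) : ℂ) := by fun_prop
      exact ((Complex.continuous_ofReal.comp_continuousOn hw').mul hec.continuousOn).add
        ((Complex.continuous_ofReal.comp_continuousOn hwc).mul (h4.mul hec).continuousOn))
    (fun t ht => by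
      rw [norm_mul, norm_e, mul_one, Complex.norm_real]; exact hW t ht)
    (fun t ht => by
      have ht0 : 0 ≤ t := by linarith [ht.1]
      refine (norm_add_le _ _).trans ?_
      simp only [norm_mul, norm_e, mul_one, Complex.norm_real, Complex.norm_I, Complex.norm_ofNat, Real.norm_eq_abs,
        abs_of_pos Real.pi_pos, Nat.abs_cast, abs_pow, abs_of_nonneg ht0]
      have := hW t ht
      have := hW' t ht
      have := ht.2
      have := Real.pi_pos
      gcongr)
  have e1 : ∑ l ∈ Ioc ⌊Z/2⌋₊ ⌊Z⌋₊, (w l : ℂ) * xi k q b γ l = ∑ l ∈ Ioc ⌊Z/2⌋₊ ⌊Z⌋₊, ((w l : ℂ) * e (γ * (l:ℝ) ^ k)) * xi k q b 0 l := by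
    refine sum_congr rfl fun l _ => ?_
    unfold xi
    split_ifs with h
    · have : e (0 * (l:ℝ) ^ k) = 1 := by unfold e; simp
      rw [this]; ring
    · simp
  rw [e1]
  refine h.trans ?_
  have hosc := osc_int k hk γ Z W hZ w w' hw hw' hW hW'
  have hs : ‖GS k q b / q‖ ≤ rc k q / Real.sqrt q := by
    rw [norm_div, Complex.norm_natCast]
    rw [div_le_div_iff₀ hq (Real.sqrt_pos.2 hq)]
    calc _ ≤ (rc k q * Real.sqrt q) * Real.sqrt q := by gcongr; exact GS_bound k q b
      _ = rc k q * q := by rw [mul_assoc, Real.mul_self_sqrt hq.le]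
  refine add_le_add (mul_le_mul hs hosc (norm_nonneg _) (by positivity)) ?_
  have hZk : Z ^ k = Z ^ (k-1) * Z := by rw [← pow_succ]; congr 1; omega
  have : (2 * q : ℝ) * (2 * W + (Z - Z/2) * (2 * W / Z + W * (2 * Real.pi * |γ| * (k * Z ^ (k-1))))) =
     6 * W * q + 2 * Real.pi * k * W * (q * (|γ| * Z ^ k)) := by
    rw [hZk]; field_simp; ring
  rw [this]
  have hpi := Real.pi_lt_four
  calc _ ≤ 6 * W * q * k + 2 * 4 * k * W * (q * (|γ| * Z ^ k)) := by
        refine add_le_add (le_mul_of_one_le_right (by positivity) hk1) ?_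
        gcongr
    _ ≤ _ := by nlinarith [show 0 ≤ W * q * k by positivity]

lemma typeI_m (k q m : ℕ) [NeZero q] (hk : 1 ≤ k) (hm : 1 ≤ m) (a : (ZMod q)ˣ) (β X W : ℝ) (hX : 0 < X) (w w' : ℝ → ℝ)
    (hw : ∀ t ∈ Set.Icc (X/m/2) (X/m), HasDerivAt w (w' t) t) (hw' : ContinuousOn w' (Set.Icc (X/m/2) (X/m)))
    (hW : ∀ t ∈ Set.Icc (X/m/2) (X/m), |w t| ≤ W) (hW' : ∀ t ∈ Set.Icc (X/m/2) (X/m), |w' t| ≤ 2 * W / (X/m)) :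
    ‖∑ l ∈ (Ioc 0 ⌊X⌋₊).filter (fun l : ℕ => ⌊X/2⌋₊ < m * l ∧ m * l ≤ ⌊X⌋₊), (w l : ℂ) * xi k q a β (m * l)‖ ≤
      (rc k q / Real.sqrt q) * (2 ^ (k+2) * W * (X/m) / (1 + |β| * X ^ k)) + 8 * k * W * (q * (1 + |β| * X ^ k)) := by
  have hm0 : (0:ℝ) < m := by exact_mod_cast hm
  have hZ : 0 < X / m := by positivity
  have hW0 : 0 ≤ W := (abs_nonneg _).trans (hW (X/m) ⟨by linarith, le_rfl⟩)
  by_cases hc : m.Coprime q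
  · set b : (ZMod q)ˣ := a * (ZMod.unitOfCoprime m hc) ^ k with hb
    have h := typeI_inner k q hk b (β * (m:ℝ) ^ k) (X/m) W hZ w w' hw hw' hW hW'
    have e1 : |β * (m:ℝ) ^ k| * (X / m) ^ k = |β| * X ^ k := by
      rw [abs_mul, abs_of_pos (show (0:ℝ) < (m:ℝ) ^ k by positivity), div_pow]; field_simp
    rw [e1] at h
    refine le_trans (le_of_eq ?_) h
    congr 1
    refine sum_congr ?_ ?_
    · ext l
      simp only [mem_filter, mem_Ioc]
      have c1 : ⌊X/2⌋₊ < m * l ↔ ⌊X/m/2⌋₊ < l := by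
        rw [Nat.floor_lt (by positivity), Nat.floor_lt (by positivity), div_right_comm, div_lt_iff₀ hm0]
        push_cast; rw [mul_comm]
      have c2 : m * l ≤ ⌊X⌋₊ ↔ l ≤ ⌊X/m⌋₊ := by
        rw [Nat.le_floor_iff hX.le, Nat.le_floor_iff hZ.le, le_div_iff₀ hm0]
        push_cast; rw [mul_comm]
      rw [c1, ← c2]
      constructor
      · rintro ⟨_, h1, h2⟩; exact ⟨h1, h2⟩
      · rintro ⟨h1, h2⟩
        refine ⟨⟨by omega, ?_⟩, h1, h2⟩
        nlinarith
    · intro l _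
      congr 1
      unfold xi
      have c1 : (m * l).Coprime q ↔ l.Coprime q := by
        rw [Nat.coprime_mul_iff_left]; exact ⟨fun h => h.2, fun h => ⟨hc, h⟩⟩
      simp only [c1]
      have c2 : ((b : (ZMod q)ˣ) : ZMod q) = a * (m : ZMod q) ^ k := by
        rw [hb]; push_cast; rw [ZMod.coe_unitOfCoprime]
      rw [c2]
      push_cast
      rw [mul_pow, mul_pow, mul_assoc, mul_assoc]
  · have : ∀ l ∈ (Ioc 0 ⌊X⌋₊).filter (fun l : ℕ => ⌊X/2⌋₊ < m * l ∧ m * l ≤ ⌊X⌋₊), (w l : ℂ) * xi k q a β (m * l) = 0 := by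
      intro l _
      have : ¬ (m * l).Coprime q := fun h => hc (Nat.coprime_mul_iff_left.1 h).1
      unfold xi
      rw [if_neg this, mul_zero]
    rw [sum_eq_zero this, norm_zero]
    positivity

lemma conv_dbl {R : Type*} [AddCommMonoid R] (x1 x2 : ℕ) (F : ℕ → ℕ → R) :
    ∑ n ∈ Ioc x1 x2, ∑ x ∈ n.divisorsAntidiagonal, F x.1 x.2 =
      ∑ m ∈ Ioc 0 x2, ∑ l ∈ (Ioc 0 x2).filter (fun l : ℕ => x1 < m * l ∧ m * l ≤ x2), F m l := by
  trans ∑ n ∈ Ioc x1 x2, ∑ x ∈ (Ioc 0 x2 ×ˢ Ioc 0 x2).filter (fun x => x.1 * x.2 = n), F x.1 x.2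
  · refine sum_congr rfl fun n hn => ?_
    simp only [mem_Ioc] at hn
    rw [Nat.divisorsAntidiagonal_eq_prod_filter_of_le (by omega) hn.2]
  · simp_rw [sum_filter]
    rw [sum_comm, sum_product]
    refine sum_congr rfl fun m _ => sum_congr rfl fun l _ => ?_
    rw [sum_ite_eq]
    simp only [mem_Ioc]

lemma sum_inv_le (N : ℕ) : ∑ m ∈ Ioc 0 N, ((m:ℝ))⁻¹ ≤ 1 + Real.log N := by
  have h := harmonic_le_one_add_log N
  rw [harmonic_eq_sum_Icc] at h
  push_cast at h
  exact h

lemma sum_inv_le' (N : ℕ) (Y : ℝ) (hN : (N:ℝ) ≤ Y) (hY : 1 ≤ Y) : ∑ m ∈ Ioc 0 N, ((m:ℝ))⁻¹ ≤ 1 + Real.log Y := by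
  refine (sum_inv_le N).trans ?_
  rcases Nat.eq_zero_or_pos N with h | h
  · subst h; simp; exact Real.log_nonneg hY
  · have : (0:ℝ) < N := by exact_mod_cast h
    gcongr

lemma dv_sum (N : ℕ) : ∑ n ∈ Ioc 0 N, (n.divisors.card : ℝ) ≤ N * (1 + Real.log N) := by
  have h1 : ∀ n ∈ Ioc 0 N, (n.divisors.card : ℝ) = ∑ x ∈ n.divisorsAntidiagonal, (1:ℝ) := by
    intro n _
    rw [sum_const, nsmul_eq_mul, mul_one, ← Nat.map_div_right_divisors, card_map]
  rw [sum_congr rfl h1, conv_dbl 0 N (fun _ _ => (1:ℝ))]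
  calc _ ≤ ∑ m ∈ Ioc 0 N, (N:ℝ) * (m:ℝ)⁻¹ := by
        refine sum_le_sum fun m hm => ?_
        simp only [mem_Ioc] at hm
        rw [sum_const, nsmul_eq_mul, mul_one]
        have hm0 : (0:ℝ) < m := by exact_mod_cast hm.1
        have : (Ioc 0 N).filter (fun l : ℕ => 0 < m * l ∧ m * l ≤ N) ⊆ Ioc 0 (N / m) := by
          intro l hl
          simp only [mem_filter, mem_Ioc] at hl ⊢
          refine ⟨hl.1.1, (Nat.le_div_iff_mul_le hm.1).2 (by rw [mul_comm]; exact hl.2.2)⟩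
        have h2 := card_le_card this
        rw [Nat.card_Ioc, Nat.sub_zero] at h2
        calc _ ≤ ((N / m : ℕ) : ℝ) := by exact_mod_cast h2
          _ ≤ (N:ℝ) / m := Nat.cast_div_le
          _ = _ := div_eq_mul_inv _ _
    _ = N * ∑ m ∈ Ioc 0 N, (m:ℝ)⁻¹ := by rw [mul_sum]
    _ ≤ _ := by gcongr; exact sum_inv_le N

lemma dv_submul (a b : ℕ) : (a * b).divisors.card ≤ a.divisors.card * b.divisors.card := by
  rw [Nat.divisors_mul]; exact Finset.card_mul_le

lemma dv_sum_inv (N : ℕ) : ∑ n ∈ Ioc 0 N, (n.divisors.card : ℝ) * (n:ℝ)⁻¹ ≤ (1 + Real.log N) ^ 2 := by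
  have h1 : ∀ n ∈ Ioc 0 N, (n.divisors.card : ℝ) * (n:ℝ)⁻¹ = ∑ x ∈ n.divisorsAntidiagonal, (x.1:ℝ)⁻¹ * (x.2:ℝ)⁻¹ := by
    intro n _
    rw [← Nat.map_div_right_divisors, sum_map, ← nsmul_eq_mul, ← sum_const]
    refine sum_congr rfl fun d hd => ?_
    show (n:ℝ)⁻¹ = (d:ℝ)⁻¹ * ((n / d : ℕ):ℝ)⁻¹
    rw [← mul_inv]; congr 1
    exact_mod_cast (Nat.mul_div_cancel' (Nat.dvd_of_mem_divisors hd)).symm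
  rw [sum_congr rfl h1, conv_dbl 0 N (fun a b => (a:ℝ)⁻¹ * (b:ℝ)⁻¹)]
  calc _ ≤ ∑ m ∈ Ioc 0 N, ∑ l ∈ Ioc 0 N, (m:ℝ)⁻¹ * (l:ℝ)⁻¹ := by
        refine sum_le_sum fun m _ => sum_le_sum_of_subset_of_nonneg (filter_subset _ _) fun l _ _ => by positivity
    _ = (∑ m ∈ Ioc 0 N, (m:ℝ)⁻¹) ^ 2 := by rw [sq, sum_mul_sum]
    _ ≤ _ := by
        have : 0 ≤ ∑ m ∈ Ioc 0 N, (m:ℝ)⁻¹ := sum_nonneg fun _ _ => by positivity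
        gcongr; exact sum_inv_le N

lemma dv_sq (N : ℕ) : ∑ n ∈ Ioc 0 N, (n.divisors.card : ℝ) ^ 2 ≤ N * (1 + Real.log N) ^ 3 := by
  have h1 : ∀ n ∈ Ioc 0 N, (n.divisors.card : ℝ) ^ 2 ≤ ∑ x ∈ n.divisorsAntidiagonal, (x.1.divisors.card : ℝ) * (x.2.divisors.card : ℝ) := by
    intro n _
    rw [sq]
    have hc : n.divisorsAntidiagonal.card = n.divisors.card := by rw [← Nat.map_div_right_divisors, card_map]
    nth_rewrite 1 [← hc]
    rw [← nsmul_eq_mul, ← sum_const]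
    refine sum_le_sum fun x hx => ?_
    have : x.1 * x.2 = n := (Nat.mem_divisorsAntidiagonal.1 hx).1
    rw [← this]
    exact_mod_cast dv_submul x.1 x.2
  refine (sum_le_sum h1).trans ?_
  rw [conv_dbl 0 N (fun a b => (a.divisors.card : ℝ) * (b.divisors.card : ℝ))]
  have hlog : 0 ≤ Real.log N := Real.log_natCast_nonneg N
  calc _ ≤ ∑ m ∈ Ioc 0 N, (m.divisors.card : ℝ) * ((N * (m:ℝ)⁻¹) * (1 + Real.log N)) := by
        refine sum_le_sum fun m hm => ?_
        simp only [mem_Ioc] at hm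
        rw [← mul_sum]
        have hm0 : (0:ℝ) < m := by exact_mod_cast hm.1
        have hs : (Ioc 0 N).filter (fun l : ℕ => 0 < m * l ∧ m * l ≤ N) ⊆ Ioc 0 (N / m) := by
          intro l hl
          simp only [mem_filter, mem_Ioc] at hl ⊢
          refine ⟨hl.1.1, (Nat.le_div_iff_mul_le hm.1).2 (by rw [mul_comm]; exact hl.2.2)⟩
        have h2 : ∑ l ∈ (Ioc 0 N).filter (fun l : ℕ => 0 < m * l ∧ m * l ≤ N), (l.divisors.card : ℝ) ≤ ∑ l ∈ Ioc 0 (N / m), (l.divisors.card : ℝ) :=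
          sum_le_sum_of_subset_of_nonneg hs fun l _ _ => by positivity
        have h3 : ((N / m : ℕ) : ℝ) ≤ N * (m:ℝ)⁻¹ := by rw [← div_eq_mul_inv]; exact Nat.cast_div_le
        have h4 : Real.log ((N / m : ℕ) : ℝ) ≤ Real.log N := by
          rcases Nat.eq_zero_or_pos (N / m) with h | h
          · rw [h]; simpa using hlog
          · have : (0:ℝ) < (N / m : ℕ) := by exact_mod_cast h
            gcongr; exact Nat.div_le_self N m
        gcongr
        refine h2.trans ((dv_sum _).trans ?_)
        have : 0 ≤ Real.log ((N / m : ℕ) : ℝ) := Real.log_natCast_nonneg _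
        gcongr
    _ = (N * (1 + Real.log N)) * ∑ m ∈ Ioc 0 N, (m.divisors.card : ℝ) * (m:ℝ)⁻¹ := by
        rw [mul_sum]; refine sum_congr rfl fun m _ => ?_; ring
    _ ≤ (N * (1 + Real.log N)) * (1 + Real.log N) ^ 2 := by gcongr; exact dv_sum_inv N
    _ = _ := by ring

noncomputable def trl (T : ℝ) (g : ArithmeticFunction ℝ) : ArithmeticFunction ℝ :=
  ⟨fun n => if (n:ℝ) ≤ T then g n else 0, by simp⟩

lemma trl_apply (T : ℝ) (g : ArithmeticFunction ℝ) (n : ℕ) : trl T g n = if (n:ℝ) ≤ T then g n else 0 := rfl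

lemma af_sub_apply (g h : ArithmeticFunction ℝ) (n : ℕ) : (g - h) n = g n - h n := by
  have : (g - h + h) n = g n := by rw [sub_add_cancel]
  rw [ArithmeticFunction.add_apply] at this
  linarith

lemma vaughan_id (U : ℝ) :
    ArithmeticFunction.vonMangoldt = trl U ArithmeticFunction.vonMangoldt +
      trl U (ArithmeticFunction.moebius : ArithmeticFunction ℝ) * ArithmeticFunction.log -
      (trl U (ArithmeticFunction.moebius : ArithmeticFunction ℝ) * trl U ArithmeticFunction.vonMangoldt) *
        (ArithmeticFunction.zeta : ArithmeticFunction ℝ) +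
      (((ArithmeticFunction.moebius : ArithmeticFunction ℝ) - trl U (ArithmeticFunction.moebius : ArithmeticFunction ℝ)) *
        (ArithmeticFunction.zeta : ArithmeticFunction ℝ)) *
        (ArithmeticFunction.vonMangoldt - trl U ArithmeticFunction.vonMangoldt) := by
  have h1 := ArithmeticFunction.vonMangoldt_mul_zeta
  have h2 : (ArithmeticFunction.moebius : ArithmeticFunction ℝ) * (ArithmeticFunction.zeta : ArithmeticFunction ℝ) = 1 :=
    ArithmeticFunction.coe_moebius_mul_coe_zeta
  rw [← h1]
  linear_combination (-ArithmeticFunction.vonMangoldt + trl U ArithmeticFunction.vonMangoldt) * h2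

lemma conv_af (x1 x2 : ℕ) (g h : ArithmeticFunction ℝ) (ξ : ℕ → ℂ) :
    ∑ n ∈ Ioc x1 x2, (((g * h) n : ℝ) : ℂ) * ξ n =
      ∑ m ∈ Ioc 0 x2, (g m : ℂ) * ∑ l ∈ (Ioc 0 x2).filter (fun l : ℕ => x1 < m * l ∧ m * l ≤ x2), (h l : ℂ) * ξ (m * l) := by
  have e1 : ∀ n ∈ Ioc x1 x2, (((g * h) n : ℝ) : ℂ) * ξ n = ∑ x ∈ n.divisorsAntidiagonal, (g x.1 : ℂ) * ((h x.2 : ℂ) * ξ (x.1 * x.2)) := by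
    intro n _
    rw [ArithmeticFunction.mul_apply, Complex.ofReal_sum, sum_mul]
    refine sum_congr rfl fun x hx => ?_
    rw [(Nat.mem_divisorsAntidiagonal.1 hx).1]; push_cast; ring
  rw [sum_congr rfl e1, conv_dbl x1 x2 (fun a b => (g a : ℂ) * ((h b : ℂ) * ξ (a * b)))]
  refine sum_congr rfl fun m _ => ?_
  rw [mul_sum]

lemma typeI_sum (g : ℕ → ℝ) (inner : ℕ → ℂ) (G K1 K2 X Y : ℝ) (x2 : ℕ) (hG : 0 ≤ G) (hK1 : 0 ≤ K1) (hK2 : 0 ≤ K2)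
    (hY0 : 0 ≤ Y) (hX : 1 ≤ X) (hx2 : (x2:ℝ) ≤ X) (hg : ∀ m ∈ Ioc 0 x2, |g m| ≤ G) (hY : ∀ m : ℕ, Y < m → g m = 0)
    (hin : ∀ m ∈ Ioc 0 x2, (m:ℝ) ≤ Y → ‖inner m‖ ≤ K1 * (m:ℝ)⁻¹ + K2) :
    ‖∑ m ∈ Ioc 0 x2, (g m : ℂ) * inner m‖ ≤ G * (K1 * (1 + Real.log X) + K2 * Y) := by
  have e1 : ∑ m ∈ Ioc 0 x2, (g m : ℂ) * inner m = ∑ m ∈ (Ioc 0 x2).filter (fun m : ℕ => (m:ℝ) ≤ Y), (g m : ℂ) * inner m := by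
    rw [sum_filter]
    refine sum_congr rfl fun m _ => ?_
    split_ifs with h
    · rfl
    · rw [hY m (not_le.1 h)]; simp
  rw [e1]
  calc _ ≤ ∑ m ∈ (Ioc 0 x2).filter (fun m : ℕ => (m:ℝ) ≤ Y), G * (K1 * (m:ℝ)⁻¹ + K2) := by
        refine (norm_sum_le _ _).trans (sum_le_sum fun m hm => ?_)
        rw [mem_filter] at hm
        rw [norm_mul, Complex.norm_real]
        exact mul_le_mul (hg m hm.1) (hin m hm.1 hm.2) (norm_nonneg _) hG
    _ = G * (K1 * (∑ m ∈ (Ioc 0 x2).filter (fun m : ℕ => (m:ℝ) ≤ Y), (m:ℝ)⁻¹) + K2 * ((Ioc 0 x2).filter (fun m : ℕ => (m:ℝ) ≤ Y)).card) := by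
        rw [← mul_sum, sum_add_distrib, ← mul_sum, sum_const, nsmul_eq_mul]; ring
    _ ≤ _ := by
        have h1 : ∑ m ∈ (Ioc 0 x2).filter (fun m : ℕ => (m:ℝ) ≤ Y), (m:ℝ)⁻¹ ≤ 1 + Real.log X :=
          (sum_le_sum_of_subset_of_nonneg (filter_subset _ _) fun l _ _ => by positivity).trans (sum_inv_le' x2 X hx2 hX)
        have h2 : (((Ioc 0 x2).filter (fun m : ℕ => (m:ℝ) ≤ Y)).card : ℝ) ≤ Y := by
          have : (Ioc 0 x2).filter (fun m : ℕ => (m:ℝ) ≤ Y) ⊆ Ioc 0 ⌊Y⌋₊ := by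
            intro m hm
            simp only [mem_filter, mem_Ioc] at hm ⊢
            exact ⟨hm.1.1, Nat.le_floor hm.2⟩
          have := card_le_card this
          rw [Nat.card_Ioc, Nat.sub_zero] at this
          exact le_trans (by exact_mod_cast this) (Nat.floor_le hY0)
        gcongr

lemma abs_mu_le (n : ℕ) : |((ArithmeticFunction.moebius : ArithmeticFunction ℝ) n)| ≤ 1 := by
  rw [ArithmeticFunction.intCoe_apply]
  exact_mod_cast ArithmeticFunction.abs_moebius_le_one (n := n)

lemma abs_trl_mu (U : ℝ) (n : ℕ) : |trl U (ArithmeticFunction.moebius : ArithmeticFunction ℝ) n| ≤ 1 := by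
  rw [trl_apply]; split_ifs
  · exact abs_mu_le n
  · simp

lemma abs_sub_trl_mu (U : ℝ) (n : ℕ) : |((ArithmeticFunction.moebius : ArithmeticFunction ℝ) - trl U (ArithmeticFunction.moebius : ArithmeticFunction ℝ)) n| ≤ 1 := by
  rw [af_sub_apply, trl_apply]; split_ifs
  · simp
  · simpa using abs_mu_le n

lemma abs_conv_small (U : ℝ) (m : ℕ) : |(trl U (ArithmeticFunction.moebius : ArithmeticFunction ℝ) * trl U ArithmeticFunction.vonMangoldt) m| ≤ Real.log m := by
  rw [ArithmeticFunction.mul_apply]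
  refine (abs_sum_le_sum_abs _ _).trans ?_
  have h := ArithmeticFunction.vonMangoldt_mul_zeta
  have h2 : Real.log m = ∑ x ∈ m.divisorsAntidiagonal, ArithmeticFunction.vonMangoldt x.2 := by
    rw [← ArithmeticFunction.vonMangoldt_sum]
    rw [Nat.sum_divisorsAntidiagonal' (f := fun a b => ArithmeticFunction.vonMangoldt b)]
  rw [h2]
  refine sum_le_sum fun x _ => ?_
  rw [abs_mul]
  have h0 := ArithmeticFunction.vonMangoldt_nonneg (n := x.2)
  have h3 : |trl U ArithmeticFunction.vonMangoldt x.2| ≤ ArithmeticFunction.vonMangoldt x.2 := by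
    rw [trl_apply]; split_ifs
    · rw [abs_of_nonneg h0]
    · rw [abs_zero]; exact h0
  calc _ ≤ 1 * ArithmeticFunction.vonMangoldt x.2 := mul_le_mul (abs_trl_mu U _) h3 (abs_nonneg _) zero_le_one
    _ = _ := one_mul _

lemma conv_small_supp (U : ℝ) (m : ℕ) (h : U * U < m) : (trl U (ArithmeticFunction.moebius : ArithmeticFunction ℝ) * trl U ArithmeticFunction.vonMangoldt) m = 0 := by
  rw [ArithmeticFunction.mul_apply]
  refine sum_eq_zero fun x hx => ?_
  rw [trl_apply, trl_apply]
  by_cases h1 : (x.1:ℝ) ≤ U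
  · by_cases h2 : (x.2:ℝ) ≤ U
    · exfalso
      have : ((x.1:ℝ)) * x.2 = m := by exact_mod_cast (Nat.mem_divisorsAntidiagonal.1 hx).1
      have h3 : (x.1:ℝ) * x.2 ≤ U * U := mul_le_mul h1 h2 (by positivity) ((Nat.cast_nonneg _).trans h1)
      linarith
    · rw [if_neg h2, mul_zero]
  · rw [if_neg h1, zero_mul]

lemma abs_conv_big (U : ℝ) (m : ℕ) : |(((ArithmeticFunction.moebius : ArithmeticFunction ℝ) - trl U (ArithmeticFunction.moebius : ArithmeticFunction ℝ)) * (ArithmeticFunction.zeta : ArithmeticFunction ℝ)) m| ≤ m.divisors.card := by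
  rw [ArithmeticFunction.coe_mul_zeta_apply]
  refine (abs_sum_le_sum_abs _ _).trans ((sum_le_sum fun x _ => abs_sub_trl_mu U x).trans ?_)
  simp

lemma conv_big_supp (U : ℝ) (m : ℕ) (h : (m:ℝ) ≤ U) : (((ArithmeticFunction.moebius : ArithmeticFunction ℝ) - trl U (ArithmeticFunction.moebius : ArithmeticFunction ℝ)) * (ArithmeticFunction.zeta : ArithmeticFunction ℝ)) m = 0 := by
  rw [ArithmeticFunction.coe_mul_zeta_apply]
  refine sum_eq_zero fun x hx => ?_
  have hx1 : (x:ℝ) ≤ m := by exact_mod_cast Nat.divisor_le hx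
  rw [af_sub_apply, trl_apply, if_pos (hx1.trans h), sub_self]

lemma vmain_num (k ρ sq H D l lX lX1 X U C0 : ℝ) (hk : 0 ≤ k) (hρ : 0 ≤ ρ) (hsq : 0 < sq) (hH : 1 ≤ H) (hD : D = sq ^ 2 * H)
    (hl : 1 ≤ l) (hlX0 : 0 ≤ lX) (hlX : 1 + lX ≤ l) (hX : 1 ≤ X) (hU : 1 ≤ U)
    (hlX1 : 0 ≤ lX1) (hlX1' : 1 + lX1 ≤ l) (p2 : ℝ) (hp2 : 0 ≤ p2) (hC0 : 0 ≤ C0) :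
    1 * ((ρ / sq * (4 * p2 * l * X / H)) * (1 + lX) + (8 * k * l * D) * U) +
    l * ((ρ / sq * (4 * p2 * 1 * X / H)) * (1 + lX) + (8 * k * 1 * D) * (U * U)) +
    (2 + 2 * lX) * ((2 + lX1) * (lX * ρ * Real.sqrt (C0 * (2 * l ^ 3) * (1 + lX)) * (p2 * X / Real.sqrt D)))
    ≤ (8 * p2 + 16 * k + 4 * p2 * Real.sqrt (2 * C0)) * (l ^ 5 * (ρ * X / Real.sqrt D + U ^ 2 * D)) := by
  have hD0 : 0 < D := by rw [hD]; positivity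
  have hsD : Real.sqrt D ≤ sq * H := by
    rw [Real.sqrt_le_left (by positivity), hD]
    nlinarith [show 0 < sq ^ 2 * H by positivity]
  have hsD0 : 0 < Real.sqrt D := Real.sqrt_pos.2 hD0
  have b1 : ρ * X / (sq * H) ≤ ρ * X / Real.sqrt D := by gcongr
  set T := ρ * X / Real.sqrt D with hT
  have hT0 : 0 ≤ T := by positivity
  have h2 : l ^ 2 ≤ l ^ 5 := pow_le_pow_right₀ hl (by norm_num)
  have h1 : l ≤ l ^ 5 := by simpa using pow_le_pow_right₀ hl (show 1 ≤ 5 by norm_num)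
  have c1 : (ρ / sq * (4 * p2 * l * X / H)) * (1 + lX) ≤ 4 * p2 * (l ^ 5 * T) := by
    calc _ = 4 * p2 * (l * (1 + lX) * (ρ * X / (sq * H))) := by field_simp
      _ ≤ 4 * p2 * (l * l * T) := by gcongr
      _ ≤ 4 * p2 * (l ^ 5 * T) := by gcongr; linarith
  have c2 : l * ((ρ / sq * (4 * p2 * 1 * X / H)) * (1 + lX)) ≤ 4 * p2 * (l ^ 5 * T) := by
    calc _ = 4 * p2 * (l * (1 + lX) * (ρ * X / (sq * H))) := by field_simp
      _ ≤ 4 * p2 * (l * l * T) := by gcongr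
      _ ≤ 4 * p2 * (l ^ 5 * T) := by gcongr; linarith
  have hUU : U ≤ U ^ 2 := by nlinarith
  have c3 : (8 * k * l * D) * U ≤ 8 * k * (l ^ 5 * (U ^ 2 * D)) := by
    calc _ = 8 * k * (l * (U * D)) := by ring
      _ ≤ _ := by gcongr
  have c4 : l * ((8 * k * 1 * D) * (U * U)) ≤ 8 * k * (l ^ 5 * (U ^ 2 * D)) := by
    calc _ = 8 * k * (l * (U ^ 2 * D)) := by ring
      _ ≤ _ := by gcongr
  have hs : Real.sqrt (C0 * (2 * l ^ 3) * (1 + lX)) ≤ Real.sqrt (2 * C0) * l ^ 2 := by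
    rw [show Real.sqrt (2 * C0) * l ^ 2 = Real.sqrt (2 * C0 * (l ^ 2) ^ 2) by
      rw [Real.sqrt_mul (show 0 ≤ 2 * C0 by positivity) ((l ^ 2) ^ 2), Real.sqrt_sq (by positivity)]]
    apply Real.sqrt_le_sqrt
    calc _ ≤ C0 * (2 * l ^ 3) * l := by gcongr
      _ = _ := by ring
  have c5 : (2 + 2 * lX) * ((2 + lX1) * (lX * ρ * Real.sqrt (C0 * (2 * l ^ 3) * (1 + lX)) * (p2 * X / Real.sqrt D)))
      ≤ 4 * p2 * Real.sqrt (2 * C0) * (l ^ 5 * T) := by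
    calc _ ≤ (2 * l) * ((2 * l) * (l * ρ * (Real.sqrt (2 * C0) * l ^ 2) * (p2 * X / Real.sqrt D))) := by
          gcongr <;> linarith
      _ = _ := by rw [hT]; ring
  have c6 : 0 ≤ l ^ 5 * (U ^ 2 * D) := by positivity
  have c7 : 0 ≤ l ^ 5 * T := by positivity
  have c8 : 0 ≤ Real.sqrt (2 * C0) := Real.sqrt_nonneg _
  have c9 : 0 ≤ p2 * (l ^ 5 * (U ^ 2 * D)) := by positivity
  have c10 : 0 ≤ k * (l ^ 5 * T) := by positivity
  have c11 : 0 ≤ p2 * Real.sqrt (2 * C0) * (l ^ 5 * (U ^ 2 * D)) := by positivity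
  nlinarith

lemma typeI_log (k q m : ℕ) [NeZero q] (hk : 1 ≤ k) (hm : 1 ≤ m) (a : (ZMod q)ˣ) (β X : ℝ) (hX : 2 ≤ X / m) :
    ‖∑ l ∈ (Ioc 0 ⌊X⌋₊).filter (fun l : ℕ => ⌊X/2⌋₊ < m * l ∧ m * l ≤ ⌊X⌋₊), (ArithmeticFunction.log l : ℂ) * xi k q a β (m * l)‖ ≤
      (rc k q / Real.sqrt q) * (4 * 2 ^ k * (1 + Real.log X) * X / (1 + |β| * X ^ k)) * (m:ℝ)⁻¹ + 8 * k * (1 + Real.log X) * (q * (1 + |β| * X ^ k)) := by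
  have hm0 : (0:ℝ) < m := by exact_mod_cast hm
  have hm1 : (1:ℝ) ≤ m := by exact_mod_cast hm
  have hX0 : 0 < X := by
    by_contra h
    have : X / m ≤ 0 := div_nonpos_of_nonpos_of_nonneg (not_lt.1 h) hm0.le
    linarith
  have hXm : X / m ≤ X := div_le_self hX0.le hm1
  have hlX : 0 ≤ Real.log X := Real.log_nonneg (by linarith)
  have h := typeI_m k q m hk hm a β X (1 + Real.log X) hX0 Real.log (fun t => t⁻¹)
    (fun t ht => Real.hasDerivAt_log (by linarith [ht.1]))
    (ContinuousOn.inv₀ continuousOn_id fun t ht => by have := ht.1; exact ne_of_gt (show (0:ℝ) < t by linarith))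
    (fun t ht => by
      have h1 : 1 ≤ t := by linarith [ht.1]
      rw [abs_of_nonneg (Real.log_nonneg h1)]
      have := Real.log_le_log (by linarith) (ht.2.trans hXm)
      linarith)
    (fun t ht => by
      have h1 : 0 < t := by linarith [ht.1]
      rw [abs_of_pos (by positivity), inv_eq_one_div, div_le_div_iff₀ h1 (by linarith)]
      nlinarith [ht.1, mul_nonneg h1.le hlX])
  refine h.trans (le_of_eq ?_)
  rw [pow_add]; field_simp; ring

lemma typeI_one (k q m : ℕ) [NeZero q] (hk : 1 ≤ k) (hm : 1 ≤ m) (a : (ZMod q)ˣ) (β X : ℝ) (hX0 : 0 < X) :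
    ‖∑ l ∈ (Ioc 0 ⌊X⌋₊).filter (fun l : ℕ => ⌊X/2⌋₊ < m * l ∧ m * l ≤ ⌊X⌋₊), (((ArithmeticFunction.zeta : ArithmeticFunction ℝ) l : ℝ) : ℂ) * xi k q a β (m * l)‖ ≤
      (rc k q / Real.sqrt q) * (4 * 2 ^ k * 1 * X / (1 + |β| * X ^ k)) * (m:ℝ)⁻¹ + 8 * k * 1 * (q * (1 + |β| * X ^ k)) := by
  have hm0 : (0:ℝ) < m := by exact_mod_cast hm
  have h := typeI_m k q m hk hm a β X 1 hX0 (fun _ => 1) (fun _ => 0)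
    (fun t ht => hasDerivAt_const t _) continuousOn_const (fun t ht => by simp)
    (fun t ht => by rw [abs_zero]; positivity)
  have e1 : ∑ l ∈ (Ioc 0 ⌊X⌋₊).filter (fun l : ℕ => ⌊X/2⌋₊ < m * l ∧ m * l ≤ ⌊X⌋₊), (((ArithmeticFunction.zeta : ArithmeticFunction ℝ) l : ℝ) : ℂ) * xi k q a β (m * l) =
      ∑ l ∈ (Ioc 0 ⌊X⌋₊).filter (fun l : ℕ => ⌊X/2⌋₊ < m * l ∧ m * l ≤ ⌊X⌋₊), ((1:ℝ) : ℂ) * xi k q a β (m * l) := by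
    refine sum_congr rfl fun l hl => ?_
    simp only [mem_filter, mem_Ioc] at hl
    rw [ArithmeticFunction.natCoe_apply, ArithmeticFunction.zeta_apply, if_neg (by omega)]
    simp
  rw [e1]
  refine h.trans (le_of_eq ?_)
  rw [pow_add]; field_simp; ring

noncomputable def vC (k : ℕ) : ℝ := 8 * 2 ^ k + 16 * k + 4 * 2 ^ k * Real.sqrt (2 * (100 * 16 ^ k * 2 ^ (k+7)))

lemma vaughan_main (k q : ℕ) [NeZero q] (hk : 1 ≤ k) (a : (ZMod q)ˣ) (β X U D : ℝ) (hX : 4 ≤ X) (hU : 1 ≤ U)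
    (hUX : U * U < X / 2) (hD : D = q * (1 + |β| * X ^ k)) (hDU : 4 * D ≤ U) :
    ‖∑ n ∈ Ioc ⌊X/2⌋₊ ⌊X⌋₊, (ArithmeticFunction.vonMangoldt n : ℂ) * xi k q a β n‖ ≤
      vC k * ((1 + Real.log (2 * X)) ^ 5 * (rc k q * X / Real.sqrt D + U ^ 2 * D)) := by
  have hq : (0:ℝ) < q := by exact_mod_cast Nat.pos_of_ne_zero (NeZero.ne q)
  have hX0 : 0 < X := by linarith
  set l := 1 + Real.log (2 * X) with hl
  have hlX0 : 0 ≤ Real.log X := Real.log_nonneg (by linarith)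
  have hlX : 1 + Real.log X ≤ l := by
    have := Real.log_le_log hX0 (show X ≤ 2 * X by linarith); linarith
  have hlX1 : 1 + Real.log (X + 1) ≤ l := by
    have := Real.log_le_log (by linarith) (show X + 1 ≤ 2 * X by linarith); linarith
  have hlX10 : 0 ≤ Real.log (X+1) := Real.log_nonneg (by linarith)
  have hl1 : 1 ≤ l := by linarith
  set H := 1 + |β| * X ^ k with hH
  have hH1 : 1 ≤ H := by have : 0 ≤ |β| * X ^ k := by positivity
                         linarith
  have hD0 : 0 < D := by rw [hD]; positivity
  have hfl : ((⌊X⌋₊ : ℕ) : ℝ) ≤ X := Nat.floor_le hX0.le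
  set μr : ArithmeticFunction ℝ := (ArithmeticFunction.moebius : ArithmeticFunction ℝ) with hμr
  set ζr : ArithmeticFunction ℝ := (ArithmeticFunction.zeta : ArithmeticFunction ℝ) with hζr
  set Λ := ArithmeticFunction.vonMangoldt with hΛ
  have hUU : U ≤ U * U := by nlinarith
  -- decomposition
  have e1 : ∑ n ∈ Ioc ⌊X/2⌋₊ ⌊X⌋₊, (Λ n : ℂ) * xi k q a β n =
      ∑ n ∈ Ioc ⌊X/2⌋₊ ⌊X⌋₊, (((trl U μr * ArithmeticFunction.log) n : ℝ) : ℂ) * xi k q a β n -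
      ∑ n ∈ Ioc ⌊X/2⌋₊ ⌊X⌋₊, ((((trl U μr * trl U Λ) * ζr) n : ℝ) : ℂ) * xi k q a β n +
      ∑ n ∈ Ioc ⌊X/2⌋₊ ⌊X⌋₊, (((((μr - trl U μr) * ζr) * (Λ - trl U Λ)) n : ℝ) : ℂ) * xi k q a β n := by
    rw [← sum_sub_distrib, ← sum_add_distrib]
    refine sum_congr rfl fun n hn => ?_
    rw [mem_Ioc, Nat.floor_lt (by positivity)] at hn
    have h0 : trl U Λ n = 0 := by rw [trl_apply, if_neg (by linarith [hn.1])]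
    have h1 : Λ n = (trl U Λ + trl U μr * ArithmeticFunction.log - (trl U μr * trl U Λ) * ζr +
        ((μr - trl U μr) * ζr) * (Λ - trl U Λ)) n := by
      rw [← vaughan_id U]
    rw [ArithmeticFunction.add_apply, af_sub_apply, ArithmeticFunction.add_apply, h0, zero_add] at h1
    rw [h1]; push_cast; ring
  rw [e1, conv_af _ _ (trl U μr) ArithmeticFunction.log, conv_af _ _ (trl U μr * trl U Λ) ζr, conv_af _ _ ((μr - trl U μr) * ζr) (Λ - trl U Λ)]
  have hrho : (0:ℝ) ≤ rc k q := by positivity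
  have T1 := typeI_sum (fun m => trl U μr m) (fun m => ∑ l ∈ (Ioc 0 ⌊X⌋₊).filter (fun l : ℕ => ⌊X/2⌋₊ < m * l ∧ m * l ≤ ⌊X⌋₊), (ArithmeticFunction.log l : ℂ) * xi k q a β (m * l))
    1 ((rc k q / Real.sqrt q) * (4 * 2 ^ k * l * X / H)) (8 * k * l * D) X U ⌊X⌋₊ zero_le_one (by positivity) (by positivity) (by linarith)
    (by linarith) hfl (fun m _ => abs_trl_mu U m) (fun m hm => by rw [trl_apply, if_neg (not_le.2 hm)])
    (fun m hm hmU => by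
      rw [mem_Ioc] at hm
      have hm0 : (0:ℝ) < m := by exact_mod_cast hm.1
      refine (typeI_log k q m hk hm.1 a β X ?_).trans ?_
      · rw [le_div_iff₀ hm0]; linarith
      · rw [hD, ← hH]
        gcongr)
  have T2 := typeI_sum (fun m => (trl U μr * trl U Λ) m) (fun m => ∑ l ∈ (Ioc 0 ⌊X⌋₊).filter (fun l : ℕ => ⌊X/2⌋₊ < m * l ∧ m * l ≤ ⌊X⌋₊), (ζr l : ℂ) * xi k q a β (m * l))
    l ((rc k q / Real.sqrt q) * (4 * 2 ^ k * 1 * X / H)) (8 * k * 1 * D) X (U * U) ⌊X⌋₊ (by linarith) (by positivity) (by positivity) (by positivity)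
    (by linarith) hfl
    (fun m hm => by
      refine (abs_conv_small U m).trans ?_
      rw [mem_Ioc] at hm
      have hm0 : (0:ℝ) < m := by exact_mod_cast hm.1
      have h1 : (m:ℝ) ≤ X := le_trans (by exact_mod_cast hm.2) hfl
      have := Real.log_le_log hm0 h1
      linarith)
    (fun m hm => conv_small_supp U m hm)
    (fun m hm hmU => by
      rw [mem_Ioc] at hm
      refine (typeI_one k q m hk hm.1 a β X hX0).trans ?_
      rw [hD])
  have T3 := type2 k q ⌊X/2⌋₊ ⌊X⌋₊ hk a β X U U (Real.log X) (2 * l ^ 3) (by linarith)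
    (by exact_mod_cast Nat.lt_floor_add_one (X/2)) hfl
    (fun m => ((((μr - trl U μr) * ζr) m : ℝ) : ℂ)) (fun m => (((Λ - trl U Λ) m : ℝ) : ℂ)) hlX0 (by positivity)
    (fun m hm => by
      rw [Complex.norm_real, af_sub_apply, trl_apply]
      rcases Nat.eq_zero_or_pos m with h | h
      · subst h; simpa using hlX0
      · have hm0 : (0:ℝ) < m := by exact_mod_cast h
        have h1 : (m:ℝ) ≤ X := le_trans (by exact_mod_cast hm) hfl
        have h2 := Real.log_le_log hm0 h1
        split_ifs
        · simpa using hlX0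
        · rw [sub_zero, Real.norm_eq_abs, abs_of_nonneg ArithmeticFunction.vonMangoldt_nonneg]
          exact ArithmeticFunction.vonMangoldt_le_log.trans h2)
    (fun M hM hMX => by
      have hM0 : (0:ℝ) < M := by exact_mod_cast hM
      have hsub : Ico M (2*M) ⊆ Ioc 0 (2*M) := by
        intro m hm; rw [mem_Ico] at hm; rw [mem_Ioc]; omega
      calc _ ≤ ∑ m ∈ Ico M (2*M), (m.divisors.card : ℝ) ^ 2 := by
            refine sum_le_sum fun m _ => ?_
            rw [Complex.norm_real]
            have := abs_conv_big U m
            rw [Real.norm_eq_abs]; gcongr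
        _ ≤ ∑ m ∈ Ioc 0 (2*M), (m.divisors.card : ℝ) ^ 2 := sum_le_sum_of_subset_of_nonneg hsub fun _ _ _ => by positivity
        _ ≤ ((2 * M : ℕ) : ℝ) * (1 + Real.log ((2 * M : ℕ) : ℝ)) ^ 3 := dv_sq (2*M)
        _ ≤ (2 * M) * l ^ 3 := by
            have h1 : 0 ≤ Real.log ((2 * M : ℕ) : ℝ) := Real.log_natCast_nonneg _
            have h2 : Real.log ((2 * M : ℕ) : ℝ) ≤ Real.log (2 * X) := by
              push_cast
              gcongr
            push_cast at h1 h2 ⊢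
            gcongr
            linarith
        _ = _ := by ring)
    (fun m hm => by rw [conv_big_supp U m hm]; simp)
    (fun m hm => by rw [af_sub_apply, trl_apply, if_pos hm]; simp)
    D (by rw [hD]) hDU (by linarith)
  refine (norm_add_le _ _).trans ((add_le_add (norm_sub_le _ _) le_rfl).trans ?_)
  refine (add_le_add (add_le_add T1 T2) T3).trans ?_
  have := vmain_num k (rc k q) (Real.sqrt q) H D l (Real.log X) (Real.log (X+1)) X U (100 * 16 ^ k * 2 ^ (k+7)) (by positivity) hrho
    (Real.sqrt_pos.2 hq) hH1 (by rw [Real.sq_sqrt hq.le, hD]) hl1 hlX0 hlX (by linarith) hU hlX10 hlX1 (2 ^ k) (by positivity) (by positivity)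
  exact this

lemma xi_eq_e (k q a : ℕ) [NeZero q] (β : ℝ) (n : ℕ) (h : n.Coprime q) :
    xi k q (a : ZMod q) β n = e (((a:ℝ) / q + β) * (n:ℝ) ^ k) := by
  unfold xi
  rw [if_pos h]
  have : ((a : ZMod q) * (n : ZMod q) ^ k) = ((a * n ^ k : ℕ) : ZMod q) := by push_cast; rfl
  rw [this, chi_eq_e, ← e_add]
  congr 1; push_cast; ring

lemma prime_sum (k q a : ℕ) [NeZero q] (β X : ℝ) (hX : 1 ≤ X) (hq : (q:ℝ) ≤ X / 2) :
    ‖∑ p ∈ (Ioc ⌊X/2⌋₊ ⌊X⌋₊).filter Nat.Prime, e (((a:ℝ) / q + β) * (p:ℝ) ^ k) * (Real.log p)‖ ≤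
      ‖∑ n ∈ Ioc ⌊X/2⌋₊ ⌊X⌋₊, (ArithmeticFunction.vonMangoldt n : ℂ) * xi k q (a : ZMod q) β n‖ + 2 * Real.sqrt X * Real.log X := by
  have hnn : ∀ n : ℕ, 0 ≤ ArithmeticFunction.vonMangoldt n - (if n.Prime then Real.log n else 0) := by
    intro n
    split_ifs with h
    · rw [ArithmeticFunction.vonMangoldt_apply_prime h, sub_self]
    · rw [sub_zero]; exact ArithmeticFunction.vonMangoldt_nonneg
  have e1 : ∑ p ∈ (Ioc ⌊X/2⌋₊ ⌊X⌋₊).filter Nat.Prime, e (((a:ℝ) / q + β) * (p:ℝ) ^ k) * (Real.log p) =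
      ∑ n ∈ Ioc ⌊X/2⌋₊ ⌊X⌋₊, (ArithmeticFunction.vonMangoldt n : ℂ) * xi k q (a : ZMod q) β n -
      ∑ n ∈ Ioc ⌊X/2⌋₊ ⌊X⌋₊, ((ArithmeticFunction.vonMangoldt n - (if n.Prime then Real.log n else 0) : ℝ) : ℂ) * xi k q (a : ZMod q) β n := by
    rw [← sum_sub_distrib, sum_filter]
    refine sum_congr rfl fun n hn => ?_
    rw [mem_Ioc, Nat.floor_lt (by positivity)] at hn
    split_ifs with h
    · have hc : n.Coprime q := by
        rw [Nat.Prime.coprime_iff_not_dvd h]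
        intro hd
        have h1 := Nat.le_of_dvd (Nat.pos_of_ne_zero (NeZero.ne q)) hd
        have h2 : (n:ℝ) ≤ q := by exact_mod_cast h1
        linarith [hn.1]
      rw [xi_eq_e k q a β n hc]; push_cast; ring
    · push_cast; ring
  rw [e1]
  refine (norm_sub_le _ _).trans ?_
  gcongr
  calc _ ≤ ∑ n ∈ Ioc ⌊X/2⌋₊ ⌊X⌋₊, (ArithmeticFunction.vonMangoldt n - (if n.Prime then Real.log n else 0)) := by
        refine (norm_sum_le _ _).trans (sum_le_sum fun n _ => ?_)
        rw [norm_mul, Complex.norm_real, Real.norm_eq_abs, abs_of_nonneg (hnn n)]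
        exact mul_le_of_le_one_right (hnn n) (norm_xi_le k q _ β n)
    _ ≤ ∑ n ∈ Ioc 0 ⌊X⌋₊, (ArithmeticFunction.vonMangoldt n - (if n.Prime then Real.log n else 0)) := by
        refine sum_le_sum_of_subset_of_nonneg (Ioc_subset_Ioc_left (Nat.zero_le _)) fun n _ _ => hnn n
    _ = Chebyshev.psi X - Chebyshev.theta X := by
        rw [sum_sub_distrib, ← sum_filter]; rfl
    _ ≤ _ := Chebyshev.psi_sub_theta_le hX

lemma key_num (V C1 l X lX ρ D q T : ℝ) (hV : 0 ≤ V) (hC1 : 0 ≤ C1) (hX : (2:ℝ) ^ 15 ≤ X) (hl : l ≤ 3 * lX) (hl0 : 0 ≤ l) (hlX : 1 ≤ lX)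
    (hq1 : 1 ≤ q) (hρ0 : 0 ≤ ρ) (hqD : q ≤ D) (hρ : ρ ≤ C1 * q ^ (1/10:ℝ)) (hD : D ≤ X ^ (1/30:ℝ)) (hT : T = X * lX ^ 5 * D ^ (-(2/5):ℝ)) :
    V * (l ^ 5 * (ρ * X / Real.sqrt D + (4 * X ^ (1/30:ℝ)) ^ 2 * D)) + 2 * Real.sqrt X * lX ≤ (V * 243 * (C1 + 16) + 2) * T := by
  have hX1 : 1 ≤ X := le_trans (by norm_num) hX
  have hX0 : 0 < X := by linarith
  have hD0 : 0 < D := by linarith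
  have hD1 : 1 ≤ D := by linarith
  have h1 : ρ * X / Real.sqrt D ≤ C1 * (X * D ^ (-(2/5):ℝ)) := by
    calc ρ * X / Real.sqrt D ≤ (C1 * D ^ (1/10:ℝ)) * X / Real.sqrt D := by
          gcongr
          refine hρ.trans ?_
          gcongr
      _ = C1 * (X * (D ^ (1/10:ℝ) / D ^ (1/2:ℝ))) := by rw [Real.sqrt_eq_rpow]; ring
      _ = _ := by rw [← Real.rpow_sub hD0]; norm_num
  have hlow : X ^ (9/10:ℝ) ≤ X * D ^ (-(2/5):ℝ) := by
    calc X ^ (9/10:ℝ) ≤ X ^ (1 + (1/30) * (-(2/5)) : ℝ) := by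
          apply Real.rpow_le_rpow_of_exponent_le hX1; norm_num
      _ = X * (X ^ (1/30:ℝ)) ^ (-(2/5):ℝ) := by rw [Real.rpow_add hX0, Real.rpow_one, Real.rpow_mul hX0.le]
      _ ≤ _ := by
          gcongr X * ?_
          exact Real.rpow_le_rpow_of_nonpos hD0 hD (by norm_num)
  have h2 : (4 * X ^ (1/30:ℝ)) ^ 2 * D ≤ 16 * (X * D ^ (-(2/5):ℝ)) := by
    calc (4 * X ^ (1/30:ℝ)) ^ 2 * D ≤ (4 * X ^ (1/30:ℝ)) ^ 2 * X ^ (1/30:ℝ) := by gcongr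
      _ = 16 * (X ^ (1/30:ℝ)) ^ 3 := by ring
      _ = 16 * X ^ (1/10:ℝ) := by rw [← Real.rpow_natCast, ← Real.rpow_mul hX0.le]; norm_num
      _ ≤ 16 * X ^ (9/10:ℝ) := by
          gcongr 16 * ?_
          exact Real.rpow_le_rpow_of_exponent_le hX1 (by norm_num)
      _ ≤ _ := by gcongr
  have h3 : Real.sqrt X ≤ X * D ^ (-(2/5):ℝ) := by
    refine le_trans ?_ hlow
    rw [Real.sqrt_eq_rpow]
    apply Real.rpow_le_rpow_of_exponent_le hX1; norm_num
  set Y := X * D ^ (-(2/5):ℝ) with hY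
  have hY0 : 0 ≤ Y := by positivity
  have hl5 : l ^ 5 ≤ 243 * lX ^ 5 := by
    calc l ^ 5 ≤ (3 * lX) ^ 5 := by gcongr
      _ = _ := by ring
  have hlx5 : lX ≤ lX ^ 5 := by simpa using pow_le_pow_right₀ hlX (show 1 ≤ 5 by norm_num)
  have hTY : T = lX ^ 5 * Y := by rw [hT, hY]; ring
  rw [hTY]
  have hs0 : 0 ≤ ρ * X / Real.sqrt D + (4 * X ^ (1/30:ℝ)) ^ 2 * D := by positivity
  calc _ ≤ V * ((243 * lX ^ 5) * (C1 * Y + 16 * Y)) + 2 * Y * lX ^ 5 := by gcongr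
    _ = _ := by ring

lemma key_prop (k : ℕ) (hk : 1 ≤ k) : ∃ C : ℝ, 0 < C ∧ ∀ X : ℝ, (2:ℝ) ^ 15 ≤ X → ∀ a q : ℕ, 1 ≤ q → Nat.gcd a q = 1 →
    ∀ β : ℝ, q * (1 + |β| * X ^ k) ≤ X ^ (1/30:ℝ) →
    ‖∑ p ∈ (Ioc ⌊X/2⌋₊ ⌊X⌋₊).filter Nat.Prime, e (((a:ℝ) / q + β) * (p:ℝ) ^ k) * (Real.log p)‖ ≤
      C * (X * Real.log X ^ 5 * (q * (1 + |β| * X ^ k)) ^ (-(2/5):ℝ)) := by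
  obtain ⟨C1, hC1, hrc⟩ := rc_bound k hk
  have hV : 0 ≤ vC k := by unfold vC; positivity
  refine ⟨vC k * 243 * (C1 + 16) + 2, by positivity, fun X hX a q hq hg β hD => ?_⟩
  have : NeZero q := ⟨by omega⟩
  have hX1 : 1 ≤ X := le_trans (by norm_num) hX
  have hX0 : 0 < X := by linarith
  have hq1 : (1:ℝ) ≤ q := by exact_mod_cast hq
  have hqD : (q:ℝ) ≤ q * (1 + |β| * X ^ k) := by
    have : 0 ≤ |β| * X ^ k := by positivity
    nlinarith
  set D : ℝ := q * (1 + |β| * X ^ k) with hDdef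
  have hY15 : (X ^ (1/15:ℝ)) ^ 15 = X := by rw [← Real.rpow_natCast, ← Real.rpow_mul hX0.le]; norm_num
  have hY2 : 2 ≤ X ^ (1/15:ℝ) := by
    calc (2:ℝ) = (2 ^ 15) ^ (1/15:ℝ) := by rw [← Real.rpow_natCast, ← Real.rpow_mul (by norm_num)]; norm_num
      _ ≤ _ := by gcongr
  have h30 : (X ^ (1/30:ℝ)) ^ 2 = X ^ (1/15:ℝ) := by rw [← Real.rpow_natCast, ← Real.rpow_mul hX0.le]; norm_num
  have hU1 : 1 ≤ X ^ (1/30:ℝ) := Real.one_le_rpow hX1 (by norm_num)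
  have hbig : 32 * X ^ (1/15:ℝ) < X := by
    set Y := X ^ (1/15:ℝ)
    have h14 : (2:ℝ) ^ 14 ≤ Y ^ 14 := by gcongr
    rw [← hY15]
    calc 32 * Y < 2 ^ 14 * Y := by gcongr; norm_num
      _ ≤ Y ^ 14 * Y := by gcongr
      _ = Y ^ 15 := by ring
  have hUX : (4 * X ^ (1/30:ℝ)) * (4 * X ^ (1/30:ℝ)) < X / 2 := by
    rw [show (4 * X ^ (1/30:ℝ)) * (4 * X ^ (1/30:ℝ)) = 16 * (X ^ (1/30:ℝ)) ^ 2 by ring, h30]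
    linarith
  have hqX : (q:ℝ) ≤ X / 2 := by nlinarith
  have p1 := prime_sum k q a β X hX1 hqX
  have p2 := vaughan_main k q hk (ZMod.unitOfCoprime a hg) β X (4 * X ^ (1/30:ℝ)) D (le_trans (by norm_num) hX) (by linarith)
    hUX hDdef (by linarith)
  rw [ZMod.coe_unitOfCoprime] at p2
  refine p1.trans ((add_le_add p2 le_rfl).trans ?_)
  have hlog1 : 1 ≤ Real.log X := by
    rw [Real.le_log_iff_exp_le hX0]
    have := Real.exp_one_lt_d9
    have : (2:ℝ) ^ 15 = 32768 := by norm_num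
    linarith
  have hlog2 : Real.log (2 * X) = Real.log 2 + Real.log X := Real.log_mul (by norm_num) hX0.ne'
  have hlog3 : Real.log 2 ≤ 1 := by have := Real.log_two_lt_d9; linarith
  have hlog4 : 0 ≤ Real.log 2 := Real.log_nonneg (by norm_num)
  exact key_num (vC k) C1 _ X (Real.log X) (rc k q) D q _ hV (by linarith) hX (by linarith) (by linarith) hlog1 hq1 (Nat.cast_nonneg _) hqD (hrc q hq) hD rfl

lemma f_bound (k : ℕ) (hk : 1 ≤ k) (hk7 : k ≤ 7) : ∃ C : ℝ, 0 < C ∧ ∀ n : ℕ, (2:ℝ) ^ (945:ℕ) ≤ n → ∀ a q : ℕ, 1 ≤ q → Nat.gcd a q = 1 →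
    ∀ β : ℝ, q * (1 + n * |β|) ≤ 2 * (n:ℝ) ^ (1/270:ℝ) →
    ‖f n k ((a:ℝ) / q + β)‖ ≤ C * ((n:ℝ) ^ ((k:ℝ))⁻¹ * Real.log n ^ 5 * (q * (1 + n * |β|)) ^ (-(2/5):ℝ)) := by
  obtain ⟨C, hC, h⟩ := key_prop k hk
  refine ⟨C, hC, fun n hn a q hq hg β hD => ?_⟩
  have hn1 : (1:ℝ) ≤ n := le_trans (one_le_pow₀ (by norm_num)) hn
  have hn0 : (0:ℝ) < n := lt_of_lt_of_le one_pos hn1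
  have hkR : (1:ℝ) ≤ k := by exact_mod_cast hk
  have hk7R : (k:ℝ) ≤ 7 := by exact_mod_cast hk7
  have hk0 : (0:ℝ) < k := by linarith
  set X : ℝ := (n:ℝ) ^ ((k:ℝ))⁻¹ with hXdef
  have hXk : X ^ k = n := by
    rw [hXdef, ← Real.rpow_natCast, ← Real.rpow_mul hn0.le, inv_mul_cancel₀ hk0.ne', Real.rpow_one]
  have hX1 : 1 ≤ X := Real.one_le_rpow hn1 (by positivity)
  have hinv : (1/7:ℝ) ≤ (k:ℝ)⁻¹ := by rw [← one_div]; gcongr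
  have hX15 : (2:ℝ) ^ 15 ≤ X := by
    calc (2:ℝ) ^ 15 ≤ (2 ^ (945:ℕ)) ^ (1/7:ℝ) := by
          rw [← Real.rpow_natCast 2 945, ← Real.rpow_mul (by norm_num), ← Real.rpow_natCast 2 15]
          apply Real.rpow_le_rpow_of_exponent_le (by norm_num); norm_num
      _ ≤ (n:ℝ) ^ (1/7:ℝ) := by gcongr
      _ ≤ X := Real.rpow_le_rpow_of_exponent_le hn1 hinv
  have hDX : q * (1 + |β| * X ^ k) ≤ X ^ (1/30:ℝ) := by
    rw [hXk, mul_comm |β|]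
    refine hD.trans ?_
    have h2 : (2:ℝ) ≤ (n:ℝ) ^ (1/945:ℝ) := by
      calc (2:ℝ) = (2 ^ (945:ℕ)) ^ (1/945:ℝ) := by
            rw [← Real.rpow_natCast 2 945, ← Real.rpow_mul (by norm_num)]; norm_num
        _ ≤ _ := by gcongr
    calc 2 * (n:ℝ) ^ (1/270:ℝ) ≤ (n:ℝ) ^ (1/945:ℝ) * (n:ℝ) ^ (1/270:ℝ) := by gcongr
      _ = (n:ℝ) ^ (1/7 * (1/30) : ℝ) := by rw [← Real.rpow_add hn0]; norm_num
      _ ≤ (n:ℝ) ^ ((k:ℝ)⁻¹ * (1/30) : ℝ) := by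
          apply Real.rpow_le_rpow_of_exponent_le hn1
          gcongr
      _ = _ := by rw [Real.rpow_mul hn0.le]
  have h1 := h X hX15 a q hq hg β hDX
  have e1 : f n k ((a:ℝ) / q + β) = ∑ p ∈ (Ioc ⌊X/2⌋₊ ⌊X⌋₊).filter Nat.Prime, e (((a:ℝ) / q + β) * (p:ℝ) ^ k) * (Real.log p) := by
    unfold f
    refine sum_congr ?_ fun _ _ => rfl
    ext p
    simp only [mem_filter, mem_range, mem_Ioc]
    have hP : P n k = X := by unfold P; rfl
    rw [hP, Nat.floor_lt (by positivity), Nat.le_floor_iff (by positivity)]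
    constructor
    · rintro ⟨_, h1, h2, h3⟩; exact ⟨⟨h2, h3⟩, h1⟩
    · rintro ⟨⟨h2, h3⟩, h1⟩
      refine ⟨?_, h1, h2, h3⟩
      have hXn : X ≤ n := by
        rw [← hXk]; exact le_self_pow₀ hX1 (by omega)
      have : (p:ℝ) ≤ n := h3.trans hXn
      have : p ≤ n := by exact_mod_cast this
      omega
  rw [e1]
  refine h1.trans ?_
  rw [hXk, mul_comm |β|]
  have hlog : Real.log X ≤ Real.log n := by
    apply Real.log_le_log (by linarith)
    rw [← hXk]; exact le_self_pow₀ hX1 (by omega)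
  have hlog0 : 0 ≤ Real.log X := Real.log_nonneg hX1
  gcongr

lemma f5_bound (n c : ℕ) (α : ℝ) (hn : 1 ≤ n) (hθ0 : 0 ≤ θ c) (hθ1 : θ c ≤ 1) : ‖f5 n c α‖ ≤ (n:ℝ) ^ (θ c / 5) * Real.log n := by
  have hn1 : (1:ℝ) ≤ n := by exact_mod_cast hn
  have hn0 : (0:ℝ) < n := by linarith
  have hY : P n 5 ^ θ c = (n:ℝ) ^ (θ c / 5) := by
    unfold P
    rw [← Real.rpow_mul hn0.le]; congr 1; push_cast; ring
  unfold f5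
  rw [hY]
  have hlog0 : 0 ≤ Real.log n := Real.log_nonneg hn1
  calc _ ≤ ∑ p ∈ (range (n+1)).filter (fun p : ℕ => p.Prime ∧ 1 < (p:ℝ) ∧ (p:ℝ) ≤ (n:ℝ) ^ (θ c / 5)), Real.log n := by
        refine (norm_sum_le _ _).trans (sum_le_sum fun p hp => ?_)
        simp only [mem_filter, mem_range] at hp
        rw [norm_mul, norm_e, one_mul, Complex.norm_real, Real.norm_eq_abs, abs_of_nonneg (Real.log_natCast_nonneg p)]
        have : (p:ℝ) ≤ n := by exact_mod_cast (by omega : p ≤ n)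
        apply Real.log_le_log (by linarith [hp.2.2.1]) this
    _ ≤ (n:ℝ) ^ (θ c / 5) * Real.log n := by
        rw [sum_const, nsmul_eq_mul]
        gcongr
        have : (range (n+1)).filter (fun p : ℕ => p.Prime ∧ 1 < (p:ℝ) ∧ (p:ℝ) ≤ (n:ℝ) ^ (θ c / 5)) ⊆ Ioc 0 ⌊(n:ℝ) ^ (θ c / 5)⌋₊ := by
          intro p hp
          simp only [mem_filter, mem_range, mem_Ioc] at hp ⊢
          exact ⟨hp.2.1.pos, Nat.le_floor hp.2.2.2⟩
        have := card_le_card this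
        rw [Nat.card_Ioc, Nat.sub_zero] at this
        exact le_trans (by exact_mod_cast this) (Nat.floor_le (by positivity))

noncomputable def gmaj (n : ℕ) (α : ℝ) : ℝ :=
  ∑ q ∈ Ioc 0 n, ∑ a ∈ range (q+1), ((q:ℝ) ^ 2)⁻¹ * (1 + ((n:ℝ) * (α - (a:ℝ) / q)) ^ 2)⁻¹

lemma int_one (n x : ℝ) (hn : 0 < n) : Integrable (fun α : ℝ => (1 + (n * (α - x)) ^ 2)⁻¹) ∧
    ∫ α : ℝ, (1 + (n * (α - x)) ^ 2)⁻¹ = Real.pi / n := by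
  have h1 := integrable_inv_one_add_sq.comp_mul_left' hn.ne'
  have h2 := h1.comp_sub_right x
  refine ⟨h2, ?_⟩
  have h3 := integral_sub_right_eq_self (μ := (volume : Measure ℝ)) (fun t : ℝ => (1 + (n * t) ^ 2)⁻¹) x
  rw [h3]
  have h4 := Measure.integral_comp_mul_left (fun t : ℝ => (1 + t ^ 2)⁻¹) n
  rw [h4, integral_univ_inv_one_add_sq, abs_of_pos (by positivity), smul_eq_mul]
  ring

lemma gmaj_int (n : ℕ) (hn : 1 ≤ n) : Integrable (gmaj n) ∧ ∫ α, gmaj n α ≤ Real.pi / n * (2 * (1 + Real.log n)) := by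
  have hn0 : (0:ℝ) < n := by exact_mod_cast hn
  have hi : ∀ q ∈ Ioc 0 n, ∀ a ∈ range (q+1), Integrable (fun α : ℝ => ((q:ℝ) ^ 2)⁻¹ * (1 + ((n:ℝ) * (α - (a:ℝ) / q)) ^ 2)⁻¹) :=
    fun q _ a _ => ((int_one n ((a:ℝ)/q) hn0).1).const_mul _
  have hi2 : ∀ q ∈ Ioc 0 n, Integrable (fun α : ℝ => ∑ a ∈ range (q+1), ((q:ℝ) ^ 2)⁻¹ * (1 + ((n:ℝ) * (α - (a:ℝ) / q)) ^ 2)⁻¹) :=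
    fun q hq => integrable_finset_sum _ (hi q hq)
  have hg : gmaj n = fun α => ∑ q ∈ Ioc 0 n, ∑ a ∈ range (q+1), ((q:ℝ) ^ 2)⁻¹ * (1 + ((n:ℝ) * (α - (a:ℝ) / q)) ^ 2)⁻¹ := rfl
  refine ⟨by rw [hg]; exact integrable_finset_sum _ hi2, ?_⟩
  rw [hg, integral_finset_sum _ hi2]
  calc _ = ∑ q ∈ Ioc 0 n, ((q:ℝ) + 1) * (((q:ℝ) ^ 2)⁻¹ * (Real.pi / n)) := by
        refine sum_congr rfl fun q hq => ?_
        rw [integral_finset_sum _ (hi q hq)]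
        rw [sum_congr rfl (fun a _ => by rw [integral_const_mul, (int_one n ((a:ℝ)/q) hn0).2])]
        rw [sum_const, card_range, nsmul_eq_mul]; push_cast; rfl
    _ ≤ ∑ q ∈ Ioc 0 n, (Real.pi / n * 2) * (q:ℝ)⁻¹ := by
        refine sum_le_sum fun q hq => ?_
        rw [mem_Ioc] at hq
        have hq1 : (1:ℝ) ≤ q := by exact_mod_cast hq.1
        have hpi := Real.pi_pos
        calc _ ≤ ((q:ℝ) + q) * (((q:ℝ) ^ 2)⁻¹ * (Real.pi / n)) := by gcongr
          _ = _ := by field_simp; ring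
    _ = (Real.pi / n * 2) * ∑ q ∈ Ioc 0 n, (q:ℝ)⁻¹ := by rw [mul_sum]
    _ ≤ (Real.pi / n * 2) * (1 + Real.log n) := by
        have hpi := Real.pi_pos
        gcongr; exact sum_inv_le n
    _ = _ := by ring

lemma gmaj_ge (n a q : ℕ) (α : ℝ) (hq : 1 ≤ q) (hqn : q ≤ n) (ha : a ≤ q) :
    ((q:ℝ) * (1 + n * |α - (a:ℝ) / q|)) ^ (-2:ℝ) ≤ gmaj n α := by
  have hq0 : (0:ℝ) < q := by exact_mod_cast hq
  have h1 : ((q:ℝ) * (1 + n * |α - (a:ℝ) / q|)) ^ (-2:ℝ) ≤ ((q:ℝ) ^ 2)⁻¹ * (1 + ((n:ℝ) * (α - (a:ℝ) / q)) ^ 2)⁻¹ := by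
    rw [Real.rpow_neg (by positivity), Real.rpow_two, mul_pow, mul_inv]
    gcongr
    have : ((n:ℝ) * (α - (a:ℝ) / q)) ^ 2 = (n * |α - (a:ℝ) / q|) ^ 2 := by rw [mul_pow, mul_pow, sq_abs]
    rw [this]
    have : 0 ≤ n * |α - (a:ℝ) / q| := by positivity
    nlinarith
  refine h1.trans ?_
  unfold gmaj
  have h2 := single_le_sum (f := fun a : ℕ => ((q:ℝ) ^ 2)⁻¹ * (1 + ((n:ℝ) * (α - (a:ℝ) / q)) ^ 2)⁻¹) (s := range (q+1))
    (fun i _ => by positivity) (mem_range.2 (Nat.lt_succ_of_le ha))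
  have h3 := single_le_sum (f := fun q : ℕ => ∑ a ∈ range (q+1), ((q:ℝ) ^ 2)⁻¹ * (1 + ((n:ℝ) * (α - (a:ℝ) / q)) ^ 2)⁻¹) (s := Ioc 0 n)
    (fun i _ => sum_nonneg fun _ _ => by positivity) (mem_Ioc.2 ⟨hq, hqn⟩)
  exact h2.trans h3

lemma meas_Maj (n : ℕ) (B : ℝ) : MeasurableSet (Maj n B) := by
  unfold Maj
  measurability

lemma meas_R (n c : ℕ) : MeasurableSet (R n c) := by
  unfold R
  measurability

lemma prod_bound (x2 x3 x5 x6 xc C2 C3 C6 Cc p2 p3 p5 p6 pc L D : ℝ)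
    (h2 : 0 ≤ x2) (h3 : 0 ≤ x3) (h5 : 0 ≤ x5) (h6 : 0 ≤ x6) (hc : 0 ≤ xc)
    (b2 : x2 ≤ C2 * (p2 * L ^ 5 * D)) (b3 : x3 ≤ C3 * (p3 * L ^ 5 * D))
    (b5 : x5 ≤ p5 * L) (b6 : x6 ≤ C6 * (p6 * L ^ 5 * D)) (bc : xc ≤ Cc * (pc * L ^ 5 * D)) :
    x2 ^ 2 * x3 ^ 2 * x5 * x6 * xc ≤
      (C2 ^ 2 * C3 ^ 2 * C6 * Cc) * (p2 ^ 2 * p3 ^ 2 * p5 * p6 * pc) * L ^ 31 * D ^ 6 := by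
  calc x2 ^ 2 * x3 ^ 2 * x5 * x6 * xc
      ≤ (C2 * (p2 * L ^ 5 * D)) ^ 2 * (C3 * (p3 * L ^ 5 * D)) ^ 2 * (p5 * L) *
        (C6 * (p6 * L ^ 5 * D)) * (Cc * (pc * L ^ 5 * D)) := by
        have := h2.trans b2
        have := h3.trans b3
        have := h5.trans b5
        have := h6.trans b6
        have := hc.trans bc
        gcongr
    _ = _ := by ring

lemma pow_combine (n : ℝ) (hn : 0 < n) (t s : ℝ) :
    (n ^ (((2:ℕ):ℝ))⁻¹) ^ 2 * (n ^ (((3:ℕ):ℝ))⁻¹) ^ 2 * n ^ t * n ^ (((6:ℕ):ℝ))⁻¹ * n ^ s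
      = n * n ^ (2 / 3 + t + 1 / 6 + s) := by
  rw [← Real.rpow_natCast (n ^ (((2:ℕ):ℝ))⁻¹) 2, ← Real.rpow_natCast (n ^ (((3:ℕ):ℝ))⁻¹) 2,
    ← Real.rpow_mul hn.le, ← Real.rpow_mul hn.le]
  nth_rewrite 6 [← Real.rpow_one n]
  rw [← Real.rpow_add hn, ← Real.rpow_add hn, ← Real.rpow_add hn, ← Real.rpow_add hn, ← Real.rpow_add hn]
  congr 1
  push_cast
  ring

lemma D_combine (D L B : ℝ) (hL : 1 ≤ L) (hB : 85 ≤ B) (hD : L ^ B ≤ D) :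
    L ^ 31 * (D ^ (-(2/5):ℝ)) ^ 6 ≤ (L ^ 3)⁻¹ * D ^ (-2:ℝ) := by
  have hL0 : 0 < L := by linarith
  have hLB : 0 < L ^ B := Real.rpow_pos_of_pos hL0 B
  have hD0 : 0 < D := lt_of_lt_of_le hLB hD
  have e1 : (D ^ (-(2/5):ℝ)) ^ 6 = D ^ (-2:ℝ) * D ^ (-(2/5):ℝ) := by
    rw [← Real.rpow_natCast, ← Real.rpow_mul hD0.le, ← Real.rpow_add hD0]
    norm_num
  have e2 : D ^ (-(2/5):ℝ) ≤ (L ^ 34)⁻¹ := by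
    calc D ^ (-(2/5):ℝ) ≤ (L ^ B) ^ (-(2/5):ℝ) :=
          Real.rpow_le_rpow_of_nonpos hLB hD (by norm_num)
      _ = L ^ (B * (-(2/5))) := by rw [← Real.rpow_mul hL0.le]
      _ ≤ L ^ (-((34:ℕ):ℝ)) := by
          apply Real.rpow_le_rpow_of_exponent_le hL
          push_cast
          linarith
      _ = _ := by rw [Real.rpow_neg hL0.le, Real.rpow_natCast]
  rw [e1]
  calc L ^ 31 * (D ^ (-2:ℝ) * D ^ (-(2/5):ℝ)) ≤ L ^ 31 * (D ^ (-2:ℝ) * (L ^ 34)⁻¹) := by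
        gcongr
    _ = _ := by field_simp

lemma pointwise_bound (c : ℕ) (hc : c = 6 ∨ c = 7) : ∃ K : ℝ, 0 < K ∧ ∀ B : ℝ, 85 ≤ B →
    ∀ n : ℕ, (2:ℝ) ^ (945:ℕ) ≤ n → 1 ≤ Real.log n → ∀ α ∈ R n c \ Maj n B,
      ‖F n c α‖ ≤ (K * (n * (n:ℝ) ^ Θ c) * (Real.log n ^ 3)⁻¹) * gmaj n α := by
  obtain ⟨C2, hC2, b2⟩ := f_bound 2 (by norm_num) (by norm_num)
  obtain ⟨C3, hC3, b3⟩ := f_bound 3 (by norm_num) (by norm_num)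
  obtain ⟨C6, hC6, b6⟩ := f_bound 6 (by norm_num) (by norm_num)
  obtain ⟨Cc, hCc, bc⟩ := f_bound c (by omega) (by omega)
  refine ⟨C2 ^ 2 * C3 ^ 2 * C6 * Cc, by positivity, ?_⟩
  rintro B hB n hn hL α ⟨⟨hα, a, q, haq, hq, hqQ, hg, hR⟩, hM⟩
  have hn1 : (1:ℝ) ≤ n := le_trans (one_le_pow₀ (by norm_num)) hn
  replace b2 := b2 n hn a q hq hg (α - (a:ℝ)/q)
  replace b3 := b3 n hn a q hq hg (α - (a:ℝ)/q)
  replace b6 := b6 n hn a q hq hg (α - (a:ℝ)/q)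
  replace bc := bc n hn a q hq hg (α - (a:ℝ)/q)
  clear hn
  have hn0 : (0:ℝ) < n := lt_of_lt_of_le one_pos hn1
  have hq1 : (1:ℝ) ≤ q := by exact_mod_cast hq
  have hq0 : (0:ℝ) < q := by linarith
  have hQ : Q n c ≤ (n:ℝ) ^ (1/270:ℝ) := by
    unfold Q
    apply Real.rpow_le_rpow_of_exponent_le hn1
    rcases hc with rfl | rfl <;> norm_num
  have hQn : (n:ℝ) ^ (1/270:ℝ) ≤ n := by
    calc (n:ℝ) ^ (1/270:ℝ) ≤ (n:ℝ) ^ (1:ℝ) := Real.rpow_le_rpow_of_exponent_le hn1 (by norm_num)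
      _ = n := Real.rpow_one _
  have hqn : q ≤ n := by
    have : (q:ℝ) ≤ n := hqQ.trans (hQ.trans hQn)
    exact_mod_cast this
  have hqb : (q:ℝ) * (n * |α - (a:ℝ)/q|) ≤ Q n c := by
    have e1 : (q:ℝ) * α - a = q * (α - (a:ℝ)/q) := by field_simp
    rw [e1, abs_mul, abs_of_pos hq0, le_div_iff₀ hn0] at hR
    linarith
  have hD2 : (q:ℝ) * (1 + n * |α - (a:ℝ)/q|) ≤ 2 * (n:ℝ) ^ (1/270:ℝ) := by
    rw [mul_add]; linarith
  have hnb : 0 ≤ (n:ℝ) * |α - (a:ℝ)/q| := by positivity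
  have hDL : Real.log n ^ B ≤ (q:ℝ) * (1 + n * |α - (a:ℝ)/q|) := by
    by_contra hcon
    push Not at hcon
    apply hM
    refine ⟨hα, a, q, haq, hq, ?_, hg, ?_⟩
    · nlinarith
    · rw [le_div_iff₀ hn0]
      nlinarith
  have eα : (a:ℝ)/q + (α - (a:ℝ)/q) = α := by ring
  rw [eα] at b2 b3 b6 bc
  have hθ : 0 ≤ θ c ∧ θ c ≤ 1 := by
    unfold θ
    rcases hc with rfl | rfl <;> norm_num
  have b5 := f5_bound n c α (by exact_mod_cast hn1) hθ.1 hθ.2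
  have hg2 := gmaj_ge n a q α hq hqn haq
  have hp := prod_bound _ _ _ _ _ _ _ _ _ _ _ _ _ _ _ _ (norm_nonneg _) (norm_nonneg _) (norm_nonneg _)
    (norm_nonneg _) (norm_nonneg _) (b2 hD2) (b3 hD2) b5 (b6 hD2) (bc hD2)
  have eF : ‖F n c α‖ = ‖f n 2 α‖ ^ 2 * ‖f n 3 α‖ ^ 2 * ‖f5 n c α‖ * ‖f n 6 α‖ * ‖f n c α‖ := by
    unfold F
    simp only [norm_mul, norm_pow]
  rw [eF]
  refine hp.trans ?_
  rw [pow_combine n hn0]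
  have hd := D_combine _ _ B hL hB hDL
  have eΘ : Θ c = 2 / 3 + θ c / 5 + 1 / 6 + ((c:ℝ))⁻¹ := by
    unfold Θ
    norm_num
  rw [← eΘ, mul_assoc _ (Real.log n ^ 31), mul_assoc _ (Real.log n ^ 3)⁻¹]
  have hK : 0 ≤ C2 ^ 2 * C3 ^ 2 * C6 * Cc * (n * (n:ℝ) ^ Θ c) := by positivity
  refine mul_le_mul_of_nonneg_left (hd.trans ?_) hK
  refine mul_le_mul_of_nonneg_left hg2 ?_
  positivity

lemma final_num (K n T L G : ℝ) (hK : 0 < K) (hn : 0 < n) (hT : 0 ≤ T) (hL : 1 ≤ L)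
    (hG : G ≤ Real.pi / n * (2 * (1 + L))) :
    (K * (n * T) * (L ^ 3)⁻¹) * G ≤ K * Real.pi * 4 * T * L⁻¹ := by
  have hL0 : 0 < L := by linarith
  have hpi := Real.pi_pos
  calc (K * (n * T) * (L ^ 3)⁻¹) * G ≤ (K * (n * T) * (L ^ 3)⁻¹) * (Real.pi / n * (2 * (1 + L))) := by
        gcongr
    _ = (K * Real.pi * T) * ((L ^ 3)⁻¹ * (2 * (1 + L))) := by field_simp
    _ ≤ (K * Real.pi * T) * (4 * L⁻¹) := by
        refine mul_le_mul_of_nonneg_left ?_ (by positivity)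
        rw [inv_mul_le_iff₀ (by positivity)]
        have : L ^ 3 * (4 * L⁻¹) = 4 * L ^ 2 := by field_simp
        rw [this]
        nlinarith
    _ = _ := by ring

theorem pruning (c : ℕ) (hc : c = 6 ∨ c = 7) :
    ∃ B0 : ℝ, 1 ≤ B0 ∧ ∀ B : ℝ, B0 ≤ B →
      ∃ C' : ℝ, 0 < C' ∧ ∃ N : ℕ, ∀ n : ℕ, N ≤ n →
        (∫ α in R n c \ Maj n B, ‖F n c α‖) ≤
          C' * (n : ℝ) ^ Θ c * (Real.log n)⁻¹ := by
  obtain ⟨K, hK, hpt⟩ := pointwise_bound c hc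
  refine ⟨85, by norm_num, fun B hB => ⟨K * Real.pi * 4, by positivity, ?_⟩⟩
  obtain ⟨N, hN⟩ := exists_nat_ge ((2:ℝ) ^ (945:ℕ))
  refine ⟨max N 3, fun n hn => ?_⟩
  have hnN : (N:ℝ) ≤ n := by exact_mod_cast (le_max_left _ _).trans hn
  have hn3 : (3:ℝ) ≤ n := by exact_mod_cast (le_max_right _ _).trans hn
  replace hpt := hpt B hB n (hN.trans hnN)
  clear hN
  have hn0 : (0:ℝ) < n := by linarith
  have hL : 1 ≤ Real.log n := by
    rw [Real.le_log_iff_exp_le hn0]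
    linarith [Real.exp_one_lt_d9]
  obtain ⟨hintg, hval⟩ := gmaj_int n (by exact_mod_cast (by linarith : (1:ℝ) ≤ n))
  have hmeas : MeasurableSet (R n c \ Maj n B) := (meas_R n c).diff (meas_Maj n B)
  set Z : ℝ := K * (n * (n:ℝ) ^ Θ c) * (Real.log n ^ 3)⁻¹ with hZ
  have hZ0 : 0 ≤ Z := by positivity
  have hg0 : ∀ α, 0 ≤ gmaj n α := fun α => by unfold gmaj; positivity
  calc (∫ α in R n c \ Maj n B, ‖F n c α‖) ≤ ∫ α in R n c \ Maj n B, Z * gmaj n α := by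
        refine integral_mono_of_nonneg (Filter.Eventually.of_forall fun _ => norm_nonneg _)
          (hintg.const_mul Z).integrableOn ?_
        exact (ae_restrict_iff' hmeas).2 (Filter.Eventually.of_forall fun α hα => hpt hL α hα)
    _ ≤ ∫ α, Z * gmaj n α :=
        setIntegral_le_integral (hintg.const_mul Z)
          (Filter.Eventually.of_forall fun α => mul_nonneg hZ0 (hg0 α))
    _ = Z * ∫ α, gmaj n α := integral_const_mul _ _
    _ ≤ _ := final_num K n _ _ _ hK hn0 (by positivity) hL hval
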